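/- Let K ⊂ ℝⁿ be a convex body with 0 in its interior, let Φ be an n-dimensional Young function, and let u ∈ V^{1,1}_d(ℝⁿ). Then for a.e. t ∈ (ess inf u, ess sup u): ∫_{{u=t}} Φ(∇u)/|∇u| dH^{n−1} ≥ ∫_{{u^K=t}} Φ_{•K•}(∇u^K)/|∇u^K| dH^{n−1}. -/

import Mathlib

open MeasureTheory Filter Set
open scoped ENNReal NNReal Topology Pointwise symmDiff RealInnerProductSpace

noncomputable section

/-- Euclidean space `ℝⁿ`. -/
abbrev Euc (n : ℕ) := EuclideanSpace ℝ (Fin n)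

/-- Convexity for `ℝ≥0∞`-valued functions on `ℝⁿ`. -/
def ConvexOnE {n : ℕ} (Φ : Euc n → ℝ≥0∞) : Prop :=
  ∀ x y : Euc n, ∀ a b : ℝ, 0 ≤ a → 0 ≤ b → a + b = 1 →
    Φ (a • x + b • y) ≤ ENNReal.ofReal a * Φ x + ENNReal.ofReal b * Φ y

/-- Strict convexity for `ℝ≥0∞`-valued functions on `ℝⁿ`. -/
def StrictConvexOnE {n : ℕ} (Φ : Euc n → ℝ≥0∞) : Prop :=
  ∀ x y : Euc n, x ≠ y → ∀ a b : ℝ, 0 < a → 0 < b → a + b = 1 →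
    Φ (a • x + b • y) < ENNReal.ofReal a * Φ x + ENNReal.ofReal b * Φ y

/-- An `n`-dimensional Young function: convex, lower semicontinuous, finite near `0`,
vanishing at `0`, tending to `∞` at infinity. -/
structure IsNYoung {n : ℕ} (Φ : Euc n → ℝ≥0∞) : Prop where
  convex : ConvexOnE Φ
  lsc : LowerSemicontinuous Φ
  finite_near_zero : ∃ ε : ℝ, 0 < ε ∧ ∀ x : Euc n, ‖x‖ < ε → Φ x ≠ ⊤
  map_zero : Φ 0 = 0
  coercive : Tendsto Φ (Bornology.cobounded (Euc n)) (𝓝 ⊤)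

/-- A convex body: a compact convex set. -/
def IsConvexBody {n : ℕ} (K : Set (Euc n)) : Prop :=
  IsCompact K ∧ Convex ℝ K

/-- The Young conjugate (Legendre transform) `Φ_•(ξ) = sup_η (⟨ξ,η⟩ - Φ(η))`,
`ℝ≥0∞`-valued (the supremum is nonnegative whenever `Φ 0 = 0`). -/
def yconj {n : ℕ} (Φ : Euc n → ℝ≥0∞) (ξ : Euc n) : ℝ≥0∞ :=
  ⨆ η : Euc n, ENNReal.ofReal ⟪ξ, η⟫ - Φ η

/-- The subgradient of an `ℝ≥0∞`-valued function. -/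
def subgrad {n : ℕ} (Ψ : Euc n → ℝ≥0∞) (ξ : Euc n) : Set (Euc n) :=
  {ζ | ∀ η : Euc n, (Ψ ξ : EReal) + ((⟪ζ, η - ξ⟫ : ℝ) : EReal) ≤ (Ψ η : EReal)}

/-- The support function of a set, real-valued. -/
def suppFnR {n : ℕ} (C : Set (Euc n)) (ξ : Euc n) : ℝ :=
  sSup ((fun η => ⟪ξ, η⟫) '' C)

/-- The support function of a set, `EReal`-valued. -/
def suppFnE {n : ℕ} (C : Set (Euc n)) (ξ : Euc n) : EReal :=
  ⨆ η ∈ C, ((⟪ξ, η⟫ : ℝ) : EReal)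

/-- The polar body `L° = {x : ⟨x,y⟩ ≤ 1 ∀ y ∈ L}`. -/
def polarBody {n : ℕ} (L : Set (Euc n)) : Set (Euc n) :=
  {x | ∀ y ∈ L, ⟪x, y⟫ ≤ 1}

/-- `E^K`: the dilate `cK` of `K` with `|cK| = |E|`. -/
def setSymm {n : ℕ} (K E : Set (Euc n)) : Set (Euc n) :=
  (((volume E).toReal / (volume K).toReal) ^ ((1 : ℝ) / n)) • K

/-- The distribution function `μ(t) = |{u > t}|`. -/
def distFn {n : ℕ} (u : Euc n → ℝ) (t : ℝ) : ℝ≥0∞ := volume {x | t < u x}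

/-- The decreasing rearrangement `u*(s) = inf {t : μ(t) ≤ s}`. -/
def decRearr {n : ℕ} (u : Euc n → ℝ) (s : ℝ) : ℝ :=
  sInf {t : ℝ | distFn u t ≤ ENNReal.ofReal s}

/-- The symmetral `u^K(x) = u*(|K| H₀^K(x)ⁿ)` of `u` with respect to `K`. -/
def funcSymm {n : ℕ} (K : Set (Euc n)) (u : Euc n → ℝ) (x : Euc n) : ℝ :=
  decRearr u ((volume K).toReal * gauge K x ^ n)

/-- The symmetral `Ψ_K` of an `n`-dimensional Young function `Ψ` with respect to `K`,
characterized by `{Ψ_K ≤ t} = −({Ψ ≤ t}^K)`; equivalently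
`Ψ_K(ξ) = inf {t : |K| H₀^K(−ξ)ⁿ ≤ |{Ψ ≤ t}|}`. -/
def youngSymm {n : ℕ} (K : Set (Euc n)) (Ψ : Euc n → ℝ≥0∞) (ξ : Euc n) : ℝ≥0∞ :=
  sInf {t : ℝ≥0∞ | volume K * ENNReal.ofReal (gauge K (-ξ) ^ n) ≤ volume {η | Ψ η ≤ t}}

/-- The essential infimum of a real function on `ℝⁿ`, valued in `EReal`. -/
def eInf {n : ℕ} (u : Euc n → ℝ) : EReal := essInf (fun x => (u x : EReal)) volume

/-- The essential supremum of a real function on `ℝⁿ`, valued in `EReal`. -/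
def eSup {n : ℕ} (u : Euc n → ℝ) : EReal := essSup (fun x => (u x : EReal)) volume

/-- `u ∈ M_d(ℝⁿ)`: measurable with `|{u > t}| < ∞` for all `t > ess inf u`. -/
def MemMd {n : ℕ} (u : Euc n → ℝ) : Prop :=
  Measurable u ∧ ∀ t : ℝ, eInf u < (t : EReal) → distFn u t < ⊤

/-- `g` is the weak gradient of `u ∈ W^{1,1}_loc(ℝⁿ)`. -/
def HasWeakGradient {n : ℕ} (u : Euc n → ℝ) (g : Euc n → Euc n) : Prop :=
  LocallyIntegrable u volume ∧ LocallyIntegrable g volume ∧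
    ∀ φ : Euc n → ℝ, ContDiff ℝ (⊤ : ℕ∞) φ → HasCompactSupport φ →
      ∀ v : Euc n, ∫ x, u x * fderiv ℝ φ x v = - ∫ x, ⟪g x, v⟫ * φ x

/-- `u ∈ V^{1,Φ}_d(ℝⁿ)`, with weak gradient `g` and `∫ Φ(∇u) < ∞`. -/
def MemV1d {n : ℕ} (Φ : Euc n → ℝ≥0∞) (u : Euc n → ℝ) (g : Euc n → Euc n) : Prop :=
  HasWeakGradient u g ∧ MemMd u ∧ ∫⁻ x, Φ (g x) < ⊤

/-- A one-dimensional Young function (on `[0,∞)`, extended arbitrarily to `ℝ`). -/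
structure IsYoung1 (A : ℝ → ℝ≥0∞) : Prop where
  map_zero : A 0 = 0
  convex : ∀ x y : ℝ, 0 ≤ x → 0 ≤ y → ∀ a b : ℝ, 0 ≤ a → 0 ≤ b → a + b = 1 →
    A (a * x + b * y) ≤ ENNReal.ofReal a * A x + ENNReal.ofReal b * A y
  left_cont : ∀ t : ℝ, 0 < t → Tendsto A (𝓝[<] t) (𝓝 (A t))
  nonconst : ∃ s t : ℝ, 0 < s ∧ 0 < t ∧ A s ≠ A t

/-- The Young conjugate of a one-dimensional Young function. -/
def yconj1 (A : ℝ → ℝ≥0∞) (t : ℝ) : ℝ≥0∞ :=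
  ⨆ (s : ℝ) (_ : 0 ≤ s), ENNReal.ofReal (s * t) - A s

/-- The generalized (right-continuous) inverse of a one-dimensional Young function. -/
def rinv (A : ℝ → ℝ≥0∞) (s : ℝ≥0∞) : ℝ :=
  sSup {t : ℝ | 0 ≤ t ∧ A t ≤ s}

/-- One-dimensional Brunn–Minkowski inequality for compact sets. -/
lemma volume_add_volume_le_of_isCompact {A B : Set ℝ} (hA : IsCompact A) (hB : IsCompact B)
    (hA' : A.Nonempty) (hB' : B.Nonempty) : volume A + volume B ≤ volume (A + B) := by
  set a := sSup A
  set b := sInf B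
  have ha : a ∈ A := hA.sSup_mem hA'
  have hb : b ∈ B := hB.sInf_mem hB'
  have h1 : volume ((fun x => x + b) '' A) = volume A := by
    rw [image_add_right, measure_preimage_add_right]
  have h2 : volume ((fun x => a + x) '' B) = volume B := by
    rw [image_add_left, measure_preimage_add]
  have hdis : AEDisjoint volume ((fun x => x + b) '' A) ((fun x => a + x) '' B) := by
    refine measure_mono_null (t := {a + b}) ?_ (by simp)
    rintro _ ⟨⟨x, hx, rfl⟩, ⟨y, hy, hxy⟩⟩
    have hxa : x ≤ a := le_csSup hA.bddAbove hx
    have hyb : b ≤ y := csInf_le hB.bddBelow hy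
    simp only [mem_singleton_iff] at *
    linarith
  have hm : NullMeasurableSet ((fun x => a + x) '' B) volume :=
    (hB.image (by fun_prop)).measurableSet.nullMeasurableSet
  rw [← h1, ← h2, ← measure_union₀ hm hdis]
  refine measure_mono (union_subset ?_ ?_)
  · rintro _ ⟨x, hx, rfl⟩
    exact add_mem_add hx hb
  · rintro _ ⟨x, hx, rfl⟩
    exact add_mem_add ha hx

/-- One-dimensional Brunn–Minkowski inequality for measurable sets. -/
lemma volume_add_volume_le {A B : Set ℝ} (hA : MeasurableSet A) (hB : MeasurableSet B)
    (hA' : A.Nonempty) (hB' : B.Nonempty) : volume A + volume B ≤ volume (A + B) := by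
  have key : ∀ K L : Set ℝ, K ⊆ A → L ⊆ B → IsCompact K → IsCompact L →
      volume K + volume L ≤ volume (A + B) := by
    intro K L hK hL hKc hLc
    obtain ⟨a, ha⟩ := hA'
    obtain ⟨b, hb⟩ := hB'
    have h := volume_add_volume_le_of_isCompact (hKc.union (isCompact_singleton (x := a)))
      (hLc.union (isCompact_singleton (x := b))) ⟨a, by simp⟩ ⟨b, by simp⟩
    calc volume K + volume L ≤ volume (K ∪ {a}) + volume (L ∪ {b}) := by
          gcongr <;> exact subset_union_left
      _ ≤ _ := h.trans (measure_mono (add_subset_add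
        (union_subset hK (by simpa using ha)) (union_subset hL (by simpa using hb))))
  have key2 : ∀ L : Set ℝ, L ⊆ B → IsCompact L → volume A + volume L ≤ volume (A + B) := by
    intro L hL hLc
    have hfin : volume L ≠ ⊤ := hLc.measure_lt_top.ne
    have : volume A ≤ volume (A + B) - volume L := by
      rw [hA.measure_eq_iSup_isCompact]
      refine iSup_le fun K => iSup_le fun hK => iSup_le fun hKc => ?_
      exact ENNReal.le_sub_of_add_le_right hfin (key K L hK hL hKc hLc)
    have h0 : volume L ≤ volume (A + B) := le_trans le_add_self (key ∅ L (by simp) hL (by simp) hLc)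
    calc volume A + volume L ≤ volume (A + B) - volume L + volume L := by gcongr
      _ = volume (A + B) := tsub_add_cancel_of_le h0
  by_cases hfin : volume A = ⊤
  · have := key2 ∅ (by simp) (by simp)
    rw [hfin] at this ⊢
    simpa using this
  · have : volume B ≤ volume (A + B) - volume A := by
      rw [hB.measure_eq_iSup_isCompact]
      refine iSup_le fun K => iSup_le fun hK => iSup_le fun hKc => ?_
      exact ENNReal.le_sub_of_add_le_left hfin (key2 K hK hKc)
    have h0 : volume A ≤ volume (A + B) := le_trans le_self_add (key2 ∅ (by simp) (by simp))
    calc volume A + volume B ≤ volume A + (volume (A + B) - volume A) := by gcongr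
      _ = volume (A + B) := add_tsub_cancel_of_le h0

lemma lintegral_eq_mul_lintegral_meas_lt {f : ℝ → ℝ≥0∞} (hf : Measurable f) {M : ℝ≥0∞}
    (hM : M ≠ 0) (hM' : M ≠ ⊤) (hfM : ∀ x, f x ≤ M) :
    ∫⁻ x, f x = M * ∫⁻ σ in Ioo (0 : ℝ) 1, volume {x | ENNReal.ofReal σ * M < f x} := by
  have hle : ∀ x, f x / M ≤ 1 := fun x => ENNReal.div_le_of_le_mul (by simpa using hfM x)
  have hne : ∀ x, f x / M ≠ ⊤ := fun x => ((hle x).trans_lt (by simp)).ne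
  have h1 : ∫⁻ x, f x = M * ∫⁻ x, ENNReal.ofReal (f x / M).toReal := by
    rw [← lintegral_const_mul _ (by fun_prop)]
    refine lintegral_congr fun x => ?_
    rw [ENNReal.ofReal_toReal (hne x), ENNReal.mul_div_cancel hM hM']
  rw [h1, lintegral_eq_lintegral_meas_lt volume (ae_of_all _ fun x => ENNReal.toReal_nonneg)
    (by fun_prop)]
  congr 1
  have hset : ∀ σ ∈ Ioi (0 : ℝ), {x | σ < (f x / M).toReal} = {x | ENNReal.ofReal σ * M < f x} := by
    intro σ hσ
    ext x
    simp only [mem_ofPred_eq]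
    rw [← ENNReal.ofReal_lt_iff_lt_toReal (le_of_lt hσ) (hne x),
      ENNReal.lt_div_iff_mul_lt (Or.inl hM) (Or.inl hM')]
  rw [setLIntegral_congr_fun measurableSet_Ioi (fun σ hσ => by rw [hset σ hσ])]
  refine le_antisymm ?_ (lintegral_mono_set Ioo_subset_Ioi_self)
  rw [setLIntegral_congr Ioo_ae_eq_Ioc, ← lintegral_indicator measurableSet_Ioi,
    ← lintegral_indicator measurableSet_Ioc]
  refine lintegral_mono fun σ => ?_
  by_cases h0 : 0 < σ
  · by_cases h1 : σ ≤ 1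
    · rw [indicator_of_mem (show σ ∈ Ioc (0 : ℝ) 1 from ⟨h0, h1⟩)]
      exact indicator_le_self _ _ _
    · rw [indicator_of_mem (show σ ∈ Ioi (0 : ℝ) from h0)]
      have : {x | ENNReal.ofReal σ * M < f x} = ∅ := by
        ext x
        simp only [mem_ofPred_eq, mem_empty_iff_false, iff_false, not_lt]
        refine (hfM x).trans ?_
        calc M = 1 * M := (one_mul M).symm
          _ ≤ ENNReal.ofReal σ * M := by
            gcongr
            rw [← ENNReal.ofReal_one]
            exact ENNReal.ofReal_le_ofReal (not_le.1 h1).le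
      simp [this]
  · rw [indicator_of_notMem (show σ ∉ Ioi (0 : ℝ) from h0)]
    exact zero_le

lemma mul_lintegral_meas_lt_le {f : ℝ → ℝ≥0∞} (hf : Measurable f) {M : ℝ≥0∞}
    (hM : M ≠ 0) (hM' : M ≠ ⊤) :
    M * ∫⁻ σ in Ioo (0 : ℝ) 1, volume {x | ENNReal.ofReal σ * M < f x} ≤ ∫⁻ x, f x := by
  have h := lintegral_eq_mul_lintegral_meas_lt (f := fun x => min (f x) M) (by fun_prop) hM hM'
    (fun x => min_le_right _ _)
  calc _ = ∫⁻ x, min (f x) M := by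
        rw [h]
        congr 1
        refine setLIntegral_congr_fun measurableSet_Ioo fun σ hσ => ?_
        have : ENNReal.ofReal σ * M < M := by
          calc ENNReal.ofReal σ * M < 1 * M := by
                refine ENNReal.mul_lt_mul_left hM hM' ?_
                rw [← ENNReal.ofReal_one]
                exact (ENNReal.ofReal_lt_ofReal_iff one_pos).2 hσ.2
            _ = M := one_mul M
        simp [this]
    _ ≤ _ := lintegral_mono fun x => min_le_left _ _

lemma ENNReal.rpow_mul_rpow_le_add {l : ℝ} (hl : 0 < l) (hl' : l < 1) (a b : ℝ≥0∞) :
    a ^ (1 - l) * b ^ l ≤ ENNReal.ofReal (1 - l) * a + ENNReal.ofReal l * b := by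
  have hl1 : 0 < 1 - l := by linarith
  by_cases ha : a = ⊤
  · rw [ha, ENNReal.mul_top (by simpa using hl1)]; simp
  by_cases hb : b = ⊤
  · rw [hb, ENNReal.mul_top (by simpa using hl)]; simp
  lift a to ℝ≥0 using ha
  lift b to ℝ≥0 using hb
  have := NNReal.geom_mean_le_arith_mean2_weighted (1 - l).toNNReal l.toNNReal a b (by
    rw [← Real.toNNReal_add hl1.le hl.le]; simp)
  rw [Real.coe_toNNReal _ hl1.le, Real.coe_toNNReal _ hl.le] at this
  rw [← ENNReal.coe_rpow_of_nonneg _ hl1.le, ← ENNReal.coe_rpow_of_nonneg _ hl.le]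
  simp only [ENNReal.ofReal]
  exact_mod_cast this

/-- The Prékopa–Leindler inequality on the line, for bounded functions. -/
lemma prekopaLeindler_real_of_bounded {l : ℝ} (hl : 0 < l) (hl' : l < 1) {f g h : ℝ → ℝ≥0∞}
    (hf : Measurable f) (hg : Measurable g) (hh : Measurable h) {N : ℝ≥0∞} (hN : N ≠ ⊤)
    (hfN : ∀ x, f x ≤ N) (hgN : ∀ x, g x ≤ N)
    (H : ∀ x y, f x ^ (1 - l) * g y ^ l ≤ h ((1 - l) * x + l * y)) :
    (∫⁻ x, f x) ^ (1 - l) * (∫⁻ x, g x) ^ l ≤ ∫⁻ x, h x := by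
  have hl1 : 0 < 1 - l := by linarith
  set Mf := ⨆ x, f x with hMf
  set Mg := ⨆ x, g x with hMg
  have hMft : Mf ≠ ⊤ := ((iSup_le hfN).trans_lt hN.lt_top).ne
  have hMgt : Mg ≠ ⊤ := ((iSup_le hgN).trans_lt hN.lt_top).ne
  by_cases hMf0 : Mf = 0
  · have : ∀ x, f x = 0 := fun x => le_antisymm ((le_iSup f x).trans hMf0.le) zero_le
    simp [this, hl1]
  by_cases hMg0 : Mg = 0
  · have : ∀ x, g x = 0 := fun x => le_antisymm ((le_iSup g x).trans hMg0.le) zero_le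
    simp [this, hl]
  set M := Mf ^ (1 - l) * Mg ^ l with hM
  have hM0 : M ≠ 0 := by
    simp [hM, ENNReal.rpow_eq_zero_iff, hMf0, hMg0, hMft, hMgt]
  have hMt : M ≠ ⊤ := ENNReal.mul_ne_top (ENNReal.rpow_ne_top_of_nonneg hl1.le hMft)
    (ENNReal.rpow_ne_top_of_nonneg hl.le hMgt)
  set If := ∫⁻ σ in Ioo (0 : ℝ) 1, volume {x | ENNReal.ofReal σ * Mf < f x} with hIf
  set Ig := ∫⁻ σ in Ioo (0 : ℝ) 1, volume {x | ENNReal.ofReal σ * Mg < g x} with hIg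
  have hf1 := lintegral_eq_mul_lintegral_meas_lt hf hMf0 hMft (fun x => le_iSup f x)
  have hg1 := lintegral_eq_mul_lintegral_meas_lt hg hMg0 hMgt (fun x => le_iSup g x)
  rw [hf1, hg1]
  have hlt : ∀ σ ∈ Ioo (0 : ℝ) 1, ∀ c : ℝ≥0∞, c ≠ 0 → c ≠ ⊤ → ENNReal.ofReal σ * c < c := by
    intro σ hσ c hc hc'
    calc ENNReal.ofReal σ * c < 1 * c := by
          refine ENNReal.mul_lt_mul_left hc hc' ?_
          rw [← ENNReal.ofReal_one]
          exact (ENNReal.ofReal_lt_ofReal_iff one_pos).2 hσ.2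
      _ = c := one_mul c
  have hmeas : ∀ σ ∈ Ioo (0 : ℝ) 1,
      ENNReal.ofReal (1 - l) * volume {x | ENNReal.ofReal σ * Mf < f x} +
        ENNReal.ofReal l * volume {x | ENNReal.ofReal σ * Mg < g x} ≤
      volume {x | ENNReal.ofReal σ * M < h x} := by
    intro σ hσ
    have hA : MeasurableSet {x | ENNReal.ofReal σ * Mf < f x} := hf measurableSet_Ioi
    have hB : MeasurableSet {x | ENNReal.ofReal σ * Mg < g x} := hg measurableSet_Ioi
    have hA' : {x | ENNReal.ofReal σ * Mf < f x}.Nonempty := lt_iSup_iff.1 (hlt σ hσ Mf hMf0 hMft)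
    have hB' : {x | ENNReal.ofReal σ * Mg < g x}.Nonempty := lt_iSup_iff.1 (hlt σ hσ Mg hMg0 hMgt)
    have h1 : volume ((1 - l) • {x | ENNReal.ofReal σ * Mf < f x}) =
        ENNReal.ofReal (1 - l) * volume {x | ENNReal.ofReal σ * Mf < f x} := by
      simp [Measure.addHaar_smul, abs_of_pos hl1]
    have h2 : volume (l • {x | ENNReal.ofReal σ * Mg < g x}) =
        ENNReal.ofReal l * volume {x | ENNReal.ofReal σ * Mg < g x} := by
      simp [Measure.addHaar_smul, abs_of_pos hl]
    rw [← h1, ← h2]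
    refine (volume_add_volume_le (hA.const_smul₀ _) (hB.const_smul₀ _) (hA'.smul_set)
      (hB'.smul_set)).trans (measure_mono ?_)
    rintro _ ⟨_, ⟨x, hx, rfl⟩, _, ⟨y, hy, rfl⟩, rfl⟩
    refine lt_of_lt_of_le ?_ (H x y)
    have hσ0 : ENNReal.ofReal σ ≠ 0 := by simpa using hσ.1
    have e : ENNReal.ofReal σ * M =
        (ENNReal.ofReal σ * Mf) ^ (1 - l) * (ENNReal.ofReal σ * Mg) ^ l := by
      rw [ENNReal.mul_rpow_of_nonneg _ _ hl1.le, ENNReal.mul_rpow_of_nonneg _ _ hl.le, hM,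
        mul_mul_mul_comm, ← ENNReal.rpow_add _ _ hσ0 ENNReal.ofReal_ne_top]
      simp
    rw [e]
    exact ENNReal.mul_lt_mul (ENNReal.rpow_lt_rpow hx hl1) (ENNReal.rpow_lt_rpow hy hl)
  calc (Mf * If) ^ (1 - l) * (Mg * Ig) ^ l = M * (If ^ (1 - l) * Ig ^ l) := by
        rw [ENNReal.mul_rpow_of_nonneg _ _ hl1.le, ENNReal.mul_rpow_of_nonneg _ _ hl.le, hM,
          mul_mul_mul_comm]
    _ ≤ M * (ENNReal.ofReal (1 - l) * If + ENNReal.ofReal l * Ig) := by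
        gcongr
        exact ENNReal.rpow_mul_rpow_le_add hl hl' _ _
    _ ≤ M * ∫⁻ σ in Ioo (0 : ℝ) 1, volume {x | ENNReal.ofReal σ * M < h x} := by
        gcongr
        have hmf : Measurable fun σ : ℝ => volume {x | ENNReal.ofReal σ * Mf < f x} :=
          (Antitone.measurable fun a b hab => measure_mono fun x hx =>
            lt_of_le_of_lt (by gcongr) (show ENNReal.ofReal b * Mf < f x from hx))
        rw [hIf, hIg, ← lintegral_const_mul' _ _ ENNReal.ofReal_ne_top,
          ← lintegral_const_mul' _ _ ENNReal.ofReal_ne_top,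
          ← lintegral_add_left (hmf.const_mul _)]
        exact setLIntegral_mono' measurableSet_Ioo hmeas
    _ ≤ _ := mul_lintegral_meas_lt_le hh hM0 hMt

/-- The Prékopa–Leindler inequality on the line. -/
lemma prekopaLeindler_real {l : ℝ} (hl : 0 < l) (hl' : l < 1) {f g h : ℝ → ℝ≥0∞}
    (hf : Measurable f) (hg : Measurable g) (hh : Measurable h)
    (H : ∀ x y, f x ^ (1 - l) * g y ^ l ≤ h ((1 - l) * x + l * y)) :
    (∫⁻ x, f x) ^ (1 - l) * (∫⁻ x, g x) ^ l ≤ ∫⁻ x, h x := by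
  have hl1 : 0 < 1 - l := by linarith
  have key : ∀ N : ℕ, (∫⁻ x, min (f x) N) ^ (1 - l) * (∫⁻ x, min (g x) N) ^ l ≤ ∫⁻ x, h x := by
    intro N
    refine prekopaLeindler_real_of_bounded hl hl' (by fun_prop) (by fun_prop) hh
      (ENNReal.natCast_ne_top N) (fun x => min_le_right _ _) (fun x => min_le_right _ _)
      fun x y => le_trans ?_ (H x y)
    gcongr <;> exact min_le_left _ _
  have hlim : ∀ f : ℝ → ℝ≥0∞, Measurable f →
      Tendsto (fun N : ℕ => ∫⁻ x, min (f x) N) atTop (𝓝 (∫⁻ x, f x)) := by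
    intro f hf
    refine lintegral_tendsto_of_tendsto_of_monotone (fun N => (by fun_prop)) ?_ ?_
    · exact ae_of_all _ fun x a b hab => min_le_min le_rfl (by exact_mod_cast hab)
    · refine ae_of_all _ fun x => ?_
      have h1 := (tendsto_const_nhds (x := f x)).min ENNReal.tendsto_nat_nhds_top
      simpa using h1
  by_cases hF : ∫⁻ x, f x = 0
  · simp [hF, hl1]
  by_cases hG : ∫⁻ x, g x = 0
  · simp [hG, hl]
  refine le_of_tendsto (ENNReal.Tendsto.mul ((hlim f hf).ennrpow_const _) ?_
    ((hlim g hg).ennrpow_const _) ?_) (Eventually.of_forall key)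
  · left
    simp [ENNReal.rpow_eq_zero_iff, hF, hl'.le]
  · left
    simp [ENNReal.rpow_eq_zero_iff, hG, hl.le, hl]

/-- The Prékopa–Leindler inequality. -/
theorem prekopaLeindler_pi {l : ℝ} (hl : 0 < l) (hl' : l < 1) (n : ℕ) :
    ∀ {f g h : (Fin n → ℝ) → ℝ≥0∞}, Measurable f → Measurable g → Measurable h →
    (∀ x y, f x ^ (1 - l) * g y ^ l ≤ h ((1 - l) • x + l • y)) →
    (∫⁻ x, f x) ^ (1 - l) * (∫⁻ x, g x) ^ l ≤ ∫⁻ x, h x := by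
  have hl1 : 0 < 1 - l := by linarith
  induction n with
  | zero =>
    intro f g h _ _ _ H
    have e : ∀ f : (Fin 0 → ℝ) → ℝ≥0∞, ∫⁻ x, f x = f 0 := by
      intro f
      rw [volume_pi, Measure.pi_of_empty _ (0 : Fin 0 → ℝ), lintegral_dirac]
    rw [e, e, e]
    simpa using H 0 0
  | succ n ih =>
    intro f g h hf hg hh H
    have ec : ∀ p : ℝ × (Fin n → ℝ),
        (MeasurableEquiv.piFinSuccAbove (fun _ : Fin (n + 1) => ℝ) 0).symm p =
          (Fin.cons p.1 p.2 : Fin (n + 1) → ℝ) := fun p => by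
      simp [MeasurableEquiv.piFinSuccAbove, Fin.insertNthEquiv, Fin.insertNth_zero']
    have e : ∀ f : (Fin (n + 1) → ℝ) → ℝ≥0∞, Measurable f →
        ∫⁻ x, f x = ∫⁻ t, ∫⁻ y : Fin n → ℝ, f (Fin.cons t y) := by
      intro f hf
      rw [← ((volume_preserving_piFinSuccAbove (fun _ : Fin (n + 1) => ℝ) 0).symm).lintegral_comp_emb
        (MeasurableEquiv.measurableEmbedding _)]
      rw [Measure.volume_eq_prod, lintegral_prod]
      · simp only [ec]
      · exact (hf.comp (MeasurableEquiv.measurable _)).aemeasurable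
    have hc : Measurable fun p : ℝ × (Fin n → ℝ) => (Fin.cons p.1 p.2 : Fin (n + 1) → ℝ) := by
      simp only [← ec]
      exact (MeasurableEquiv.piFinSuccAbove (fun _ : Fin (n + 1) => ℝ) 0).symm.measurable
    have hm : ∀ f : (Fin (n + 1) → ℝ) → ℝ≥0∞, Measurable f → 
        Measurable fun t : ℝ => ∫⁻ y : Fin n → ℝ, f (Fin.cons t y) := fun f hf =>
      Measurable.lintegral_prod_right' (f := fun p : ℝ × (Fin n → ℝ) => f (Fin.cons p.1 p.2)) 
        (hf.comp hc)
    rw [e f hf, e g hg, e h hh]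
    refine prekopaLeindler_real hl hl' (hm f hf) (hm g hg) (hm h hh) fun s t => ?_
    have hs : ∀ (f : (Fin (n + 1) → ℝ) → ℝ≥0∞), Measurable f → ∀ t : ℝ,
        Measurable fun y : Fin n → ℝ => f (Fin.cons t y) := fun f hf t =>
      (hf.comp hc).comp measurable_prodMk_left
    refine ih (hs f hf s) (hs g hg t) (hs h hh _) fun x y => ?_
    convert H (Fin.cons s x) (Fin.cons t y) using 2
    ext i
    refine Fin.cases ?_ (fun j => ?_) i <;> simp

/-- Multiplicative Brunn–Minkowski inequality in Euclidean space. -/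
theorem brunnMinkowski_mul {n : ℕ} {l : ℝ} (hl : 0 < l) (hl' : l < 1) {A B D : Set (Euc n)}
    (hA : MeasurableSet A) (hB : MeasurableSet B) (hD : MeasurableSet D)
    (H : ∀ x ∈ A, ∀ y ∈ B, (1 - l) • x + l • y ∈ D) :
    volume A ^ (1 - l) * volume B ^ l ≤ volume D := by
  have hl1 : 0 < 1 - l := by linarith
  have hmp := (EuclideanSpace.volume_preserving_symm_measurableEquiv_toLp (Fin n)).symm
  have e : ∀ S : Set (Euc n), MeasurableSet S →
      volume S = ∫⁻ x : Fin n → ℝ, S.indicator 1 (WithLp.toLp 2 x) := by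
    intro S hS
    rw [← lintegral_indicator_one hS, ← hmp.lintegral_comp_emb (MeasurableEquiv.measurableEmbedding _)]
    rfl
  have hm : ∀ S : Set (Euc n), MeasurableSet S → 
      Measurable fun x : Fin n → ℝ => S.indicator (1 : Euc n → ℝ≥0∞) (WithLp.toLp 2 x) := 
    fun S hS => (measurable_one.indicator hS).comp (by fun_prop)
  rw [e A hA, e B hB, e D hD]
  refine prekopaLeindler_pi hl hl' n (hm A hA) (hm B hB) (hm D hD) fun x y => ?_
  by_cases hx : WithLp.toLp 2 x ∈ A
  · by_cases hy : WithLp.toLp 2 y ∈ B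
    · have := H _ hx _ hy
      rw [WithLp.toLp_add, WithLp.toLp_smul, WithLp.toLp_smul, indicator_of_mem hx,
        indicator_of_mem hy, indicator_of_mem this]
      simp
    · simp [hy, hl]
  · simp [hx, hl1]

/-- The Brunn–Minkowski inequality in Euclidean space of positive dimension. -/
theorem brunnMinkowski {n : ℕ} {A B D : Set (Euc n)}
    (hA : MeasurableSet A) (hB : MeasurableSet B) (hD : MeasurableSet D)
    {a b : ℝ} (ha : 0 < a) (hb : 0 ≤ b) (hAa : ENNReal.ofReal (a ^ n) = volume A)
    (hBb : ENNReal.ofReal (b ^ n) = volume B) (hB0 : B.Nonempty)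
    (H : A + B ⊆ D) :
    ENNReal.ofReal ((a + b) ^ n) ≤ volume D := by
  rcases hb.eq_or_lt with rfl | hb
  · obtain ⟨y, hy⟩ := hB0
    rw [add_zero, hAa, ← measure_preimage_add_right volume (-y)]
    refine measure_mono fun x hx => H ?_
    exact ⟨_, hx, y, hy, by simp⟩
  set l := b / (a + b) with hl
  have hab : 0 < a + b := by positivity
  have hl0 : 0 < l := by positivity
  have hl1e : 1 - l = a / (a + b) := by rw [hl]; field_simp; ring
  have hl1 : 0 < 1 - l := by rw [hl1e]; positivity
  have hl' : l < 1 := by linarith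
  have h := brunnMinkowski_mul hl0 hl' (hA.const_smul₀ (1 - l)⁻¹) (hB.const_smul₀ l⁻¹) hD (by
    rintro _ ⟨x, hx, rfl⟩ _ ⟨y, hy, rfl⟩
    simp only [smul_smul]
    rw [mul_inv_cancel₀ hl1.ne', mul_inv_cancel₀ hl0.ne', one_smul, one_smul]
    exact H (add_mem_add hx hy))
  have e1 : volume ((1 - l)⁻¹ • A) = ENNReal.ofReal ((a + b) ^ n) := by
    rw [Measure.addHaar_smul, ← hAa, ← ENNReal.ofReal_mul (abs_nonneg _), finrank_euclideanSpace_fin,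
      abs_of_pos (by positivity), ← mul_pow, hl1e]
    congr 2
    field_simp
  have e2 : volume (l⁻¹ • B) = ENNReal.ofReal ((a + b) ^ n) := by
    rw [Measure.addHaar_smul, ← hBb, ← ENNReal.ofReal_mul (abs_nonneg _), finrank_euclideanSpace_fin,
      abs_of_pos (by positivity), ← mul_pow, hl]
    congr 2
    field_simp
  rw [e1, e2, ← ENNReal.rpow_add _ _ (by simp; positivity) ENNReal.ofReal_ne_top] at h
  simpa using h

section SupportFunction

variable {n : ℕ} {C : Set (Euc n)}

theorem bddAbove_inner_image (hC : IsCompact C) (ξ : Euc n) :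
    BddAbove ((fun η => ⟪ξ, η⟫) '' C) :=
  (hC.image (by fun_prop)).bddAbove

theorem inner_le_suppFnR (hC : IsCompact C) (ξ : Euc n) {η : Euc n} (hη : η ∈ C) :
    ⟪ξ, η⟫ ≤ suppFnR C ξ :=
  le_csSup (bddAbove_inner_image hC ξ) ⟨η, hη, rfl⟩

theorem suppFnR_le (h0 : (0 : Euc n) ∈ C) {ξ : Euc n} {a : ℝ} (h : ∀ η ∈ C, ⟪ξ, η⟫ ≤ a) :
    suppFnR C ξ ≤ a :=
  csSup_le ⟨_, 0, h0, rfl⟩ (by rintro _ ⟨η, hη, rfl⟩; exact h η hη)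

theorem suppFnR_nonneg (hC : IsCompact C) (h0 : (0 : Euc n) ∈ C) (ξ : Euc n) :
    0 ≤ suppFnR C ξ := by
  simpa using inner_le_suppFnR hC ξ h0

theorem suppFnR_add_le (hC : IsCompact C) (h0 : (0 : Euc n) ∈ C) (ξ ζ : Euc n) :
    suppFnR C (ξ + ζ) ≤ suppFnR C ξ + suppFnR C ζ :=
  suppFnR_le h0 fun η hη => by
    rw [inner_add_left]
    exact add_le_add (inner_le_suppFnR hC ξ hη) (inner_le_suppFnR hC ζ hη)

theorem suppFnR_smul_le (hC : IsCompact C) (h0 : (0 : Euc n) ∈ C) {a : ℝ} (ha : 0 ≤ a)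
    (ξ : Euc n) : suppFnR C (a • ξ) ≤ a * suppFnR C ξ :=
  suppFnR_le h0 fun η hη => by
    rw [real_inner_smul_left]
    exact mul_le_mul_of_nonneg_left (inner_le_suppFnR hC ξ hη) ha

theorem suppFnR_le_mul_norm (h0 : (0 : Euc n) ∈ C) {R : ℝ} (hR : ∀ η ∈ C, ‖η‖ ≤ R)
    (ξ : Euc n) : suppFnR C ξ ≤ R * ‖ξ‖ :=
  suppFnR_le h0 fun η hη => (real_inner_le_norm _ _).trans (by
    rw [mul_comm]
    exact mul_le_mul_of_nonneg_right (hR η hη) (norm_nonneg _))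

theorem continuous_suppFnR (hC : IsCompact C) (h0 : (0 : Euc n) ∈ C) :
    Continuous (suppFnR C) := by
  obtain ⟨R, hR⟩ := hC.isBounded.exists_norm_le
  have hR0 : 0 ≤ R := (norm_nonneg _).trans (hR 0 h0)
  refine LipschitzWith.continuous (K := ⟨R, hR0⟩) (LipschitzWith.of_le_add_mul _ fun x y => ?_)
  have h := suppFnR_add_le hC h0 y (x - y)
  rw [add_sub_cancel] at h
  refine h.trans (add_le_add le_rfl ?_)
  rw [dist_eq_norm]
  exact suppFnR_le_mul_norm h0 hR _

end SupportFunction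

/-- First-order Taylor estimate, uniform in the base point, for a compactly supported `C¹`
function. -/
theorem exists_forall_sub_le_inner_gradient {n : ℕ} {w : Euc n → ℝ} (hw : ContDiff ℝ 1 w)
    (hcs : HasCompactSupport w) {κ : ℝ} (hκ : 0 < κ) :
    ∃ δ > 0, ∀ x v : Euc n, ‖v‖ < δ → w (x + v) ≤ w x + ⟪gradient w x, v⟫ + κ * ‖v‖ := by
  have hcd : Continuous (fderiv ℝ w) := hw.continuous_fderiv (by simp)
  have huc : UniformContinuous (fderiv ℝ w) :=
    (hcs.fderiv ℝ).uniformContinuous_of_continuous hcd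
  obtain ⟨δ, hδ, H⟩ := Metric.uniformContinuous_iff.1 huc κ hκ
  refine ⟨δ, hδ, fun x v hv => ?_⟩
  have hmv := (convex_ball x δ).norm_image_sub_le_of_norm_hasFDerivWithin_le' (f := w)
    (f' := fderiv ℝ w) (φ := fderiv ℝ w x) (C := κ) (x := x) (y := x + v)
    (fun z _ => ((hw.differentiable (by simp)) z).hasFDerivAt.hasFDerivWithinAt)
    (fun z hz => by
      rw [← dist_eq_norm]
      exact (H (Metric.mem_ball.1 hz)).le) (Metric.mem_ball_self hδ) (by simpa using hv)
  have e : ⟪gradient w x, v⟫ = fderiv ℝ w x v := by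
    simp [gradient]
  rw [e]
  have := (le_abs_self _).trans hmv
  rw [add_sub_cancel_left] at this
  linarith


/-- Isoperimetric inequality in Minkowski-content form. -/
theorem volume_add_mul_le_volume_add_smul {m : ℕ} {C A : Set (Euc (m + 1))} (hC : IsCompact C)
    (h0 : (0 : Euc (m + 1)) ∈ C) (hA : IsOpen A) {a c ε : ℝ} (ha : 0 < a) (hc : 0 ≤ c)
    (hε : 0 < ε) (hAa : ENNReal.ofReal (a ^ (m + 1)) ≤ volume A) (hAt : volume A ≠ ⊤)
    (hCc : ENNReal.ofReal (c ^ (m + 1)) = volume C) :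
    volume A + ENNReal.ofReal (ε * ((m + 1) * a ^ m * c)) ≤ volume (A + (-ε) • C) := by
  set a' : ℝ := (volume A).toReal ^ ((1 : ℝ) / (m + 1 : ℕ)) with ha'
  have e1 : a' ^ (m + 1) = (volume A).toReal := by
    rw [ha', ← Real.rpow_natCast, ← Real.rpow_mul ENNReal.toReal_nonneg]
    rw [one_div, inv_mul_cancel₀ (by positivity), Real.rpow_one]
  have e2 : ENNReal.ofReal (a' ^ (m + 1)) = volume A := by
    rw [e1, ENNReal.ofReal_toReal hAt]
  have haa : a ≤ a' := by
    refine le_of_pow_le_pow_left₀ (Nat.succ_ne_zero m) (by positivity) ?_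
    rw [e1]
    exact (ENNReal.ofReal_le_iff_le_toReal hAt).1 hAa
  have hCm : MeasurableSet ((-ε) • C) := (hC.smul (-ε)).isClosed.measurableSet
  have hBM := brunnMinkowski (a := a') (b := ε * c) hA.measurableSet hCm
    (hA.add_right (t := (-ε) • C)).measurableSet (ha.trans_le haa) (by positivity) e2 (by
      rw [Measure.addHaar_smul, ← hCc, ← ENNReal.ofReal_mul (abs_nonneg _),
        finrank_euclideanSpace_fin, abs_pow, abs_neg, abs_of_pos hε, mul_pow])
    ⟨_, 0, h0, rfl⟩ subset_rfl
  refine le_trans ?_ hBM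
  rw [← e2, ← ENNReal.ofReal_add (by positivity) (by positivity)]
  refine ENNReal.ofReal_le_ofReal ?_
  have h1 := pow_add_mul_le_add_pow (a := a') (b := ε * c) (by positivity) (by positivity) (m + 1)
  refine le_trans ?_ h1
  push_cast
  have : a ^ m ≤ a' ^ m := by gcongr
  have : ε * ((m + 1) * a ^ m * c) ≤ ε * ((m + 1) * a' ^ m * c) := by gcongr
  linarith

/-- Anisotropic Sobolev-type inequality for smooth compactly supported functions. -/
theorem ofReal_mul_le_lintegral_suppFnR_gradient {m : ℕ} {C : Set (Euc (m + 1))}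
    (hC : IsCompact C) (h0 : (0 : Euc (m + 1)) ∈ C) {w : Euc (m + 1) → ℝ} (hw : ContDiff ℝ 1 w)
    (hcs : HasCompactSupport w) (hw0 : ∀ x, 0 ≤ w x) {a b c : ℝ} (ha : 0 < a)
    (hc : 0 ≤ c) (hA : ENNReal.ofReal (a ^ (m + 1)) ≤ volume {x | b < w x})
    (hCc : ENNReal.ofReal (c ^ (m + 1)) = volume C) :
    ENNReal.ofReal (b * ((m + 1) * a ^ m * c)) ≤
      ∫⁻ x, ENNReal.ofReal (suppFnR C (gradient w x)) := by
  obtain ⟨R, hR⟩ := hC.isBounded.exists_norm_le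
  obtain ⟨S, hS⟩ := hcs.isCompact.isBounded.exists_norm_le
  have hR0 : 0 ≤ R := (norm_nonneg _).trans (hR 0 h0)
  have hgc : Continuous (gradient w) := by
    unfold gradient
    exact (LinearIsometryEquiv.continuous _).comp (hw.continuous_fderiv (by simp))
  have hsc := continuous_suppFnR hC h0
  set B : Set (Euc (m + 1)) := Metric.closedBall 0 (S + R) with hB
  have hBt : volume B ≠ ⊤ := (isCompact_closedBall _ _).measure_lt_top.ne
  have hwt : ∫⁻ x, ENNReal.ofReal (w x) ≠ ⊤ := by
    have := (hw.continuous.integrable_of_hasCompactSupport hcs (μ := volume)).lintegral_lt_top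
    exact this.ne
  have key : ∀ κ : ℝ, 0 < κ → ENNReal.ofReal (b * ((m + 1) * a ^ m * c)) ≤
      (∫⁻ x, ENNReal.ofReal (suppFnR C (gradient w x))) + ENNReal.ofReal (κ * R) * volume B := by
    intro κ hκ
    obtain ⟨δ, hδ, H⟩ := exists_forall_sub_le_inner_gradient hw hcs hκ
    obtain ⟨ε, hε, hε1, hεδ⟩ : ∃ ε : ℝ, 0 < ε ∧ ε ≤ 1 ∧ ε * R < δ := by
      refine ⟨min 1 (δ / (R + 1)), by positivity, min_le_left _ _, ?_⟩
      calc min 1 (δ / (R + 1)) * R ≤ δ / (R + 1) * R := by gcongr; exact min_le_right _ _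
        _ < δ := by
          rw [div_mul_eq_mul_div, div_lt_iff₀ (by positivity)]
          nlinarith
    set W : Euc (m + 1) → ℝ := fun x => 
      w x + ε * (suppFnR C (gradient w x) + B.indicator (fun _ => κ * R) x) with hW
    have hBi : ∀ x, 0 ≤ B.indicator (fun _ => κ * R) x := fun x =>
      indicator_nonneg (fun _ _ => by positivity) x
    have hWm : Measurable W := by
      have : Measurable (B.indicator fun _ => κ * R) :=
        measurable_const.indicator Metric.isClosed_closedBall.measurableSet
      have := hw.continuous.measurable
      have := (hsc.comp hgc).measurable
      fun_prop
    have hW0 : ∀ x, 0 ≤ W x := fun x => 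
      add_nonneg (hw0 x) (mul_nonneg hε.le (add_nonneg (suppFnR_nonneg hC h0 _) (hBi x)))
    have hsub : ∀ s : ℝ, 0 ≤ s → {x | s < w x} + (-ε) • C ⊆ {x | s < W x} := by
      rintro s hs _ ⟨y, hy, _, ⟨z, hz, rfl⟩, rfl⟩
      have hy' : s < w y := hy
      set x := y + (-ε) • z with hx
      have hyx : y = x + ε • z := by simp [hx]
      have hεz : ‖ε • z‖ ≤ ε * R := by
        rw [norm_smul, Real.norm_of_nonneg hε.le]
        gcongr
        exact hR z hz
      have h1 := H x (ε • z) (hεz.trans_lt hεδ)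
      rw [← hyx] at h1
      have hyS : ‖y‖ ≤ S := hS y (subset_tsupport _ (by
        rw [Function.mem_support]; exact (hs.trans_lt hy').ne'))
      have hxB : x ∈ B := by
        rw [hB, mem_closedBall_zero_iff]
        calc ‖x‖ = ‖y - ε • z‖ := by rw [hyx]; simp
          _ ≤ ‖y‖ + ‖ε • z‖ := norm_sub_le _ _
          _ ≤ S + R := by
            have : ε * R ≤ R := by nlinarith
            linarith
      change s < w x + ε * (suppFnR C (gradient w x) + B.indicator (fun _ => κ * R) x)
      rw [indicator_of_mem hxB]
      rw [real_inner_smul_right] at h1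
      have h2 := inner_le_suppFnR hC (gradient w x) hz
      have h3 : κ * ‖ε • z‖ ≤ κ * (ε * R) := by gcongr
      nlinarith
    have hopen : ∀ s, IsOpen {x | s < w x} := fun s => isOpen_lt continuous_const hw.continuous
    have hlow : ∀ s : ℝ, 0 < s → volume {x | s < w x} + 
        (Ioo 0 b).indicator (fun _ => ENNReal.ofReal (ε * ((m + 1) * a ^ m * c))) s ≤ 
          volume {x | s < W x} := by
      intro s hs
      by_cases hsb : s < b
      · rw [indicator_of_mem (mem_Ioo.2 ⟨hs, hsb⟩)]
        refine le_trans ?_ (measure_mono (hsub s hs.le))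
        refine volume_add_mul_le_volume_add_smul hC h0 (hopen s) ha hc hε
          (hA.trans (measure_mono fun x hx => hsb.trans hx)) ?_ hCc
        have : {x | s < w x} ⊆ tsupport w := fun x hx => subset_tsupport _ (by
          rw [Function.mem_support]; exact (hs.trans hx).ne')
        exact ((measure_mono this).trans_lt hcs.isCompact.measure_lt_top).ne
      · rw [indicator_of_notMem (fun h => hsb h.2), add_zero]
        refine le_trans (measure_mono fun x hx => ?_) (measure_mono (hsub s hs.le))
        exact ⟨x, hx, 0, ⟨0, h0, by simp⟩, by simp⟩
    have hint : (∫⁻ x, ENNReal.ofReal (w x)) +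
        ENNReal.ofReal (ε * ((m + 1) * a ^ m * c)) * ENNReal.ofReal b ≤ 
          ∫⁻ x, ENNReal.ofReal (W x) := by
      rw [lintegral_eq_lintegral_meas_lt volume (ae_of_all _ hw0) hw.continuous.aemeasurable,
        lintegral_eq_lintegral_meas_lt volume (ae_of_all _ hW0) hWm.aemeasurable]
      refine le_trans (le_of_eq ?_) (setLIntegral_mono' measurableSet_Ioi hlow)
      rw [lintegral_add_right _ (measurable_const.indicator measurableSet_Ioo),
        lintegral_indicator measurableSet_Ioo, setLIntegral_const,
        Measure.restrict_apply measurableSet_Ioo, 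
        inter_eq_left.2 (fun x hx => hx.1), Real.volume_Ioo, sub_zero]
    have hWe : ∫⁻ x, ENNReal.ofReal (W x) = (∫⁻ x, ENNReal.ofReal (w x)) + 
        ENNReal.ofReal ε * ((∫⁻ x, ENNReal.ofReal (suppFnR C (gradient w x))) + 
          ENNReal.ofReal (κ * R) * volume B) := by
      have : ∀ x, ENNReal.ofReal (W x) = ENNReal.ofReal (w x) + ENNReal.ofReal ε * 
          (ENNReal.ofReal (suppFnR C (gradient w x)) + 
            B.indicator (fun _ => ENNReal.ofReal (κ * R)) x) := by
        intro x
        rw [hW]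
        dsimp only
        rw [ENNReal.ofReal_add (hw0 x) (mul_nonneg hε.le 
          (add_nonneg (suppFnR_nonneg hC h0 _) (hBi x))), ENNReal.ofReal_mul hε.le,
          ENNReal.ofReal_add (suppFnR_nonneg hC h0 _) (hBi x)]
        congr 3
        by_cases hx : x ∈ B <;> simp [hx]
      simp_rw [this]
      have hmw : Measurable fun x => ENNReal.ofReal (w x) := hw.continuous.measurable.ennreal_ofReal
      have hmh : Measurable fun x => ENNReal.ofReal (suppFnR C (gradient w x)) := 
        (hsc.comp hgc).measurable.ennreal_ofReal
      rw [lintegral_add_left hmw, lintegral_const_mul' _ _ ENNReal.ofReal_ne_top,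
        lintegral_add_left hmh, 
        lintegral_indicator Metric.isClosed_closedBall.measurableSet, setLIntegral_const]
    rw [hWe, ENNReal.add_le_add_iff_left hwt, ENNReal.ofReal_mul hε.le, mul_assoc,
      ENNReal.mul_le_mul_iff_right (by simpa using hε) ENNReal.ofReal_ne_top] at hint
    rwa [mul_comm b, ENNReal.ofReal_mul (by positivity)]
  have hlim : Tendsto (fun κ : ℝ => (∫⁻ x, ENNReal.ofReal (suppFnR C (gradient w x))) + 
      ENNReal.ofReal (κ * R) * volume B) (𝓝[>] 0) 
      (𝓝 ((∫⁻ x, ENNReal.ofReal (suppFnR C (gradient w x))) + 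
        ENNReal.ofReal (0 * R) * volume B)) := by
    refine Tendsto.const_add _ (ENNReal.Tendsto.mul_const ?_ (Or.inr hBt))
    refine (ENNReal.tendsto_ofReal ?_)
    exact ((continuous_id.mul continuous_const).tendsto 0).mono_left nhdsWithin_le_nhds
  have := ge_of_tendsto hlim (eventually_nhdsWithin_of_forall key)
  simpa using this

section Mollification

variable {n : ℕ}

/-- The mollification `x ↦ ∫ η (x - t) f t dt`. -/
def mollify (η f : Euc n → ℝ) (x : Euc n) : ℝ := ∫ t, η (x - t) * f t

theorem mollify_eq_convolution_left (η f : Euc n → ℝ) :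
    mollify η f = convolution η f (ContinuousLinearMap.lsmul ℝ ℝ) volume := by
  ext x
  rw [convolution_lsmul_swap]
  rfl

theorem mollify_eq_convolution_right (η f : Euc n → ℝ) :
    mollify η f = convolution f η (ContinuousLinearMap.lsmul ℝ ℝ) volume := by
  ext x
  rw [convolution_lsmul]
  simp [mollify, mul_comm]

theorem contDiff_mollify {η f : Euc n → ℝ} (hη : ContDiff ℝ (⊤ : ℕ∞) η)
    (hηc : HasCompactSupport η) (hf : LocallyIntegrable f volume) :
    ContDiff ℝ 1 (mollify η f) := by
  rw [mollify_eq_convolution_right]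
  exact hηc.contDiff_convolution_right _ hf (hη.of_le (by exact_mod_cast le_top))

theorem integrable_mul_of_locallyIntegrable {η f : Euc n → ℝ} (hη : Continuous η)
    (hηc : HasCompactSupport η) (hf : LocallyIntegrable f volume) :
    Integrable fun t => η t * f t := by
  simpa using hf.integrable_smul_left_of_hasCompactSupport hη hηc

theorem hasCompactSupport_comp_sub_left {η : Euc n → ℝ} (hηc : HasCompactSupport η) (x : Euc n) :
    HasCompactSupport fun t => η (x - t) :=
  hηc.comp_homeomorph (Homeomorph.subLeft x)

theorem LocallyIntegrable.inner_const_right {g : Euc n → Euc n} (hg : LocallyIntegrable g volume)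
    (v : Euc n) : LocallyIntegrable (fun t => ⟪g t, v⟫) volume := by
  intro x
  obtain ⟨s, hs, h⟩ := hg x
  exact ⟨s, hs, h.inner_const v⟩

theorem LocallyIntegrable.suppFnR_comp {C : Set (Euc n)} (hC : IsCompact C)
    (h0 : (0 : Euc n) ∈ C) {g : Euc n → Euc n} (hg : LocallyIntegrable g volume) :
    LocallyIntegrable (fun t => suppFnR C (g t)) volume := by
  intro x
  obtain ⟨s, hs, h⟩ := hg x
  obtain ⟨R, hR⟩ := hC.isBounded.exists_norm_le
  refine ⟨s, hs, (h.norm.const_mul R).mono'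
    ((continuous_suppFnR hC h0).comp_aestronglyMeasurable h.aestronglyMeasurable) ?_⟩
  refine ae_of_all _ fun t => ?_
  rw [Real.norm_of_nonneg (suppFnR_nonneg hC h0 _)]
  exact suppFnR_le_mul_norm h0 hR _

theorem inner_gradient_mollify {u : Euc n → ℝ} {g : Euc n → Euc n} (hug : HasWeakGradient u g)
    {η : Euc n → ℝ} (hη : ContDiff ℝ (⊤ : ℕ∞) η) (hηc : HasCompactSupport η) (x v : Euc n) :
    ⟪gradient (mollify η u) x, v⟫ = ∫ t, η (x - t) * ⟪g t, v⟫ := by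
  have h1 := hηc.hasFDerivAt_convolution_right (ContinuousLinearMap.lsmul ℝ ℝ) hug.1
    (hη.of_le (by exact_mod_cast le_top)) x
  rw [← mollify_eq_convolution_right] at h1
  have e : ⟪gradient (mollify η u) x, v⟫ = fderiv ℝ (mollify η u) x v := by simp [gradient]
  rw [e, h1.fderiv, convolution_precompR_apply _ hug.1 (hηc.fderiv ℝ)
    (hη.continuous_fderiv (by simp)), convolution_lsmul]
  have h2 := hug.2.2 (fun t => η (x - t)) (hη.comp (contDiff_const.sub contDiff_id))
    (hasCompactSupport_comp_sub_left hηc x) v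
  have h3 : ∀ t, fderiv ℝ (fun t => η (x - t)) t v = - fderiv ℝ η (x - t) v := by
    intro t
    have : HasFDerivAt (fun t => η (x - t)) ((fderiv ℝ η (x - t)).comp
        (-ContinuousLinearMap.id ℝ (Euc n))) t :=
      ((hη.differentiable (by simp)) (x - t)).hasFDerivAt.comp t
        ((hasFDerivAt_id t).const_sub x)
    rw [this.fderiv]
    simp
  simp only [h3, mul_neg, integral_neg, neg_inj] at h2
  simp only [smul_eq_mul]
  rw [h2]
  simp only [mul_comm]

theorem suppFnR_gradient_mollify_le {C : Set (Euc n)} (hC : IsCompact C)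
    (h0 : (0 : Euc n) ∈ C) {u : Euc n → ℝ} {g : Euc n → Euc n} (hug : HasWeakGradient u g)
    {η : Euc n → ℝ} (hη : ContDiff ℝ (⊤ : ℕ∞) η) (hηc : HasCompactSupport η)
    (hη0 : ∀ x, 0 ≤ η x) (x : Euc n) :
    suppFnR C (gradient (mollify η u) x) ≤ mollify η (fun t => suppFnR C (g t)) x := by
  refine suppFnR_le h0 fun v hv => ?_
  rw [inner_gradient_mollify hug hη hηc]
  have hc : Continuous fun t => η (x - t) := hη.continuous.comp (by fun_prop)
  have hcs := hasCompactSupport_comp_sub_left hηc x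
  refine integral_mono (integrable_mul_of_locallyIntegrable hc hcs (LocallyIntegrable.inner_const_right hug.2.1 v))
    (integrable_mul_of_locallyIntegrable hc hcs (LocallyIntegrable.suppFnR_comp hC h0 hug.2.1)) fun t => ?_
  exact mul_le_mul_of_nonneg_left (inner_le_suppFnR hC _ hv) (hη0 _)

theorem lintegral_ofReal_mollify {η p : Euc n → ℝ} (hη : Continuous η)
    (hηc : HasCompactSupport η) (hη0 : ∀ x, 0 ≤ η x) (hη1 : ∫ x, η x = 1)
    (hp : Integrable p) (hp0 : ∀ x, 0 ≤ p x) :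
    ∫⁻ x, ENNReal.ofReal (mollify η p x) = ∫⁻ x, ENNReal.ofReal (p x) := by
  have h1 : ∀ x, ENNReal.ofReal (mollify η p x) =
      ∫⁻ t, ENNReal.ofReal (η (x - t)) * ENNReal.ofReal (p t) := by
    intro x
    rw [mollify, ofReal_integral_eq_lintegral_ofReal]
    · simp_rw [ENNReal.ofReal_mul (hη0 _)]
    · exact integrable_mul_of_locallyIntegrable (hη.comp (by fun_prop))
        (hasCompactSupport_comp_sub_left hηc x) hp.locallyIntegrable
    · exact ae_of_all _ fun t => mul_nonneg (hη0 _) (hp0 _)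
  have hηm := hη.measurable
  simp_rw [h1]
  rw [lintegral_lintegral_swap]
  · have : ∀ t, ∫⁻ x, ENNReal.ofReal (η (x - t)) * ENNReal.ofReal (p t) = ENNReal.ofReal (p t) := by
      intro t
      rw [lintegral_mul_const' _ _ ENNReal.ofReal_ne_top,
        lintegral_sub_right_eq_self (fun x => ENNReal.ofReal (η x)) t,
        ← ofReal_integral_eq_lintegral_ofReal (hη.integrable_of_hasCompactSupport hηc)
          (ae_of_all _ hη0), hη1]
      simp
    simp_rw [this]
  · have h2 : Measurable fun z : Euc n × Euc n => ENNReal.ofReal (η (z.1 - z.2)) := by fun_prop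
    refine AEMeasurable.mul (f := fun z : Euc n × Euc n => ENNReal.ofReal (η (z.1 - z.2)))
      (g := fun z => ENNReal.ofReal (p z.2)) h2.aemeasurable ?_
    exact hp.aestronglyMeasurable.aemeasurable.ennreal_ofReal.comp_snd

/-- A standard sequence of mollifiers. -/
theorem exists_mollifiers (n : ℕ) : ∃ η : ℕ → Euc n → ℝ,
    (∀ k, ContDiff ℝ (⊤ : ℕ∞) (η k)) ∧ (∀ k, HasCompactSupport (η k)) ∧ (∀ k x, 0 ≤ η k x) ∧
    (∀ k, ∫ x, η k x = 1) ∧ ∀ f : Euc n → ℝ, LocallyIntegrable f volume →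
      ∀ᵐ x, Tendsto (fun k => mollify (η k) f x) atTop (𝓝 (f x)) := by
  let φ : ℕ → ContDiffBump (0 : Euc n) := fun k =>
    ⟨1 / ((k : ℝ) + 1), 2 * (1 / ((k : ℝ) + 1)), by positivity, by
      have : (0 : ℝ) < 1 / ((k : ℝ) + 1) := by positivity
      linarith⟩
  refine ⟨fun k => (φ k).normed volume, fun k => (φ k).contDiff_normed,
    fun k => (φ k).hasCompactSupport_normed, fun k => (φ k).nonneg_normed,
    fun k => (φ k).integral_normed, fun f hf => ?_⟩
  simp_rw [mollify_eq_convolution_left]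
  refine ContDiffBump.ae_convolution_tendsto_right_of_locallyIntegrable (K := 2) ?_ ?_ hf
  · have := (tendsto_one_div_add_atTop_nhds_zero_nat (𝕜 := ℝ)).const_mul 2
    rw [mul_zero] at this
    exact this
  · exact Eventually.of_forall fun k => le_rfl

/-- Smooth cutoff functions with controlled gradient. -/
theorem exists_cutoff (n : ℕ) : ∃ M : ℝ, 0 ≤ M ∧ ∀ R : ℝ, 0 < R → ∃ χ : Euc n → ℝ,
    ContDiff ℝ 1 χ ∧ HasCompactSupport χ ∧ (∀ x, 0 ≤ χ x) ∧ (∀ x, χ x ≤ 1) ∧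
    (∀ x ∈ Metric.ball (0 : Euc n) R, χ x = 1) ∧ ∀ x, ‖gradient χ x‖ ≤ M / R := by
  let φ : ContDiffBump (0 : Euc n) := ⟨1, 2, one_pos, one_lt_two⟩
  have hφ : ContDiff ℝ 1 φ := φ.contDiff
  obtain ⟨M, hM⟩ := (φ.hasCompactSupport.fderiv ℝ).exists_bound_of_continuous
    (hφ.continuous_fderiv (by simp))
  refine ⟨M, (norm_nonneg _).trans (hM 0), fun R hR => ⟨fun x => φ (R⁻¹ • x), 
    hφ.comp (contDiff_const_smul _), ?_, fun x => φ.nonneg, fun x => φ.le_one, fun x hx => ?_,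
    fun x => ?_⟩⟩
  · exact φ.hasCompactSupport.comp_smul (inv_ne_zero hR.ne')
  · refine φ.one_of_mem_closedBall ?_
    rw [mem_closedBall_zero_iff, norm_smul, norm_inv, Real.norm_of_nonneg hR.le,
      inv_mul_le_iff₀ hR]
    simpa [φ] using (mem_ball_zero_iff.1 hx).le
  · have h1 : HasFDerivAt (fun x => φ (R⁻¹ • x)) ((fderiv ℝ φ (R⁻¹ • x)).comp
        (R⁻¹ • ContinuousLinearMap.id ℝ (Euc n))) x :=
      ((hφ.differentiable (by simp)) _).hasFDerivAt.comp x ((hasFDerivAt_id x).const_smul R⁻¹)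
    rw [gradient, LinearIsometryEquiv.norm_map, h1.fderiv, ContinuousLinearMap.comp_smul,
      ContinuousLinearMap.comp_id, norm_smul, norm_inv, Real.norm_of_nonneg hR.le, div_eq_inv_mul]
    gcongr
    exact hM _

end Mollification

/-- A `C¹` truncation function between the levels `s` and `t`. -/
theorem exists_truncation {s t δ : ℝ} (hδ : 0 < δ) (hst : 2 * δ < t - s) :
    ∃ θ ρ : ℝ → ℝ, (∀ x, HasDerivAt θ (ρ x) x) ∧ Continuous ρ ∧ (∀ x, 0 ≤ ρ x) ∧
      (∀ x, ρ x ≤ 1) ∧ (∀ x, x ∉ Ioo s t → ρ x = 0) ∧ (∀ x, 0 ≤ θ x) ∧ (∀ x, θ x ≤ t - s) ∧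
      (∀ x, x ≤ s → θ x = 0) ∧ ∀ x, t - δ ≤ x → t - s - 2 * δ ≤ θ x := by
  set ρ : ℝ → ℝ := fun r => max 0 (min 1 (min ((r - s) / δ) ((t - r) / δ))) with hρ
  have hc : Continuous ρ := by fun_prop
  have h0 : ∀ x, 0 ≤ ρ x := fun x => le_max_left _ _
  have h1 : ∀ x, ρ x ≤ 1 := fun x => max_le zero_le_one (min_le_left _ _)
  have hout : ∀ x, x ∉ Ioo s t → ρ x = 0 := by
    intro x hx
    refine max_eq_left ((min_le_right _ _).trans ?_)
    rcases le_or_gt x s with h | h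
    · exact (min_le_left _ _).trans (div_nonpos_of_nonpos_of_nonneg (by linarith) hδ.le)
    · have : t ≤ x := by
        by_contra h'
        exact hx ⟨h, not_le.1 h'⟩
      exact (min_le_right _ _).trans (div_nonpos_of_nonpos_of_nonneg (by linarith) hδ.le)
  have hin : ∀ x ∈ Icc (s + δ) (t - δ), ρ x = 1 := by
    intro x hx
    have e1 : 1 ≤ (x - s) / δ := by rw [le_div_iff₀ hδ]; linarith [hx.1]
    have e2 : 1 ≤ (t - x) / δ := by rw [le_div_iff₀ hδ]; linarith [hx.2]
    simp [hρ, min_eq_left (le_min e1 e2)]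
  set θ : ℝ → ℝ := fun x => ∫ r in s..x, ρ r with hθ
  have hi : ∀ a b, IntervalIntegrable ρ volume a b := fun a b => hc.intervalIntegrable a b
  have hd : ∀ x, HasDerivAt θ (ρ x) x := fun x => hc.integral_hasStrictDerivAt s x |>.hasDerivAt
  have hm : Monotone θ := monotone_of_deriv_nonneg (fun x => (hd x).differentiableAt)
    fun x => by rw [(hd x).deriv]; exact h0 x
  have hs : ∀ x, x ≤ s → θ x = 0 := by
    intro x hx
    rw [hθ]
    dsimp only
    rw [intervalIntegral.integral_congr (g := fun _ => 0)]
    · simp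
    · intro r hr
      rw [uIcc_of_ge hx] at hr
      exact hout r fun h => absurd hr.2 (not_le.2 h.1)
  have hadd : ∀ a b, θ b = θ a + ∫ r in a..b, ρ r := fun a b =>
    (intervalIntegral.integral_add_adjacent_intervals (hi s a) (hi a b)).symm
  refine ⟨θ, ρ, hd, hc, h0, h1, hout, fun x => ?_, fun x => ?_, hs, fun x hx => ?_⟩
  · rcases le_total x s with h | h
    · exact (hs x h).ge
    · exact (hs s le_rfl).ge.trans (hm h)
  · refine (hm (le_max_left x t)).trans ?_
    rw [hadd t (max x t)]
    have e1 : ∫ r in t..max x t, ρ r = 0 := by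
      rw [intervalIntegral.integral_congr (g := fun _ => 0)]
      · simp
      · intro r hr
        rw [uIcc_of_le (le_max_right x t)] at hr
        exact hout r fun h => absurd hr.1 (not_le.2 h.2)
    rw [e1, add_zero]
    calc θ t ≤ ∫ r in s..t, (1 : ℝ) := intervalIntegral.integral_mono_on (by linarith) (hi _ _)
          (by simp) fun x _ => h1 x
      _ = t - s := by simp
  · refine le_trans ?_ (hm hx)
    rw [hadd (s + δ) (t - δ)]
    have e1 : ∫ r in (s + δ)..(t - δ), ρ r = t - s - 2 * δ := by
      rw [intervalIntegral.integral_congr (g := fun _ => 1)]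
      · simp; ring
      · intro r hr
        rw [uIcc_of_le (by linarith)] at hr
        exact hin r hr
    rw [e1]
    have : 0 ≤ θ (s + δ) := (hs s le_rfl).ge.trans (hm (by linarith))
    linarith

section

variable {m : ℕ}

theorem volume_lt_le_liminf {n : ℕ} {v : ℕ → Euc n → ℝ} {w : Euc n → ℝ}
    (hv : ∀ k, Continuous (v k)) {S : Set (Euc n)} (hS : MeasurableSet S) {b : ℝ}
    (h : ∀ᵐ x, x ∈ S → Tendsto (fun k => v k x) atTop (𝓝 (w x)) ∧ b < w x) :
    volume S ≤ liminf (fun k => volume {x | b < v k x}) atTop := by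
  have hm : ∀ k, MeasurableSet {x | b < v k x} := fun k =>
    (isOpen_lt continuous_const (hv k)).measurableSet
  calc volume S = ∫⁻ x, S.indicator 1 x := (lintegral_indicator_one hS).symm
    _ ≤ ∫⁻ x, liminf (fun k => {x | b < v k x}.indicator (1 : Euc n → ℝ≥0∞) x) atTop := by
      refine lintegral_mono_ae ?_
      filter_upwards [h] with x hx
      by_cases hxS : x ∈ S
      · obtain ⟨h1, h2⟩ := hx hxS
        refine le_liminf_of_le (by isBoundedDefault) ?_
        filter_upwards [h1.eventually_const_lt h2] with k hk
        rw [indicator_of_mem hxS, indicator_of_mem (show x ∈ {x | b < v k x} from hk)]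
      · simp [hxS]
    _ ≤ liminf (fun k => ∫⁻ x, {x | b < v k x}.indicator 1 x) atTop :=
      lintegral_liminf_le fun k => measurable_one.indicator (hm k)
    _ = _ := by simp_rw [lintegral_indicator_one (hm _)]

theorem gradient_comp_mul {n : ℕ} {θ : ℝ → ℝ} {θ' : ℝ} {v χ : Euc n → ℝ} {x : Euc n}
    (hθ : HasDerivAt θ θ' (v x)) (hv : DifferentiableAt ℝ v x) (hχ : DifferentiableAt ℝ χ x) :
    gradient (fun x => θ (v x) * χ x) x =
      (χ x * θ') • gradient v x + θ (v x) • gradient χ x := by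
  have h1 : HasFDerivAt (fun x => θ (v x)) (θ' • fderiv ℝ v x) x :=
    hθ.comp_hasFDerivAt x hv.hasFDerivAt
  have h2 := h1.mul hχ.hasFDerivAt
  simp only [gradient]
  rw [show (fun x => θ (v x) * χ x) = (fun x => θ (v x)) * χ from rfl, h2.fderiv]
  simp only [map_add, map_smul, smul_smul]
  rw [add_comm]

/-- Anisotropic Sobolev inequality between two levels, with an error term. -/
theorem ofReal_mul_le_setLIntegral_suppFnR_add {C : Set (Euc (m + 1))} (hC : IsCompact C)
    (h0 : (0 : Euc (m + 1)) ∈ C) {c : ℝ} (hc : 0 ≤ c)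
    (hCc : ENNReal.ofReal (c ^ (m + 1)) = volume C) {u : Euc (m + 1) → ℝ}
    {g : Euc (m + 1) → Euc (m + 1)} (hug : HasWeakGradient u g) (hu : Measurable u)
    (hg : Integrable g) {s t δ a : ℝ} (hδ : 0 < δ) (hst : 2 * δ < t - s) (hs : distFn u s ≠ ⊤)
    (ha : 0 < a) (hat : ENNReal.ofReal (a ^ (m + 1)) < distFn u t) :
    ENNReal.ofReal ((t - s - 3 * δ) * ((m + 1) * a ^ m * c)) ≤
      (∫⁻ x in {x | s < u x ∧ u x < t}, ENNReal.ofReal (suppFnR C (g x))) + ENNReal.ofReal δ := by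
  obtain ⟨θ, ρ, hd, hρc, hρ0, hρ1, hρout, hθ0, hθ1, hθs, hθt⟩ := exists_truncation hδ hst
  obtain ⟨η, hη, hηc, hη0, hη1, hηt⟩ := exists_mollifiers (m + 1)
  obtain ⟨M, hM, hcut⟩ := exists_cutoff (m + 1)
  obtain ⟨Q, hQ⟩ := hC.isBounded.exists_norm_le
  have hQ0 : 0 ≤ Q := (norm_nonneg _).trans (hQ 0 h0)
  have hL : 0 < t - s := by linarith
  -- choice of the radius
  obtain ⟨R, hR, hRe, hRa⟩ : ∃ R : ℝ, 0 < R ∧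
      ENNReal.ofReal (Q * (M / R)) * (ENNReal.ofReal (t - s) * distFn u s) ≤ ENNReal.ofReal δ ∧
      ENNReal.ofReal (a ^ (m + 1)) < volume ({x | t < u x} ∩ Metric.ball 0 R) := by
    have h1 : Tendsto (fun N : ℕ => volume ({x | t < u x} ∩ Metric.ball 0 (N : ℝ))) atTop
        (𝓝 (distFn u t)) := by
      have e : {x | t < u x} = ⋃ N : ℕ, {x | t < u x} ∩ Metric.ball 0 (N : ℝ) := by
        rw [← inter_iUnion, Metric.iUnion_ball_nat, inter_univ]
      rw [distFn, e]
      conv => enter [1, N]; rw [← e]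
      refine tendsto_measure_iUnion_atTop fun i j hij => ?_
      exact inter_subset_inter_right _ (Metric.ball_subset_ball (by exact_mod_cast hij))
    have h2 : Tendsto (fun N : ℕ => ENNReal.ofReal (Q * (M / N)) *
        (ENNReal.ofReal (t - s) * distFn u s)) atTop (𝓝 0) := by
      have h3 : Tendsto (fun N : ℕ => Q * (M / (N : ℝ))) atTop (𝓝 0) := by
        simpa using (tendsto_const_div_atTop_nhds_zero_nat M).const_mul Q
      have h4 := ENNReal.Tendsto.mul_const (b := ENNReal.ofReal (t - s) * distFn u s)
        (ENNReal.tendsto_ofReal h3) (Or.inr (ENNReal.mul_ne_top ENNReal.ofReal_ne_top hs))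
      simpa using h4
    obtain ⟨N, hN1, hN2, hN3⟩ := ((h1.eventually_const_lt hat).and
      ((h2.eventually_le_const (u := ENNReal.ofReal δ) (by simpa using hδ)).and 
        (eventually_gt_atTop 0))).exists
    exact ⟨N, by exact_mod_cast hN3, hN2, hN1⟩
  obtain ⟨χ, hχ, hχc, hχ0, hχ1, hχR, hχg⟩ := hcut R hR
  set p : Euc (m + 1) → ℝ := fun x => suppFnR C (g x) with hp
  have hp0 : ∀ x, 0 ≤ p x := fun x => suppFnR_nonneg hC h0 _
  have hpi : Integrable p := (hg.norm.const_mul Q).mono'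
    ((continuous_suppFnR hC h0).comp_aestronglyMeasurable hg.aestronglyMeasurable)
    (ae_of_all _ fun x => by
      rw [Real.norm_of_nonneg (hp0 x)]
      exact suppFnR_le_mul_norm h0 hQ _)
  have hθc : Continuous θ := continuous_iff_continuousAt.2 fun x => (hd x).continuousAt
  have hθC : ContDiff ℝ 1 θ := by
    rw [contDiff_one_iff_deriv]
    refine ⟨fun x => (hd x).differentiableAt, ?_⟩
    rwa [show deriv θ = ρ from funext fun x => (hd x).deriv]
  set v : ℕ → Euc (m + 1) → ℝ := fun k => mollify (η k) u with hv
  have hvC : ∀ k, ContDiff ℝ 1 (v k) := fun k => contDiff_mollify (hη k) (hηc k) hug.1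
  set q : ℕ → Euc (m + 1) → ℝ := fun k => mollify (η k) p with hq
  have hqC : ∀ k, Continuous (q k) := fun k =>
    (contDiff_mollify (hη k) (hηc k) hpi.locallyIntegrable).continuous
  have hq0 : ∀ k x, 0 ≤ q k x := fun k x =>
    integral_nonneg fun y => mul_nonneg (hη0 k _) (hp0 _)
  have hqI : ∀ k, ∫⁻ x, ENNReal.ofReal (q k x) = ∫⁻ x, ENNReal.ofReal (p x) := fun k =>
    lintegral_ofReal_mollify (hη k).continuous (hηc k) (hη0 k) (hη1 k) hpi hp0
  set w : ℕ → Euc (m + 1) → ℝ := fun k x => θ (v k x) * χ x with hw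
  have hwC : ∀ k, ContDiff ℝ 1 (w k) := fun k => (hθC.comp (hvC k)).mul hχ
  -- pointwise bound on the integrand
  have hbound : ∀ k x, ENNReal.ofReal (suppFnR C (gradient (w k) x)) ≤
      ENNReal.ofReal (q k x * ρ (v k x)) +
        ENNReal.ofReal (Q * (M / R)) * (tsupport χ).indicator (fun x => 
          ENNReal.ofReal (θ (v k x))) x := by
    intro k x
    have hvd : DifferentiableAt ℝ (v k) x := (hvC k).differentiable (by simp) x
    have hχd : DifferentiableAt ℝ χ x := hχ.differentiable (by simp) x
    have e1 : gradient (w k) x = (χ x * ρ (v k x)) • gradient (v k) x +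
        θ (v k x) • gradient χ x := gradient_comp_mul (hd _) hvd hχd
    have e2 := suppFnR_gradient_mollify_le hC h0 hug (hη k) (hηc k) (hη0 k) x
    have e3 : suppFnR C (gradient (w k) x) ≤
        (χ x * ρ (v k x)) * q k x + θ (v k x) * (Q * ‖gradient χ x‖) := by
      rw [e1]
      refine (suppFnR_add_le hC h0 _ _).trans (add_le_add ?_ ?_)
      · exact (suppFnR_smul_le hC h0 (mul_nonneg (hχ0 x) (hρ0 _)) _).trans
          (mul_le_mul_of_nonneg_left e2 (mul_nonneg (hχ0 x) (hρ0 _)))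
      · exact (suppFnR_smul_le hC h0 (hθ0 _) _).trans
          (mul_le_mul_of_nonneg_left (suppFnR_le_mul_norm h0 hQ _) (hθ0 _))
    have e4 : (χ x * ρ (v k x)) * q k x ≤ q k x * ρ (v k x) := by
      have := mul_nonneg (hq0 k x) (hρ0 (v k x))
      nlinarith [hχ1 x]
    by_cases hx : x ∈ tsupport χ
    · rw [indicator_of_mem hx, ← ENNReal.ofReal_mul (by positivity),
        ← ENNReal.ofReal_add (mul_nonneg (hq0 k x) (hρ0 _))
          (mul_nonneg (by positivity) (hθ0 _))]
      refine ENNReal.ofReal_le_ofReal (e3.trans (add_le_add e4 ?_))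
      rw [mul_comm]
      exact mul_le_mul_of_nonneg_right (mul_le_mul_of_nonneg_left (hχg x) hQ0) (hθ0 _)
    · rw [indicator_of_notMem hx, mul_zero, add_zero]
      refine ENNReal.ofReal_le_ofReal (e3.trans ?_)
      have : gradient χ x = 0 := by
        have : fderiv ℝ χ x = 0 := image_eq_zero_of_notMem_tsupport (fun h => hx
          (tsupport_fderiv_subset ℝ h))
        simp [gradient, this]
      rw [this]
      simpa using e4
  have hae : ∀ᵐ x, Tendsto (fun k => v k x) atTop (𝓝 (u x)) := hηt u hug.1
  have hae' : ∀ᵐ x, Tendsto (fun k => q k x) atTop (𝓝 (p x)) := hηt p hpi.locallyIntegrable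
  -- the left-hand side
  have hleft : ∀ᶠ k in atTop, ENNReal.ofReal (a ^ (m + 1)) < 
      volume {x | t - s - 3 * δ < w k x} := by
    refine eventually_lt_of_lt_liminf (hRa.trans_le (volume_lt_le_liminf 
      (w := fun x => θ (u x) * χ x) (fun k => (hwC k).continuous)
      ((measurableSet_lt measurable_const hu).inter measurableSet_ball) ?_)) (by isBoundedDefault)
    filter_upwards [hae] with x hx hxS
    refine ⟨((hθc.tendsto _).comp hx).mul_const _, ?_⟩
    rw [hχR x hxS.2, mul_one]
    have := hθt (u x) (by have : t < u x := hxS.1; linarith)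
    linarith
  have hsob : ∀ᶠ k in atTop, ENNReal.ofReal ((t - s - 3 * δ) * ((m + 1) * a ^ m * c)) + 
        ∫⁻ x, ENNReal.ofReal (q k x * (1 - ρ (v k x))) ≤ 
      (∫⁻ x, ENNReal.ofReal (p x)) + ENNReal.ofReal (Q * (M / R)) * ∫⁻ x in tsupport χ, 
          ENNReal.ofReal (θ (v k x)) := by
    filter_upwards [hleft] with k hk
    have h1 := ofReal_mul_le_lintegral_suppFnR_gradient hC h0 (hwC k) hχc.mul_left
      (fun x => mul_nonneg (hθ0 _) (hχ0 x)) ha hc hk.le hCc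
    have hm1 : Measurable fun x => ENNReal.ofReal (q k x * ρ (v k x)) :=
      ((hqC k).mul (hρc.comp (hvC k).continuous)).measurable.ennreal_ofReal
    have hm2 : Measurable fun x => ENNReal.ofReal (θ (v k x)) :=
      (hθc.comp (hvC k).continuous).measurable.ennreal_ofReal
    refine (add_le_add (h1.trans (lintegral_mono (hbound k))) le_rfl).trans (le_of_eq ?_)
    rw [lintegral_add_left hm1, lintegral_const_mul' _ _ ENNReal.ofReal_ne_top, 
      lintegral_indicator (isClosed_tsupport χ).measurableSet, add_right_comm, ← hqI k,
      ← lintegral_add_left hm1]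
    congr 1
    refine lintegral_congr fun x => ?_
    rw [← ENNReal.ofReal_add (mul_nonneg (hq0 k x) (hρ0 _)) 
      (mul_nonneg (hq0 k x) (sub_nonneg.2 (hρ1 _)))]
    congr 1
    ring
  -- passage to the limit
  have hlim2 : Tendsto (fun k => ∫⁻ x in tsupport χ, ENNReal.ofReal (θ (v k x))) atTop
      (𝓝 (∫⁻ x in tsupport χ, ENNReal.ofReal (θ (u x)))) := by
    refine tendsto_lintegral_of_dominated_convergence (fun _ => ENNReal.ofReal (t - s))
      (fun k => (hθc.comp (hvC k).continuous).measurable.ennreal_ofReal)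
      (fun k => ae_of_all _ fun x => ENNReal.ofReal_le_ofReal (hθ1 _)) ?_ ?_
    · rw [setLIntegral_const]
      exact ENNReal.mul_ne_top ENNReal.ofReal_ne_top hχc.isCompact.measure_lt_top.ne
    · refine ae_restrict_of_ae ?_
      filter_upwards [hae] with x hx
      exact ENNReal.tendsto_ofReal ((hθc.tendsto _).comp hx)
  have hlim2' : ∫⁻ x in tsupport χ, ENNReal.ofReal (θ (u x)) ≤ 
      ENNReal.ofReal (t - s) * distFn u s := by
    calc ∫⁻ x in tsupport χ, ENNReal.ofReal (θ (u x)) ≤ ∫⁻ x, ENNReal.ofReal (θ (u x)) :=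
          setLIntegral_le_lintegral _ _
      _ ≤ ∫⁻ x, {x | s < u x}.indicator (fun _ => ENNReal.ofReal (t - s)) x := by
        refine lintegral_mono fun x => ?_
        by_cases hx : s < u x
        · rw [indicator_of_mem (show x ∈ {x | s < u x} from hx)]
          exact ENNReal.ofReal_le_ofReal (hθ1 _)
        · simp [hθs _ (not_lt.1 hx)]
      _ = _ := by
        rw [lintegral_indicator (measurableSet_lt measurable_const hu), setLIntegral_const, distFn]
  have hfatou : ∫⁻ x, ENNReal.ofReal (p x * (1 - ρ (u x))) ≤ 
      liminf (fun k => ∫⁻ x, ENNReal.ofReal (q k x * (1 - ρ (v k x)))) atTop := by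
    refine le_trans (lintegral_mono_ae ?_) (lintegral_liminf_le fun k => 
      ((hqC k).mul (continuous_const.sub (hρc.comp (hvC k).continuous))).measurable.ennreal_ofReal)
    filter_upwards [hae, hae'] with x hx hx'
    refine le_of_eq (Tendsto.liminf_eq ?_).symm
    exact ENNReal.tendsto_ofReal (hx'.mul (tendsto_const_nhds.sub ((hρc.tendsto _).comp hx)))
  have hmain : ENNReal.ofReal ((t - s - 3 * δ) * ((m + 1) * a ^ m * c)) + 
      ∫⁻ x, ENNReal.ofReal (p x * (1 - ρ (u x))) ≤ 
        (∫⁻ x, ENNReal.ofReal (p x)) + ENNReal.ofReal δ := by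
    have h1 : Tendsto (fun k => (∫⁻ x, ENNReal.ofReal (p x)) + 
        ENNReal.ofReal (Q * (M / R)) * ∫⁻ x in tsupport χ, ENNReal.ofReal (θ (v k x))) atTop
        (𝓝 ((∫⁻ x, ENNReal.ofReal (p x)) + 
          ENNReal.ofReal (Q * (M / R)) * ∫⁻ x in tsupport χ, ENNReal.ofReal (θ (u x)))) :=
      (ENNReal.Tendsto.const_mul hlim2 (Or.inr ENNReal.ofReal_ne_top)).const_add _
    have h2 := liminf_le_liminf hsob
    rw [h1.liminf_eq, liminf_const_add _ _ _ (by isBoundedDefault) (by isBoundedDefault)] at h2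
    refine (add_le_add le_rfl hfatou).trans (h2.trans (add_le_add le_rfl ?_))
    exact (mul_le_mul_right hlim2' _).trans hRe
  have hpm : AEMeasurable p volume := hpi.aestronglyMeasurable.aemeasurable
  have hsplit : ∫⁻ x, ENNReal.ofReal (p x) = (∫⁻ x, ENNReal.ofReal (p x * ρ (u x))) + 
      ∫⁻ x, ENNReal.ofReal (p x * (1 - ρ (u x))) := by
    have hm1 : AEMeasurable (fun x => ENNReal.ofReal (p x * ρ (u x))) volume :=
      (hpm.mul (hρc.measurable.comp hu).aemeasurable).ennreal_ofReal
    rw [← lintegral_add_left' hm1]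
    refine lintegral_congr fun x => ?_
    rw [← ENNReal.ofReal_add (mul_nonneg (hp0 x) (hρ0 _)) 
      (mul_nonneg (hp0 x) (sub_nonneg.2 (hρ1 _)))]
    congr 1
    ring
  have hfin : ∫⁻ x, ENNReal.ofReal (p x * (1 - ρ (u x))) ≠ ⊤ := by
    refine ne_top_of_le_ne_top hpi.lintegral_lt_top.ne ?_
    rw [hsplit]
    exact le_add_self
  rw [hsplit, add_right_comm, ENNReal.add_le_add_iff_right hfin] at hmain
  refine hmain.trans (add_le_add ?_ le_rfl)
  have hmS : MeasurableSet {x | s < u x ∧ u x < t} := 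
    (measurableSet_lt measurable_const hu).inter (measurableSet_lt hu measurable_const)
  rw [← lintegral_indicator hmS]
  refine lintegral_mono fun x => ?_
  by_cases hx : s < u x ∧ u x < t
  · rw [indicator_of_mem (show x ∈ {x | s < u x ∧ u x < t} from hx)]
    refine ENNReal.ofReal_le_ofReal ?_
    nlinarith [hp0 x, hρ1 (u x)]
  · simp [hρout (u x) hx]

end

section

variable {m : ℕ}

theorem antitone_distFn {n : ℕ} (u : Euc n → ℝ) : Antitone (distFn u) := fun _ _ hst =>
  measure_mono fun _ hx => lt_of_le_of_lt hst hx

/-- The isoperimetric profile `t ↦ n μ(t)^{1-1/n} c` of the superlevel sets of `u`. -/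
def levelProfile (c : ℝ) (u : Euc (m + 1) → ℝ) (t : ℝ) : ℝ≥0∞ :=
  if distFn u t = 0 then 0 else
    ENNReal.ofReal ((m + 1) * ((distFn u t).toReal ^ ((1 : ℝ) / (m + 1 : ℕ))) ^ m * c)

theorem measurable_levelProfile (c : ℝ) (u : Euc (m + 1) → ℝ) :
    Measurable (levelProfile c u) := by
  have h : Measurable (distFn u) := (antitone_distFn u).measurable
  exact Measurable.ite (h (measurableSet_singleton 0)) measurable_const (by fun_prop)

theorem ofReal_mul_levelProfile_le {C : Set (Euc (m + 1))} (hC : IsCompact C)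
    (h0 : (0 : Euc (m + 1)) ∈ C) {c : ℝ} (hc : 0 ≤ c)
    (hCc : ENNReal.ofReal (c ^ (m + 1)) = volume C) {u : Euc (m + 1) → ℝ}
    {g : Euc (m + 1) → Euc (m + 1)} (hug : HasWeakGradient u g) (hu : Measurable u)
    (hg : Integrable g) {s t : ℝ} (hst : s < t) (hs : distFn u s ≠ ⊤) :
    ENNReal.ofReal (t - s) * levelProfile c u t ≤
      ∫⁻ x in {x | s < u x ∧ u x < t}, ENNReal.ofReal (suppFnR C (g x)) := by
  by_cases ht : distFn u t = 0
  · simp [levelProfile, ht]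
  have htt : distFn u t ≠ ⊤ := ne_top_of_le_ne_top hs (antitone_distFn u hst.le)
  rw [levelProfile, if_neg ht, ← ENNReal.ofReal_mul (by linarith)]
  set A : ℝ := (distFn u t).toReal ^ ((1 : ℝ) / (m + 1 : ℕ)) with hA
  have hA0 : 0 < A := Real.rpow_pos_of_pos (ENNReal.toReal_pos ht htt) _
  have e1 : A ^ (m + 1) = (distFn u t).toReal := by
    rw [hA, ← Real.rpow_natCast, ← Real.rpow_mul ENNReal.toReal_nonneg]
    rw [one_div, inv_mul_cancel₀ (by positivity), Real.rpow_one]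
  have h1 : ∀ᶠ δ : ℝ in 𝓝[>] 0, 
      ENNReal.ofReal ((t - s - 3 * δ) * ((m + 1) * (A * (1 - δ)) ^ m * c)) ≤
      (∫⁻ x in {x | s < u x ∧ u x < t}, ENNReal.ofReal (suppFnR C (g x))) + ENNReal.ofReal δ := by
    have hpos : 0 < min 1 ((t - s) / 2) := lt_min one_pos (by linarith)
    filter_upwards [Ioo_mem_nhdsGT hpos] with δ hδ
    have hδ1 : δ < 1 := hδ.2.trans_le (min_le_left _ _)
    have hδ2 : δ < (t - s) / 2 := hδ.2.trans_le (min_le_right _ _)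
    refine ofReal_mul_le_setLIntegral_suppFnR_add hC h0 hc hCc hug hu hg hδ.1 (by linarith) hs
      (mul_pos hA0 (by linarith)) ?_
    rw [ENNReal.ofReal_lt_iff_lt_toReal (pow_nonneg (mul_nonneg hA0.le (by linarith)) _) htt, ← e1]
    refine pow_lt_pow_left₀ ?_ (mul_nonneg hA0.le (by linarith)) (Nat.succ_ne_zero m)
    nlinarith [hδ.1]
  have h2 : Tendsto (fun δ : ℝ => 
      ENNReal.ofReal ((t - s - 3 * δ) * ((m + 1) * (A * (1 - δ)) ^ m * c))) (𝓝[>] 0) 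
      (𝓝 (ENNReal.ofReal ((t - s) * ((m + 1) * A ^ m * c)))) := by
    have : Continuous fun δ : ℝ => 
      ENNReal.ofReal ((t - s - 3 * δ) * ((m + 1) * (A * (1 - δ)) ^ m * c)) :=
      ENNReal.continuous_ofReal.comp (by fun_prop)
    simpa using (this.tendsto 0).mono_left nhdsWithin_le_nhds
  have h3 : Tendsto (fun δ : ℝ => (∫⁻ x in {x | s < u x ∧ u x < t}, 
      ENNReal.ofReal (suppFnR C (g x))) + ENNReal.ofReal δ) (𝓝[>] 0) 
      (𝓝 (∫⁻ x in {x | s < u x ∧ u x < t}, ENNReal.ofReal (suppFnR C (g x)))) := by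
    have : Continuous fun δ : ℝ => (∫⁻ x in {x | s < u x ∧ u x < t}, 
      ENNReal.ofReal (suppFnR C (g x))) + ENNReal.ofReal δ :=
      continuous_const.add ENNReal.continuous_ofReal
    simpa using (this.tendsto 0).mono_left nhdsWithin_le_nhds
  exact le_of_tendsto_of_tendsto h2 h3 h1

theorem integrable_suppFnR_comp {C : Set (Euc (m + 1))} (hC : IsCompact C)
    (h0 : (0 : Euc (m + 1)) ∈ C) {g : Euc (m + 1) → Euc (m + 1)} (hg : Integrable g) :
    Integrable fun x => suppFnR C (g x) := by
  obtain ⟨Q, hQ⟩ := hC.isBounded.exists_norm_le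
  exact (hg.norm.const_mul Q).mono'
    ((continuous_suppFnR hC h0).comp_aestronglyMeasurable hg.aestronglyMeasurable)
    (ae_of_all _ fun x => by
      rw [Real.norm_of_nonneg (suppFnR_nonneg hC h0 _)]
      exact suppFnR_le_mul_norm h0 hQ _)

/-- Integrated anisotropic Sobolev inequality over a measurable set of levels. -/
theorem setLIntegral_levelProfile_le {C : Set (Euc (m + 1))} (hC : IsCompact C)
    (h0 : (0 : Euc (m + 1)) ∈ C) {c : ℝ} (hc : 0 ≤ c)
    (hCc : ENNReal.ofReal (c ^ (m + 1)) = volume C) {u : Euc (m + 1) → ℝ}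
    {g : Euc (m + 1) → Euc (m + 1)} (hug : HasWeakGradient u g) (hu : Measurable u)
    (hg : Integrable g) {s : ℝ} (hs : distFn u s ≠ ⊤) {T : Set ℝ} (hT : MeasurableSet T)
    (hTs : T ⊆ Ioi s) :
    ∫⁻ t in T, levelProfile c u t ≤ ∫⁻ x in u ⁻¹' T, ENNReal.ofReal (suppFnR C (g x)) := by
  have hpi := integrable_suppFnR_comp hC h0 hg
  set ν : Measure ℝ := (volume.withDensity fun x => ENNReal.ofReal (suppFnR C (g x))).map u with hν
  have : IsFiniteMeasure (volume.withDensity fun x => ENNReal.ofReal (suppFnR C (g x))) :=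
    isFiniteMeasure_withDensity hpi.lintegral_lt_top.ne
  have : IsFiniteMeasure ν := Measure.isFiniteMeasure_map _ _
  have hνa : ∀ S, MeasurableSet S → 
      ν S = ∫⁻ x in u ⁻¹' S, ENNReal.ofReal (suppFnR C (g x)) := fun S hS => by
    rw [hν, Measure.map_apply hu hS, withDensity_apply _ (hu hS)]
  have hae : ∀ᵐ t, t ∈ T → levelProfile c u t ≤ ν.rnDeriv volume t := by
    filter_upwards [(IsUnifLocDoublingMeasure.vitaliFamily (volume : Measure ℝ) 1).ae_tendsto_rnDeriv
      ν] with t ht htT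
    have hst : s < t := hTs htT
    have h1 := ht.comp (Real.tendsto_Icc_vitaliFamily_left t)
    refine ge_of_tendsto h1 ?_
    filter_upwards [Ioo_mem_nhdsLT hst] with y hy
    have hyt : 0 < t - y := by linarith [hy.2]
    simp only [Function.comp_apply]
    rw [ENNReal.le_div_iff_mul_le (Or.inl (by simpa using hy.2)) (Or.inl (by simp)),
      Real.volume_Icc, mul_comm, hνa _ measurableSet_Icc]
    refine (ofReal_mul_levelProfile_le hC h0 hc hCc hug hu hg hy.2
      (ne_top_of_le_ne_top hs (antitone_distFn u hy.1.le))).trans ?_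
    exact lintegral_mono_set fun x hx => ⟨hx.1.le, hx.2.le⟩
  rw [← hνa T hT]
  calc ∫⁻ t in T, levelProfile c u t ≤ ∫⁻ t in T, ν.rnDeriv volume t := 
        setLIntegral_mono_ae' hT hae
    _ = (volume.withDensity (ν.rnDeriv volume)) T := (withDensity_apply _ hT).symm
    _ ≤ ν T := Measure.withDensity_rnDeriv_le _ _ _

end

section

variable {n : ℕ}

theorem measurePreserving_shear (v : Euc n) :
    MeasurePreserving (fun z : ℝ × Euc n => (z.1, z.2 + z.1 • v)) := by
  refine (MeasurePreserving.id (volume : Measure ℝ)).skew_product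
    (g := fun (s : ℝ) (x : Euc n) => x + s • v) (by fun_prop) ?_
  exact Eventually.of_forall fun s => (measurePreserving_add_right volume (s • v)).map_eq

theorem integrable_prod_comp_add_smul {G : Euc n → ℝ} (hG : LocallyIntegrable G volume)
    (v : Euc n) {B : Set (Euc n)} (hB : IsCompact B) :
    Integrable (fun z : ℝ × Euc n => G (z.2 + z.1 • v))
      ((volume.restrict (Ioc (0 : ℝ) 1)).prod (volume.restrict B)) := by
  set B' : Set (Euc n) := (fun z : ℝ × Euc n => z.2 + z.1 • v) '' (Icc (0 : ℝ) 1 ×ˢ B) with hB'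
  have hB'c : IsCompact B' := (isCompact_Icc.prod hB).image (by fun_prop)
  have h1 : IntegrableOn (fun z : ℝ × Euc n => G z.2) (Ioc (0 : ℝ) 1 ×ˢ B')
      (volume.prod volume) := by
    rw [IntegrableOn, ← Measure.prod_restrict]
    exact (hG.integrableOn_isCompact hB'c).comp_snd _
  let e : ℝ × Euc n ≃ᵐ ℝ × Euc n :=
    { toFun := fun z => (z.1, z.2 + z.1 • v)
      invFun := fun z => (z.1, z.2 - z.1 • v)
      left_inv := fun z => by simp
      right_inv := fun z => by simp
      measurable_toFun := by simp only [Equiv.coe_fn_mk]; fun_prop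
      measurable_invFun := by simp only [Equiv.coe_fn_symm_mk]; fun_prop }
  have h2 := ((measurePreserving_shear v).integrableOn_comp_preimage e.measurableEmbedding).2 h1
  rw [Measure.prod_restrict]
  refine h2.mono_set fun z hz => ⟨hz.1, ?_⟩
  exact ⟨z, ⟨Ioc_subset_Icc_self hz.1, hz.2⟩, rfl⟩

theorem locallyIntegrable_integral_comp_add_smul {G : Euc n → ℝ}
    (hG : LocallyIntegrable G volume) (v : Euc n) :
    LocallyIntegrable (fun x => ∫ s in (0 : ℝ)..1, G (x + s • v)) volume := by
  rw [locallyIntegrable_iff]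
  intro B hB
  have := (integrable_prod_comp_add_smul hG v hB).integral_prod_right
  simp only [intervalIntegral.integral_of_le zero_le_one]
  exact this

theorem mollify_add_sub_eq {u : Euc n → ℝ} {g : Euc n → Euc n} (hug : HasWeakGradient u g)
    {η : Euc n → ℝ} (hη : ContDiff ℝ (⊤ : ℕ∞) η) (hηc : HasCompactSupport η) (x v : Euc n) :
    mollify η u (x + v) - mollify η u x =
      mollify η (fun t => ∫ s in (0 : ℝ)..1, ⟪g (t + s • v), v⟫) x := by
  have hG : LocallyIntegrable (fun t => ⟪g t, v⟫) volume :=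
    LocallyIntegrable.inner_const_right hug.2.1 v
  have hC1 := contDiff_mollify hη hηc hug.1
  have hd : ∀ s ∈ uIcc (0 : ℝ) 1, HasDerivAt (fun s => mollify η u (x + s • v))
      (⟪gradient (mollify η u) (x + s • v), v⟫) s := by
    intro s _
    have h1 := (hC1.differentiable (by simp) (x + s • v)).hasFDerivAt
    have h2 : HasDerivAt (fun s : ℝ => x + s • v) v s := by
      simpa using ((hasDerivAt_id s).smul_const v).const_add x
    have h3 := h1.comp_hasDerivAt s h2
    have h4 : ⟪gradient (mollify η u) (x + s • v), v⟫ =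
      fderiv ℝ (mollify η u) (x + s • v) v := by simp [gradient]
    rw [h4]
    exact h3
  have hcont : Continuous fun s : ℝ => ⟪gradient (mollify η u) (x + s • v), v⟫ := by
    have : Continuous (gradient (mollify η u)) := by
      unfold gradient
      exact (InnerProductSpace.toDual ℝ (Euc n)).symm.continuous.comp
        (hC1.continuous_fderiv (by simp))
    fun_prop
  have h1 := intervalIntegral.integral_eq_sub_of_hasDerivAt hd (hcont.intervalIntegrable 0 1)
  simp only [one_smul, zero_smul, add_zero] at h1
  rw [← h1]
  have h2 : ∀ s : ℝ, ⟪gradient (mollify η u) (x + s • v), v⟫ =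
      ∫ t, η (x - t) * ⟪g (t + s • v), v⟫ := by
    intro s
    rw [inner_gradient_mollify hug hη hηc,
      ← integral_add_right_eq_self (fun t => η (x + s • v - t) * ⟪g t, v⟫) (s • v)]
    simp
  simp only [h2]
  rw [intervalIntegral_integral_swap]
  · simp [mollify]
  have hcs := hasCompactSupport_comp_sub_left hηc x
  have hcη : Continuous fun t => η (x - t) := by
    have := hη.continuous
    fun_prop
  obtain ⟨M, hM⟩ := hcs.exists_bound_of_continuous hcη
  set B := tsupport fun t => η (x - t)
  have h3 := integrable_prod_comp_add_smul hG v (B := B) hcs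
  have h4 : Integrable (fun z : ℝ × Euc n => η (x - z.2) * ⟪g (z.2 + z.1 • v), v⟫)
      ((volume.restrict (Ioc (0 : ℝ) 1)).prod (volume.restrict B)) := by
    refine h3.bdd_mul (c := M) (by fun_prop) ?_
    exact Eventually.of_forall fun z => hM z.2
  rw [uIoc_of_le zero_le_one]
  have h5 : Measurable fun z : ℝ × Euc n => z.2 := measurable_snd
  rw [Measure.prod_restrict] at h4
  have h6 := (integrableOn_iff_integrable_of_support_subset (s := univ ×ˢ B)
    (μ := (volume.restrict (Ioc (0 : ℝ) 1)).prod volume)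
    (f := fun z : ℝ × Euc n => η (x - z.2) * ⟪g (z.2 + z.1 • v), v⟫) ?_).1 ?_
  · exact h6
  · intro z hz
    refine ⟨mem_univ _, subset_tsupport _ ?_⟩
    intro h
    apply hz
    simp only at h
    simp [h]
  · rw [IntegrableOn, ← Measure.prod_restrict, Measure.restrict_univ, Measure.prod_restrict]
    exact h4

theorem ae_sub_eq_integral_inner {u : Euc n → ℝ} {g : Euc n → Euc n} (hug : HasWeakGradient u g)
    (v : Euc n) :
    ∀ᵐ x, u (x + v) - u x = ∫ s in (0 : ℝ)..1, ⟪g (x + s • v), v⟫ := by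
  obtain ⟨η, hη, hηc, -, -, hlim⟩ := exists_mollifiers n
  have h1 := hlim _ hug.1
  have h2 := (measurePreserving_add_right volume v).quasiMeasurePreserving.ae h1
  have hG : LocallyIntegrable (fun t => ⟪g t, v⟫) volume :=
    LocallyIntegrable.inner_const_right hug.2.1 v
  have h3 := hlim _ (locallyIntegrable_integral_comp_add_smul hG v)
  filter_upwards [h1, h2, h3] with x h1 h2 h3
  refine tendsto_nhds_unique ?_ h3
  simpa only [mollify_add_sub_eq hug (hη _) (hηc _)] using h2.sub h1

end

section

variable {m : ℕ}

/-- Coordinates on `ℝ^(m+1)` splitting off the first variable. -/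
def consCoords (m : ℕ) : (ℝ × Euc m) ≃L[ℝ] Euc (m + 1) :=
  LinearEquiv.toContinuousLinearEquiv
    { toFun := fun p => WithLp.toLp 2 (Fin.cons p.1 p.2.ofLp)
      invFun := fun x => (x 0, WithLp.toLp 2 (Fin.tail x.ofLp))
      map_add' := fun p q => by
        ext i
        refine Fin.cases ?_ (fun j => ?_) i <;> simp
      map_smul' := fun c p => by
        ext i
        refine Fin.cases ?_ (fun j => ?_) i <;> simp
      left_inv := fun p => by simp
      right_inv := fun x => by simp }

theorem consCoords_apply (p : ℝ × Euc m) :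
    consCoords m p = WithLp.toLp 2 (Fin.cons p.1 p.2.ofLp) := rfl

theorem norm_consCoords_sq (p : ℝ × Euc m) : ‖consCoords m p‖ ^ 2 = p.1 ^ 2 + ‖p.2‖ ^ 2 := by
  simp [consCoords_apply, EuclideanSpace.norm_sq_eq, Fin.sum_univ_succ]

theorem measurePreserving_consCoords : MeasurePreserving (consCoords m) := by
  have h1 := (volume_preserving_piFinSuccAbove (fun _ : Fin (m + 1) => ℝ) 0).symm
  have h2 : MeasurePreserving (fun p : ℝ × Euc m => (p.1, p.2.ofLp)) := by
    exact (MeasurePreserving.id (volume : Measure ℝ)).prod (PiLp.volume_preserving_ofLp (Fin m))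
  have h3 := (PiLp.volume_preserving_toLp (Fin (m + 1))).comp (h1.comp h2)
  convert h3 using 1
  ext1 p
  simp [consCoords_apply, MeasurableEquiv.piFinSuccAbove, Fin.insertNthEquiv, Fin.insertNth_zero']

theorem exists_lineCoords (e : Euc (m + 1)) (he : ‖e‖ = 1) :
    ∃ T : (ℝ × Euc m) ≃L[ℝ] Euc (m + 1), MeasurePreserving T ∧
      (∀ s y, T (s, y) = s • e + T (0, y)) ∧ (∀ s y, ⟪T (s, y), e⟫ = s) ∧
      ∀ p, ‖T p‖ ^ 2 = p.1 ^ 2 + ‖p.2‖ ^ 2 := by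
  have ho : Orthonormal ℝ ((({0} : Set (Fin (m + 1)))).domRestrict fun _ => e) := by
    rw [orthonormal_iff_ite]
    rintro ⟨i, hi⟩ ⟨j, hj⟩
    obtain rfl : i = 0 := hi
    obtain rfl : j = 0 := hj
    simp [Set.domRestrict, he]
  obtain ⟨b, hb⟩ := ho.exists_orthonormalBasis_extension_of_card_eq (by simp)
  have hb0 : b 0 = e := hb 0 rfl
  have hT : ∀ p, ((consCoords m).trans b.repr.symm.toContinuousLinearEquiv) p =
      b.repr.symm (consCoords m p) := fun p => rfl
  have h1 : b.repr.symm (consCoords m (1, 0)) = e := by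
    have : consCoords m (1, 0) = EuclideanSpace.single 0 1 := by
      ext i
      refine Fin.cases ?_ (fun j => ?_) i <;> simp [consCoords_apply]
    rw [this, ← hb0]
    simp
  refine ⟨(consCoords m).trans b.repr.symm.toContinuousLinearEquiv, ?_, ?_, ?_, ?_⟩
  · exact b.measurePreserving_repr_symm.comp measurePreserving_consCoords
  · intro s y
    rw [hT, hT]
    have : ((s, y) : ℝ × Euc m) = s • (1, 0) + (0, y) := by simp
    rw [this, map_add, map_smul, map_add, map_smul, h1]
  · intro s y
    rw [hT, ← h1, LinearIsometryEquiv.inner_map_map]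
    simp [consCoords_apply, PiLp.inner_apply, Fin.sum_univ_succ]
  · intro p
    rw [hT, LinearIsometryEquiv.norm_map, norm_consCoords_sq]

end

section

variable {m : ℕ}

theorem measurable_intervalIntegral_fst {k : ℝ × Euc m → ℝ} (hk : Measurable k) :
    Measurable fun p : ℝ × Euc m => ∫ τ in (0 : ℝ)..p.1, k (τ, p.2) := by
  have h1 : ∀ p : ℝ × Euc m, ∫ τ in (0 : ℝ)..p.1, k (τ, p.2) =
      p.1 * ∫ σ in Ioc (0 : ℝ) 1, k (p.1 * σ, p.2) := by
    intro p
    rw [← intervalIntegral.integral_of_le zero_le_one,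
      intervalIntegral.mul_integral_comp_mul_left (f := fun τ => k (τ, p.2))]
    simp
  simp only [h1]
  refine measurable_fst.mul ?_
  have h2 : StronglyMeasurable fun q : (ℝ × Euc m) × ℝ => k (q.1.1 * q.2, q.1.2) :=
    Measurable.stronglyMeasurable (by fun_prop)
  exact h2.integral_prod_right.measurable

theorem ae_locallyIntegrable_line {k : ℝ × Euc m → ℝ} (hk : LocallyIntegrable k volume) :
    ∀ᵐ y : Euc m, LocallyIntegrable (fun s => k (s, y)) volume := by
  have h1 : ∀ N : ℕ, ∀ᵐ y : Euc m, y ∈ Metric.closedBall (0 : Euc m) N →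
      IntegrableOn (fun s => k (s, y)) (Icc (-(N : ℝ)) N) := by
    intro N
    have h2 : IntegrableOn k (Icc (-(N : ℝ)) N ×ˢ Metric.closedBall (0 : Euc m) N) :=
      hk.integrableOn_isCompact (isCompact_Icc.prod (isCompact_closedBall _ _))
    rw [IntegrableOn, Measure.volume_eq_prod, ← Measure.prod_restrict] at h2
    have h3 := h2.prod_left_ae
    rwa [ae_restrict_iff' measurableSet_closedBall] at h3
  filter_upwards [ae_all_iff.2 h1] with y hy
  rw [locallyIntegrable_iff]
  intro B hB
  obtain ⟨R, hR⟩ := hB.isBounded.exists_norm_le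
  obtain ⟨N, hN⟩ := exists_nat_ge (max R ‖y‖)
  refine (hy N (by simpa using (le_max_right _ _).trans hN)).mono_set fun s hs => ?_
  exact abs_le.1 ((hR s hs).trans ((le_max_left _ _).trans hN))

theorem ae_ae_eq_of_forall_ae_add_eq {z : ℝ × Euc m → ℝ} (hz : Measurable z)
    (h : ∀ h : ℝ, ∀ᵐ p : ℝ × Euc m, z (p.1 + h, p.2) = z p) :
    ∃ s₀ : ℝ, ∀ᵐ y : Euc m, ∀ᵐ s : ℝ, z (s, y) = z (s₀, y) := by
  have h1 : ∀ h : ℝ, ∀ᵐ s : ℝ, ∀ᵐ y : Euc m, z (s + h, y) = z (s, y) := fun t =>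
    Measure.ae_ae_of_ae_prod (h t)
  have hm : MeasurableSet {q : (ℝ × ℝ) × Euc m | ¬ z (q.1.2 + q.1.1, q.2) = z (q.1.2, q.2)} := by
    refine (measurableSet_eq_fun ?_ ?_).compl <;> fun_prop
  have hm2 : MeasurableSet {q : ℝ × ℝ | ∀ᵐ y : Euc m, z (q.2 + q.1, y) = z (q.2, y)} :=
    measurable_measure_prodMk_left hm (measurableSet_singleton (0 : ℝ≥0∞))
  have h2 := (Measure.ae_ae_comm (μ := volume) (ν := volume)
    (p := fun h s : ℝ => ∀ᵐ y : Euc m, z (s + h, y) = z (s, y)) hm2).1 (ae_of_all _ h1)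
  obtain ⟨s₀, hs₀⟩ := h2.exists
  refine ⟨s₀, ?_⟩
  have h3 : ∀ᵐ s : ℝ, ∀ᵐ y : Euc m, z (s, y) = z (s₀, y) := by
    have := (measurePreserving_add_right (volume : Measure ℝ) (-s₀)).quasiMeasurePreserving.ae hs₀
    filter_upwards [this] with s hs
    simpa using hs
  refine (Measure.ae_ae_comm (μ := volume) (ν := volume)
    (p := fun (s : ℝ) (y : Euc m) => z (s, y) = z (s₀, y)) ?_).1 h3
  exact measurableSet_eq_fun hz (by fun_prop)

theorem exists_absolutelyContinuous_lines {u : Euc (m + 1) → ℝ} {g : Euc (m + 1) → Euc (m + 1)}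
    (hu : Measurable u) (hg : Measurable g) (hug : HasWeakGradient u g) {e : Euc (m + 1)}
    {T : (ℝ × Euc m) ≃L[ℝ] Euc (m + 1)} (hT : MeasurePreserving T)
    (hTe : ∀ s y, T (s, y) = s • e + T (0, y)) :
    (∀ᵐ y : Euc m, LocallyIntegrable (fun s => ⟪g (T (s, y)), e⟫) volume) ∧
    ∃ b : Euc m → ℝ, Measurable b ∧ ∀ᵐ y : Euc m, ∀ᵐ s : ℝ,
      u (T (s, y)) = b y + ∫ τ in (0 : ℝ)..s, ⟪g (T (τ, y)), e⟫ := by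
  set k : ℝ × Euc m → ℝ := fun p => ⟪g (T p), e⟫ with hk
  have hTm : Measurable T := T.continuous.measurable
  have hkm : Measurable k := (hg.comp hTm).inner measurable_const
  have hkl : LocallyIntegrable k volume := by
    rw [locallyIntegrable_iff]
    intro B hB
    have h1 : IntegrableOn (fun x => ⟪g x, e⟫) (T '' B) :=
      (LocallyIntegrable.inner_const_right hug.2.1 e).integrableOn_isCompact
        (hB.image T.continuous)
    exact (hT.integrableOn_image T.toHomeomorph.measurableEmbedding).1 h1
  have hli := ae_locallyIntegrable_line hkl
  refine ⟨hli, ?_⟩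
  set W : ℝ × Euc m → ℝ := fun p => ∫ τ in (0 : ℝ)..p.1, k (τ, p.2) with hW
  have hWm : Measurable W := measurable_intervalIntegral_fst hkm
  set z : ℝ × Euc m → ℝ := fun p => u (T p) - W p with hz
  have hzm : Measurable z := (hu.comp hTm).sub hWm
  have hli' : ∀ᵐ p : ℝ × Euc m, LocallyIntegrable (fun s => k (s, p.2)) volume :=
    Measure.quasiMeasurePreserving_snd.ae hli
  obtain ⟨s₀, hs₀⟩ := ae_ae_eq_of_forall_ae_add_eq hzm fun h => by
    have h1 := hT.quasiMeasurePreserving.ae (ae_sub_eq_integral_inner hug (h • e))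
    filter_upwards [h1, hli'] with p hp hl
    obtain ⟨s, y⟩ := p
    have hTadd : ∀ t : ℝ, T (s, y) + t • e = T (s + t, y) := by
      intro t
      rw [hTe s, hTe (s + t), add_smul]
      abel
    simp only [smul_smul, hTadd, inner_smul_right] at hp
    rw [intervalIntegral.integral_const_mul] at hp
    have h2 := intervalIntegral.mul_integral_comp_add_mul (a := 0) (b := 1)
      (f := fun τ => k (τ, y)) h s
    simp only [mul_zero, add_zero, mul_one] at h2
    have h3 : ∫ σ in (0 : ℝ)..1, k (s + h * σ, y) =
        ∫ σ in (0 : ℝ)..1, ⟪g (T (s + σ * h, y)), e⟫ := by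
      simp only [hk, mul_comm]
    rw [← h3, h2] at hp
    have hi : ∀ a b : ℝ, IntervalIntegrable (fun τ => k (τ, y)) volume a b := fun a b =>
      (hl.integrableOn_isCompact isCompact_uIcc).intervalIntegrable
    have h4 := intervalIntegral.integral_add_adjacent_intervals (hi 0 s) (hi s (s + h))
    simp only [hz, hW]
    linarith
  refine ⟨fun y => z (s₀, y), by fun_prop, ?_⟩
  filter_upwards [hs₀] with y hy
  filter_upwards [hy] with s hs
  simp only [hz] at hs ⊢
  linarith

end

section

theorem exists_fiber_density {X Y : Type*} [MeasurableSpace X] [StandardBorelSpace X]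
    [MeasurableSpace Y] [MeasurableSpace.CountablySeparated Y] {G : X → Y} (hG : Measurable G)
    {A : Set X} (hA : MeasurableSet A) (hinj : InjOn G A) {ψ : X → ℝ≥0∞} (hψ : Measurable ψ) :
    ∃ F : Y → ℝ≥0∞, Measurable F ∧ (∀ x ∈ A, F (G x) = ψ x) ∧ ∀ p, p ∉ G '' A → F p = 0 := by
  have : StandardBorelSpace A := hA.standardBorel
  have hi : Function.Injective (A.domRestrict G) := hinj.injective
  have he : MeasurableEmbedding (A.domRestrict G) :=
    (hG.comp measurable_subtype_coe).measurableEmbedding hi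
  refine ⟨Function.extend (A.domRestrict G) (fun x => ψ x) 0,
    he.measurable_extend (hψ.comp measurable_subtype_coe) measurable_zero, ?_, ?_⟩
  · intro x hx
    exact hi.extend_apply (fun x : A => ψ x) 0 ⟨x, hx⟩
  · intro p hp
    refine Function.extend_apply' _ _ _ ?_
    rintro ⟨x, hx⟩
    exact hp ⟨x, x.2, hx⟩

variable {m : ℕ}

theorem lipschitzWith_snd_lineCoords {T : (ℝ × Euc m) ≃L[ℝ] Euc (m + 1)}
    (hT : ∀ p, ‖T p‖ ^ 2 = p.1 ^ 2 + ‖p.2‖ ^ 2) : LipschitzWith 1 fun x => (T.symm x).2 := by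
  refine LipschitzWith.of_dist_le_mul fun x y => ?_
  rw [dist_eq_norm, dist_eq_norm, ← Prod.snd_sub, ← map_sub]
  have := hT (T.symm (x - y))
  rw [T.apply_symm_apply] at this
  simp only [NNReal.coe_one, one_mul]
  refine (sq_le_sq₀ (norm_nonneg _) (norm_nonneg _)).1 ?_
  nlinarith [sq_nonneg (T.symm (x - y)).1]

theorem lintegral_fiber_le_hausdorff {u : Euc (m + 1) → ℝ} (hu : Measurable u)
    {P : Euc (m + 1) → Euc m} (hP : LipschitzWith 1 P) {c : ℝ≥0∞}
    (hc : (μH[(m : ℝ)] : Measure (Euc m)) = c • volume) {A : Set (Euc (m + 1))}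
    (hA : MeasurableSet A) (hinj : InjOn (fun x => (u x, P x)) A) {ψ : Euc (m + 1) → ℝ≥0∞}
    {F : ℝ × Euc m → ℝ≥0∞} (hF : Measurable F) (hF1 : ∀ x ∈ A, F (u x, P x) = ψ x)
    (hF0 : ∀ p, p ∉ (fun x => (u x, P x)) '' A → F p = 0) (t : ℝ) :
    c * ∫⁻ y, F (t, y) ≤ ∫⁻ x in u ⁻¹' {t} ∩ A, ψ x ∂μH[(m : ℝ)] := by
  set E := u ⁻¹' {t} ∩ A with hE
  have hEm : MeasurableSet E := (hu (measurableSet_singleton t)).inter hA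
  have hPm : Measurable P := hP.continuous.measurable
  have hPE : MeasurableSet (P '' E) := by
    refine hEm.image_of_measurable_injOn hPm fun x hx y hy hxy => hinj hx.2 hy.2 ?_
    have h1 : u x = t := hx.1
    have h2 : u y = t := hy.1
    simp [h1, h2, hxy]
  have h1 : (μH[(m : ℝ)] : Measure (Euc m)).restrict (P '' E) ≤
      (μH[(m : ℝ)].restrict E).map P := by
    refine Measure.le_iff.2 fun S hS => ?_
    rw [Measure.restrict_apply hS, Measure.map_apply hPm hS, Measure.restrict_apply (hPm hS)]
    have h2 : S ∩ P '' E ⊆ P '' (P ⁻¹' S ∩ E) := by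
      rintro _ ⟨hy, x, hx, rfl⟩
      exact ⟨x, ⟨hy, hx⟩, rfl⟩
    refine (measure_mono h2).trans ?_
    simpa using hP.hausdorffMeasure_image_le (Nat.cast_nonneg m) (P ⁻¹' S ∩ E)
  have hFt : Measurable fun y => F (t, y) := by fun_prop
  have h2 : ∫⁻ x in E, ψ x ∂μH[(m : ℝ)] = ∫⁻ x in E, F (t, P x) ∂μH[(m : ℝ)] := by
    refine setLIntegral_congr_fun hEm fun x hx => ?_
    have h1 : u x = t := hx.1
    rw [← hF1 x hx.2, h1]
  have h3 : ∫⁻ y, F (t, y) = ∫⁻ y in P '' E, F (t, y) := by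
    rw [← lintegral_indicator hPE]
    refine lintegral_congr fun y => ?_
    by_cases hy : y ∈ P '' E
    · rw [indicator_of_mem hy]
    · rw [indicator_of_notMem hy]
      refine hF0 _ ?_
      rintro ⟨x, hx, hxy⟩
      simp only [Prod.mk.injEq] at hxy
      exact hy ⟨x, ⟨hxy.1, hx⟩, hxy.2⟩
  rw [h2, ← lintegral_map (f := fun y => F (t, y)) hFt hPm, h3]
  calc c * ∫⁻ y in P '' E, F (t, y) = ∫⁻ y in P '' E, F (t, y) ∂μH[(m : ℝ)] := by
        rw [hc, Measure.restrict_smul, lintegral_smul_measure, smul_eq_mul]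
    _ ≤ _ := lintegral_mono' h1 le_rfl

theorem lintegral_image_fiber_density {w k : ℝ → ℝ} {D : Set ℝ}
    (hw : ∀ s ∈ D, HasDerivWithinAt w (k s) D s) (hinj : InjOn w D) {f p : ℝ → ℝ≥0∞}
    (hf : ∀ s ∈ D, f (w s) = p s) {S : Set ℝ}
    (hSD : MeasurableSet (w ⁻¹' S ∩ D)) :
    ∫⁻ t in S ∩ w '' D, f t = ∫⁻ s in w ⁻¹' S ∩ D, ENNReal.ofReal |k s| * p s := by
  have h1 := lintegral_image_eq_lintegral_abs_deriv_mul hSD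
    (fun s hs => (hw s hs.2).mono inter_subset_right) (hinj.mono inter_subset_right) f
  rw [show S ∩ w '' D = w '' (w ⁻¹' S ∩ D) by rw [image_preimage_inter], h1]
  exact setLIntegral_congr_fun hSD fun s hs => by simp only [hf s hs.2]

theorem exists_slice_le {u : Euc (m + 1) → ℝ} (hu : Measurable u)
    {T : (ℝ × Euc m) ≃L[ℝ] Euc (m + 1)} (hTv : MeasurePreserving T)
    (hT : ∀ p, ‖T p‖ ^ 2 = p.1 ^ 2 + ‖p.2‖ ^ 2) {c : ℝ≥0∞}
    (hc : (μH[(m : ℝ)] : Measure (Euc m)) = c • volume) {k : Euc (m + 1) → ℝ} (hk : Measurable k)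
    (hline : ∀ᵐ y : Euc m, ∃ w : ℝ → ℝ, ∀ᵐ s : ℝ, u (T (s, y)) = w s ∧
      HasDerivAt w (k (T (s, y))) s)
    {A : Set (Euc (m + 1))} (hA : MeasurableSet A)
    (hinj : InjOn (fun x => (u x, (T.symm x).2)) A) {ψ : Euc (m + 1) → ℝ≥0∞} (hψ : Measurable ψ) :
    ∃ Q : ℝ → ℝ≥0∞, Measurable Q ∧ (∀ t, Q t ≤ ∫⁻ x in u ⁻¹' {t} ∩ A, ψ x ∂μH[(m : ℝ)]) ∧
      ∀ S, MeasurableSet S →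
        c * ∫⁻ x in u ⁻¹' S ∩ A, ENNReal.ofReal |k x| * ψ x ≤ ∫⁻ t in S, Q t := by
  have hP := lipschitzWith_snd_lineCoords hT
  obtain ⟨F, hF, hF1, hF0⟩ := exists_fiber_density (G := fun x => (u x, (T.symm x).2))
    (hu.prodMk hP.continuous.measurable) hA hinj hψ
  refine ⟨fun t => c * ∫⁻ y, F (t, y), hF.lintegral_prod_right'.const_mul c,
    lintegral_fiber_le_hausdorff hu hP hc hA hinj hF hF1 hF0, fun S hS => ?_⟩
  rw [lintegral_const_mul _ hF.lintegral_prod_right']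
  refine mul_le_mul_right ?_ _
  have hswap : ∫⁻ t in S, ∫⁻ y, F (t, y) = ∫⁻ y, ∫⁻ t in S, F (t, y) :=
    lintegral_lintegral_swap (f := fun t y => F (t, y)) hF.aemeasurable
  have hTm : Measurable T := T.continuous.measurable
  have hB : MeasurableSet (u ⁻¹' S ∩ A) := (hu hS).inter hA
  rw [← hTv.setLIntegral_comp_preimage hB (by fun_prop), Measure.volume_eq_prod,
    ← lintegral_indicator (hTm hB), lintegral_prod_symm _
      (Measurable.indicator (by fun_prop) (hTm hB)).aemeasurable, hswap]
  refine lintegral_mono_ae ?_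
  filter_upwards [hline] with y hy
  obtain ⟨w, hw⟩ := hy
  obtain ⟨N, hN, hNm, hN0⟩ := exists_measurable_superset_of_null (ae_iff.1 hw)
  have hTy : Measurable fun s : ℝ => T (s, y) := by fun_prop
  set D : Set ℝ := (fun s => T (s, y)) ⁻¹' A \ N with hD
  have hDm : MeasurableSet D := (hTy hA).diff hNm
  have hDN : ∀ s ∈ D, u (T (s, y)) = w s ∧ HasDerivAt w (k (T (s, y))) s := fun s hs =>
    not_not.1 fun h => hs.2 (hN h)
  have hSD : w ⁻¹' S ∩ D = (fun s => u (T (s, y))) ⁻¹' S ∩ D := by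
    ext s
    simp only [mem_inter_iff, mem_preimage, and_congr_left_iff]
    intro hs
    rw [(hDN s hs).1]
  have hwinj : InjOn w D := by
    intro s hs s' hs' h
    have h1 := hinj hs.1 hs'.1 (by simp [(hDN s hs).1, (hDN s' hs').1, h])
    simpa using T.injective h1
  have h1 := lintegral_image_fiber_density (fun s hs => (hDN s hs).2.hasDerivWithinAt) hwinj
    (f := fun t => F (t, y)) (p := fun s => ψ (T (s, y))) (fun s hs => by
      rw [← (hDN s hs).1, ← hF1 _ hs.1]
      simp) (S := S) (hSD ▸ ((hu.comp hTy) hS).inter hDm)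
  calc ∫⁻ s, (T ⁻¹' (u ⁻¹' S ∩ A)).indicator
        (fun x => ENNReal.ofReal |k (T x)| * ψ (T x)) (s, y)
      = ∫⁻ s in w ⁻¹' S ∩ D, ENNReal.ofReal |k (T (s, y))| * ψ (T (s, y)) := by
        have huS : MeasurableSet ((fun s => u (T (s, y))) ⁻¹' S ∩ D) :=
          ((hu.comp hTy) hS).inter hDm
        rw [hSD, ← lintegral_indicator huS]
        refine lintegral_congr_ae ?_
        filter_upwards [measure_eq_zero_iff_ae_notMem.1 hN0] with s hs
        by_cases h : T (s, y) ∈ u ⁻¹' S ∩ A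
        · rw [indicator_of_mem (show (s, y) ∈ T ⁻¹' (u ⁻¹' S ∩ A) from h), indicator_of_mem]
          exact ⟨h.1, h.2, hs⟩
        · rw [indicator_of_notMem (show (s, y) ∉ T ⁻¹' (u ⁻¹' S ∩ A) from h), indicator_of_notMem]
          exact fun h' => h ⟨h'.1, h'.2.1⟩
    _ = ∫⁻ t in S ∩ w '' D, F (t, y) := h1.symm
    _ ≤ ∫⁻ t in S, F (t, y) := lintegral_mono_set inter_subset_left

end

section

variable {m : ℕ}

theorem exists_nat_forall_div_le_of_hasDerivAt {w : ℝ → ℝ} {a s : ℝ} (hw : HasDerivAt w a s)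
    (ha : 0 < a) :
    ∃ p : ℕ, ∀ h : ℝ, 0 < h → h < 1 / ((p : ℝ) + 1) → h / ((p : ℝ) + 1) ≤ w (s + h) - w s := by
  have h1 := (hasDerivAt_iff_tendsto_slope_zero.1 hw).eventually
    (lt_mem_nhds (half_lt_self ha))
  rw [eventually_nhdsWithin_iff, Metric.eventually_nhds_iff] at h1
  obtain ⟨δ, hδ, h1⟩ := h1
  obtain ⟨p, hp⟩ := exists_nat_one_div_lt (lt_min hδ (half_pos ha))
  refine ⟨p, fun h h0 h2 => ?_⟩
  have h3 := h1 (y := h) (by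
    simp only [dist_zero_right, Real.norm_eq_abs, abs_of_pos h0]
    exact h2.trans (hp.trans_le (min_le_left _ _))) h0.ne'
  have h4 : a / 2 * h ≤ w (s + h) - w s := by
    rw [smul_eq_mul, inv_mul_eq_div, lt_div_iff₀ h0] at h3
    exact h3.le
  have h5 : 1 / ((p : ℝ) + 1) ≤ a / 2 := hp.le.trans (min_le_right _ _)
  calc h / ((p : ℝ) + 1) = 1 / ((p : ℝ) + 1) * h := by ring
    _ ≤ a / 2 * h := by gcongr
    _ ≤ _ := h4

theorem lt_of_forall_rat_div_le {w : ℝ → ℝ} (hw : Continuous w) {s s' : ℝ} {p : ℕ}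
    (h : ∀ q : ℚ, 0 < (q : ℝ) → (q : ℝ) < 1 / ((p : ℝ) + 1) →
      (q : ℝ) / ((p : ℝ) + 1) ≤ w (s + q) - w s) (hs : s < s') (hs' : s' - s < 1 / ((p : ℝ) + 1)) :
    w s < w s' := by
  have h1 : IsClosed {t : ℝ | t / ((p : ℝ) + 1) ≤ w (s + t) - w s} :=
    isClosed_le (by fun_prop) (by fun_prop)
  have h2 := Rat.denseRange_cast (𝕜 := ℝ) |>.open_subset_closure_inter
    (isOpen_Ioo (a := (0 : ℝ)) (b := 1 / ((p : ℝ) + 1)))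
  have h3 : Ioo (0 : ℝ) (1 / ((p : ℝ) + 1)) ∩ range ((↑) : ℚ → ℝ) ⊆
      {t : ℝ | t / ((p : ℝ) + 1) ≤ w (s + t) - w s} := by
    rintro _ ⟨hq, q, rfl⟩
    exact h q hq.1 hq.2
  have h4 := h1.closure_subset_iff.2 h3 (h2 ⟨sub_pos.2 hs, hs'⟩)
  have h5 : 0 < (s' - s) / ((p : ℝ) + 1) := div_pos (sub_pos.2 hs) (by positivity)
  have h6 : (s' - s) / ((p : ℝ) + 1) ≤ w (s + (s' - s)) - w s := h4
  rw [add_sub_cancel] at h6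
  linarith

theorem exists_injOn_cover {u : Euc (m + 1) → ℝ} {g : Euc (m + 1) → Euc (m + 1)}
    (hu : Measurable u) (hg : Measurable g) (hug : HasWeakGradient u g) {e : Euc (m + 1)}
    {T : (ℝ × Euc m) ≃L[ℝ] Euc (m + 1)} (hT : MeasurePreserving T)
    (hTe : ∀ s y, T (s, y) = s • e + T (0, y)) :
    (∀ᵐ y : Euc m, ∃ w : ℝ → ℝ, ∀ᵐ s : ℝ, u (T (s, y)) = w s ∧
      HasDerivAt w ⟪g (T (s, y)), e⟫ s) ∧
    ∃ A : ℕ × ℤ → Set (Euc (m + 1)), (∀ i, MeasurableSet (A i)) ∧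
      (∀ i, InjOn (fun x => (u x, (T.symm x).2)) (A i)) ∧
      ∀ᵐ x, 0 < ⟪g x, e⟫ → ∃ i, x ∈ A i := by
  obtain ⟨hli, b, hb, hub⟩ := exists_absolutelyContinuous_lines hu hg hug hT hTe
  have hTm : Measurable T := T.continuous.measurable
  have hTsm : Measurable T.symm := T.symm.continuous.measurable
  have hkm : Measurable fun p => ⟪g (T p), e⟫ := (hg.comp hTm).inner measurable_const
  set W : ℝ × Euc m → ℝ := fun p => ∫ τ in (0 : ℝ)..p.1, ⟪g (T (τ, p.2)), e⟫ with hW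
  have hWm : Measurable W := measurable_intervalIntegral_fst hkm
  refine ⟨?_, ?_⟩
  · filter_upwards [hli, hub] with y hy hy'
    refine ⟨fun s => b y + W (s, y), ?_⟩
    filter_upwards [LocallyIntegrable.ae_hasDerivAt_integral hy, hy'] with s hs hs'
    exact ⟨hs', (hs 0).const_add (b y)⟩
  obtain ⟨N, hN, hNm, hN0⟩ := exists_measurable_superset_of_null (ae_iff.1 hli)
  have hNy : ∀ y, y ∉ N → LocallyIntegrable (fun s => ⟪g (T (s, y)), e⟫) volume := fun y hy =>
    not_not.1 fun h => hy (hN h)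
  have hWc : ∀ y, y ∉ N → Continuous fun s => W (s, y) := by
    intro y hy
    refine intervalIntegral.continuous_primitive (f := fun s => ⟪g (T (s, y)), e⟫)
      (fun c d => ?_) 0
    exact ((hNy y hy).integrableOn_isCompact isCompact_uIcc).intervalIntegrable
  set A' : ℕ × ℤ → Set (ℝ × Euc m) := fun i => {p | p.2 ∉ N ∧ u (T p) = b p.2 + W p ∧
    ⌊2 * ((i.1 : ℝ) + 1) * p.1⌋ = i.2 ∧ ∀ q : ℚ, 0 < (q : ℝ) → (q : ℝ) < 1 / ((i.1 : ℝ) + 1) →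
      (q : ℝ) / ((i.1 : ℝ) + 1) ≤ W (p.1 + q, p.2) - W p} with hA'
  have hA'm : ∀ i, MeasurableSet (A' i) := by
    intro i
    have m1 : MeasurableSet {p : ℝ × Euc m | p.2 ∉ N} := measurable_snd hNm.compl
    have m2 : MeasurableSet {p : ℝ × Euc m | u (T p) = b p.2 + W p} :=
      measurableSet_eq_fun (hu.comp hTm) (by fun_prop)
    have m3 : MeasurableSet {p : ℝ × Euc m | ⌊2 * ((i.1 : ℝ) + 1) * p.1⌋ = i.2} :=
      (Int.measurable_floor.comp (by fun_prop)) (measurableSet_singleton i.2)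
    have m4 : ∀ q : ℚ, MeasurableSet {p : ℝ × Euc m |
        (q : ℝ) / ((i.1 : ℝ) + 1) ≤ W (p.1 + q, p.2) - W p} := fun q =>
      measurableSet_le measurable_const (by fun_prop)
    refine m1.inter (m2.inter (m3.inter ?_))
    have m5 : MeasurableSet (⋂ (q : ℚ) (_ : 0 < (q : ℝ)) (_ : (q : ℝ) < 1 / ((i.1 : ℝ) + 1)),
        {p : ℝ × Euc m | (q : ℝ) / ((i.1 : ℝ) + 1) ≤ W (p.1 + q, p.2) - W p}) :=
      MeasurableSet.iInter fun q => MeasurableSet.iInter fun _ => MeasurableSet.iInter fun _ => m4 q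
    have m6 : {p : ℝ × Euc m | ∀ q : ℚ, 0 < (q : ℝ) → (q : ℝ) < 1 / ((i.1 : ℝ) + 1) →
        (q : ℝ) / ((i.1 : ℝ) + 1) ≤ W (p.1 + q, p.2) - W p} =
        ⋂ (q : ℚ) (_ : 0 < (q : ℝ)) (_ : (q : ℝ) < 1 / ((i.1 : ℝ) + 1)),
        {p : ℝ × Euc m | (q : ℝ) / ((i.1 : ℝ) + 1) ≤ W (p.1 + q, p.2) - W p} := by
      ext p
      simp only [mem_iInter]
      rfl
    rw [← m6] at m5
    exact m5
  refine ⟨fun i => T.symm ⁻¹' A' i, fun i => hTsm (hA'm i), ?_, ?_⟩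
  · intro i x hx x' hx' h
    simp only [Prod.mk.injEq] at h
    have key : ∀ x x' : Euc (m + 1), T.symm x ∈ A' i → T.symm x' ∈ A' i → u x = u x' →
        (T.symm x).2 = (T.symm x').2 → ¬ (T.symm x).1 < (T.symm x').1 := by
      intro x x' hx hx' h h' hlt
      obtain ⟨h1, h2, h3, h4⟩ := hx
      obtain ⟨-, h2', h3', -⟩ := hx'
      rw [T.apply_symm_apply] at h2 h2'
      have h5 : (T.symm x').1 - (T.symm x).1 < 1 / ((i.1 : ℝ) + 1) := by
        have hp : (0 : ℝ) < (i.1 : ℝ) + 1 := by positivity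
        have h6 := Int.abs_sub_lt_one_of_floor_eq_floor (h3'.trans h3.symm)
        have h7 := (abs_lt.1 h6).2
        rw [lt_div_iff₀ hp]
        nlinarith [mul_pos hp (sub_pos.2 hlt)]
      have h6 := lt_of_forall_rat_div_le (hWc _ h1) (s := (T.symm x).1) h4 hlt h5
      rw [h2, h2', ← h'] at h
      have h7 : W (T.symm x') = W ((T.symm x').1, (T.symm x).2) := by rw [h']
      have h8 : W (T.symm x) = W ((T.symm x).1, (T.symm x).2) := rfl
      rw [h7, h8] at h
      linarith
    have h1 := key x x' hx hx' h.1 h.2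
    have h2 := key x' x hx' hx h.1.symm h.2.symm
    exact T.symm.injective (Prod.ext (le_antisymm (not_lt.1 h2) (not_lt.1 h1)) h.2)
  · have hae : ∀ᵐ p : ℝ × Euc m, 0 < ⟪g (T p), e⟫ → ∃ i, p ∈ A' i := by
      rw [Measure.volume_eq_prod]
      have hms : MeasurableSet {p : ℝ × Euc m | 0 < ⟪g (T p), e⟫ → ∃ i, p ∈ A' i} := by
        have : {p : ℝ × Euc m | 0 < ⟪g (T p), e⟫ → ∃ i, p ∈ A' i} =
            {p | 0 < ⟪g (T p), e⟫}ᶜ ∪ ⋃ i, A' i := by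
          ext p
          simp [imp_iff_not_or]
        rw [this]
        exact (measurableSet_lt measurable_const hkm).compl.union (MeasurableSet.iUnion hA'm)
      have hms' : MeasurableSet (Prod.swap ⁻¹'
        {p : ℝ × Euc m | 0 < ⟪g (T p), e⟫ → ∃ i, p ∈ A' i}) := measurable_swap hms
      have h1 : ∀ᵐ p : Euc m × ℝ ∂(volume.prod volume), 0 < ⟪g (T p.swap), e⟫ →
          ∃ i, p.swap ∈ A' i := by
        refine (Measure.ae_prod_iff_ae_ae hms').2 ?_
        filter_upwards [hub, measure_eq_zero_iff_ae_notMem.1 hN0] with y hy hyN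
        filter_upwards [hy, LocallyIntegrable.ae_hasDerivAt_integral (hNy y hyN)] with s hs hs' hk
        obtain ⟨p, hp⟩ := exists_nat_forall_div_le_of_hasDerivAt (hs' 0) hk
        exact ⟨(p, ⌊2 * ((p : ℝ) + 1) * s⌋), hyN, hs, rfl, fun q h1 h2 => hp q h1 h2⟩
      exact (Measure.measurePreserving_swap (μ := (volume : Measure ℝ))
        (ν := (volume : Measure (Euc m)))).quasiMeasurePreserving.ae h1
    have hTs : MeasurePreserving T.symm := by
      have := hT.symm T.toHomeomorph.toMeasurableEquiv
      exact this
    filter_upwards [hTs.quasiMeasurePreserving.ae hae] with x hx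
    simpa using hx

end

section

variable {m : ℕ}

theorem exists_dense_directions (m : ℕ) : ∃ d : ℕ → Euc (m + 1), (∀ i, ‖d i‖ = 1) ∧
    ∀ (v : Euc (m + 1)) (ε : ℝ), v ≠ 0 → 0 < ε → ∃ i, ‖‖v‖⁻¹ • v - d i‖ < ε := by
  have : Nonempty (Metric.sphere (0 : Euc (m + 1)) 1) :=
    (NormedSpace.sphere_nonempty (x := (0 : Euc (m + 1)))).2 zero_le_one |>.to_subtype
  obtain ⟨d, hd⟩ := TopologicalSpace.exists_dense_seq (Metric.sphere (0 : Euc (m + 1)) 1)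
  refine ⟨fun i => d i, fun i => by simp, fun v ε hv hε => ?_⟩
  have h1 : ‖v‖⁻¹ • v ∈ Metric.sphere (0 : Euc (m + 1)) 1 := by
    simp [norm_smul, inv_mul_cancel₀ (norm_ne_zero_iff.2 hv)]
  obtain ⟨i, hi⟩ := hd.exists_dist_lt ⟨_, h1⟩ hε
  exact ⟨i, by simpa [Subtype.dist_eq, dist_eq_norm] using hi⟩

theorem mul_norm_lt_inner_of_norm_sub_lt {v d : Euc m} {ε : ℝ} (hv : v ≠ 0)
    (hd : ‖d‖ = 1) (h : ‖‖v‖⁻¹ • v - d‖ < ε) : (1 - ε) * ‖v‖ < ⟪v, d⟫ := by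
  have h0 : 0 < ‖v‖ := norm_pos_iff.2 hv
  have h1 : ⟪‖v‖⁻¹ • v - d, d⟫ ≥ -‖‖v‖⁻¹ • v - d‖ := by
    have := abs_real_inner_le_norm (‖v‖⁻¹ • v - d) d
    rw [hd, mul_one] at this
    exact (abs_le.1 this).1
  rw [inner_sub_left, inner_smul_left, real_inner_self_eq_norm_sq, hd] at h1
  simp only [conj_trivial, one_pow] at h1
  have h2 : 1 - ε < ‖v‖⁻¹ * ⟪v, d⟫ := by linarith
  rw [inv_mul_eq_div, lt_div_iff₀ h0] at h2
  exact h2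

theorem exists_lower_coarea {u : Euc (m + 1) → ℝ} {g : Euc (m + 1) → Euc (m + 1)}
    (hu : Measurable u) (hg : Measurable g) (hug : HasWeakGradient u g) {c : ℝ≥0∞}
    (hc : (μH[(m : ℝ)] : Measure (Euc m)) = c • volume)
    {ψ : Euc (m + 1) → ℝ≥0∞} (hψ : Measurable ψ) {ε : ℝ} (hε : 0 < ε) :
    ∃ Q : ℝ → ℝ≥0∞, Measurable Q ∧ (∀ t, Q t ≤ ∫⁻ x in u ⁻¹' {t}, ψ x ∂μH[(m : ℝ)]) ∧
      ∀ S, MeasurableSet S →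
        c * ∫⁻ x in u ⁻¹' S, ENNReal.ofReal ((1 - ε) * ‖g x‖) * ψ x ≤ ∫⁻ t in S, Q t := by
  obtain ⟨d, hd1, hd⟩ := exists_dense_directions m
  choose T hT hTe hTi hTn using fun i => exists_lineCoords (d i) (hd1 i)
  choose hline A hAm hAinj hAcov using fun i => exists_injOn_cover hu hg hug (hT i) (hTe i)
  obtain ⟨σ, hσ⟩ := exists_surjective_nat (ℕ × ℕ × ℤ)
  set B : ℕ → Set (Euc (m + 1)) := fun k => A (σ k).1 (σ k).2 ∩
    {x | (1 - ε) * ‖g x‖ < ⟪g x, d (σ k).1⟫} with hB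
  have hBm : ∀ k, MeasurableSet (B k) := fun k => (hAm _ _).inter
    (measurableSet_lt (hg.norm.const_mul _) (hg.inner measurable_const))
  set D := disjointed B with hD
  have hDm : ∀ k, MeasurableSet (D k) := MeasurableSet.disjointed hBm
  have hDB : ∀ k, D k ⊆ B k := disjointed_le B
  have hDd : Pairwise (Function.onFun Disjoint D) := disjoint_disjointed B
  have hDU : ⋃ k, D k = ⋃ k, B k := iUnion_disjointed
  choose Q hQm hQle hQS using fun k => exists_slice_le hu (hT (σ k).1) (hTn (σ k).1) hc
    (hg.inner measurable_const) (hline (σ k).1) (hDm k)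
    ((hAinj (σ k).1 (σ k).2).mono ((hDB k).trans inter_subset_left)) hψ
  refine ⟨fun t => ∑' k, Q k t, Measurable.tsum hQm, fun t => ?_, fun S hS => ?_⟩
  · calc ∑' k, Q k t ≤ ∑' k, ∫⁻ x in u ⁻¹' {t} ∩ D k, ψ x ∂μH[(m : ℝ)] :=
          ENNReal.tsum_le_tsum fun k => hQle k t
      _ = ∫⁻ x in ⋃ k, u ⁻¹' {t} ∩ D k, ψ x ∂μH[(m : ℝ)] := by
          rw [lintegral_iUnion (fun k => (hu (measurableSet_singleton t)).inter (hDm k))]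
          intro i j hij
          exact (hDd hij).mono inter_subset_right inter_subset_right
      _ ≤ _ := lintegral_mono_set (iUnion_subset fun k => inter_subset_left)
  · have h1 : ∀ᵐ x, g x ≠ 0 → x ∈ ⋃ k, D k := by
      filter_upwards [ae_all_iff.2 hAcov] with x hx hgx
      rw [hDU, mem_iUnion]
      have hε' : 0 < min ε 1 := lt_min hε one_pos
      obtain ⟨i, hi⟩ := hd (g x) (min ε 1) hgx hε'
      have h2 := mul_norm_lt_inner_of_norm_sub_lt hgx (hd1 i) hi
      have h3 : 0 < ⟪g x, d i⟫ := lt_of_le_of_lt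
        (mul_nonneg (by linarith [min_le_right ε 1]) (norm_nonneg _)) h2
      obtain ⟨j, hj⟩ := hx i h3
      obtain ⟨k, hk⟩ := hσ (i, j)
      refine ⟨k, ?_⟩
      simp only [hB, hk]
      refine ⟨hj, lt_of_le_of_lt ?_ h2⟩
      have := min_le_left ε 1
      gcongr
    have hum := hu hS
    calc c * ∫⁻ x in u ⁻¹' S, ENNReal.ofReal ((1 - ε) * ‖g x‖) * ψ x
        = c * ∫⁻ x in ⋃ k, u ⁻¹' S ∩ D k, ENNReal.ofReal ((1 - ε) * ‖g x‖) * ψ x := by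
          congr 1
          rw [← lintegral_indicator hum,
            ← lintegral_indicator (MeasurableSet.iUnion fun k => hum.inter (hDm k))]
          refine lintegral_congr_ae ?_
          filter_upwards [h1] with x hx
          by_cases hxS : x ∈ u ⁻¹' S
          · rw [indicator_of_mem hxS]
            by_cases hgx : g x = 0
            · simp [indicator, hgx]
            · rw [← inter_iUnion, indicator_of_mem (mem_inter hxS (hx hgx))]
          · rw [indicator_of_notMem hxS, ← inter_iUnion, indicator_of_notMem fun h => hxS h.1]
      _ = ∑' k, c * ∫⁻ x in u ⁻¹' S ∩ D k, ENNReal.ofReal ((1 - ε) * ‖g x‖) * ψ x := by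
          rw [ENNReal.tsum_mul_left, lintegral_iUnion (fun k => hum.inter (hDm k))]
          intro i j hij
          exact (hDd hij).mono inter_subset_right inter_subset_right
      _ ≤ ∑' k, c * ∫⁻ x in u ⁻¹' S ∩ D k, ENNReal.ofReal |⟪g x, d (σ k).1⟫| * ψ x := by
          refine ENNReal.tsum_le_tsum fun k => mul_le_mul_right ?_ _
          refine setLIntegral_mono' (hum.inter (hDm k)) fun x hx => ?_
          gcongr
          exact (hDB k hx.2).2.le.trans (le_abs_self _)
      _ ≤ ∑' k, ∫⁻ t in S, Q k t := ENNReal.tsum_le_tsum fun k => hQS k S hS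
      _ = _ := (lintegral_tsum fun k => (hQm k).aemeasurable).symm

end

section

variable {m : ℕ}

theorem HasWeakGradient.congr_ae {n : ℕ} {u : Euc n → ℝ} {g g' : Euc n → Euc n}
    (h : HasWeakGradient u g) (hg : g =ᵐ[volume] g') : HasWeakGradient u g' := by
  refine ⟨h.1, h.2.1.congr hg, fun φ hφ hφc v => ?_⟩
  rw [h.2.2 φ hφ hφc v]
  congr 1
  refine integral_congr_ae ?_
  filter_upwards [hg] with x hx
  rw [hx]

theorem ofReal_suppFnR_le_add {n : ℕ} {Φ : Euc n → ℝ≥0∞} {C : Set (Euc n)}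
    (h0 : (0 : Euc n) ∈ C) {q : ℝ≥0} (hq : ∀ η ∈ C, yconj Φ η ≤ q) (ξ : Euc n) :
    ENNReal.ofReal (suppFnR C ξ) ≤ Φ ξ + q := by
  by_cases hΦ : Φ ξ = ⊤
  · simp [hΦ]
  have h1 : suppFnR C ξ ≤ (Φ ξ + q).toReal := by
    refine suppFnR_le h0 fun η hη => ?_
    have h2 : ENNReal.ofReal ⟪η, ξ⟫ - Φ ξ ≤ q :=
      (le_iSup (fun ζ => ENNReal.ofReal ⟪η, ζ⟫ - Φ ζ) ξ).trans (hq η hη)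
    rw [tsub_le_iff_left] at h2
    rw [real_inner_comm]
    exact (ENNReal.ofReal_le_iff_le_toReal (by simp [hΦ])).1 h2
  exact (ENNReal.ofReal_le_ofReal h1).trans ENNReal.ofReal_toReal_le

theorem ae_mul_levelProfile_le {Φ : Euc (m + 1) → ℝ≥0∞} (hΦ : LowerSemicontinuous Φ)
    {u : Euc (m + 1) → ℝ} {gu : Euc (m + 1) → Euc (m + 1)} (hug : HasWeakGradient u gu)
    (hu : Measurable u) (hgu : Integrable gu) {κ : ℝ≥0∞}
    (hκ : (μH[(m : ℝ)] : Measure (Euc m)) = κ • volume)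
    {C : Set (Euc (m + 1))} (hC : IsCompact C) (h0 : (0 : Euc (m + 1)) ∈ C) {c : ℝ} (hc : 0 ≤ c)
    (hCc : ENNReal.ofReal (c ^ (m + 1)) = volume C) {q : ℝ≥0} (hq : ∀ η ∈ C, yconj Φ η ≤ q)
    {s : ℝ} (hs : distFn u s ≠ ⊤) :
    ∀ᵐ t : ℝ, s < t → κ * levelProfile c u t ≤
      (∫⁻ x in {x | u x = t}, Φ (gu x) / ENNReal.ofReal ‖gu x‖ ∂μH[(m : ℝ)]) +
        κ * (q * ((volume.restrict (u ⁻¹' Ioi s)).map u).rnDeriv volume t) := by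
  set g := hgu.aestronglyMeasurable.mk gu with hgdef
  have hgm : Measurable g := hgu.aestronglyMeasurable.stronglyMeasurable_mk.measurable
  have hgg : gu =ᵐ[volume] g := hgu.aestronglyMeasurable.ae_eq_mk
  have hug' := hug.congr_ae hgg
  have hgi : Integrable g := hgu.congr hgg
  obtain ⟨N, hN, hNm, hN0⟩ := exists_measurable_superset_of_null (ae_iff.1 hgg)
  have hgN : ∀ x, x ∉ N → gu x = g x := fun x hx => not_not.1 fun h => hx (hN h)
  set ψ : Euc (m + 1) → ℝ≥0∞ := Nᶜ.indicator fun x => Φ (g x) / ENNReal.ofReal ‖g x‖ with hψ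
  have hψm : Measurable ψ := by
    refine Measurable.indicator ?_ hNm.compl
    exact (hΦ.measurable.comp hgm).div hgm.norm.ennreal_ofReal
  have hψle : ∀ x, ψ x ≤ Φ (gu x) / ENNReal.ofReal ‖gu x‖ := by
    intro x
    by_cases hx : x ∈ Nᶜ
    · rw [hψ, indicator_of_mem hx, hgN x hx]
    · rw [hψ, indicator_of_notMem hx]
      exact bot_le
  have hyoung : ∀ᵐ x, ENNReal.ofReal (suppFnR C (g x)) ≤ ENNReal.ofReal ‖g x‖ * ψ x + q := by
    filter_upwards [measure_eq_zero_iff_ae_notMem.1 hN0] with x hx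
    by_cases hgx : g x = 0
    · have : suppFnR C (g x) ≤ 0 := suppFnR_le h0 fun η _ => by simp [hgx]
      simp [ENNReal.ofReal_of_nonpos this]
    · rw [hψ, indicator_of_mem (show x ∈ Nᶜ from hx), ENNReal.mul_div_cancel (by simpa using hgx)
        ENNReal.ofReal_ne_top]
      exact ofReal_suppFnR_le_add h0 hq _
  set ν : Measure ℝ := (volume.restrict (u ⁻¹' Ioi s)).map u with hν
  have hfin : IsFiniteMeasure (volume.restrict (u ⁻¹' Ioi s)) := by
    rw [isFiniteMeasure_restrict]
    exact hs
  have : IsFiniteMeasure ν := Measure.isFiniteMeasure_map _ _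
  obtain ⟨Z, hZm, hZ1, hZ2⟩ := Measure.mutuallySingular_singularPart ν volume
  have hνZ : ∀ S, MeasurableSet S → S ⊆ Z → ν S = ∫⁻ t in S, ν.rnDeriv volume t := by
    intro S hS hSZ
    conv_lhs => rw [Measure.haveLebesgueDecomposition_add ν volume]
    rw [Measure.add_apply, measure_mono_null hSZ hZ1, zero_add, withDensity_apply _ hS]
  choose Q hQm hQle hQS using fun k : ℕ => exists_lower_coarea hu hgm hug' hκ hψm
    (ε := 1 / ((k : ℝ) + 1)) (by positivity)
  have hlp := measurable_levelProfile c u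
  have main : ∀ k : ℕ, ∀ᵐ t : ℝ, s < t →
      ENNReal.ofReal (1 - 1 / ((k : ℝ) + 1)) * (κ * levelProfile c u t) ≤
        Q k t + κ * (q * ν.rnDeriv volume t) := by
    intro k
    set a := ENNReal.ofReal (1 - 1 / ((k : ℝ) + 1)) with ha
    have ha1 : a ≤ 1 := ENNReal.ofReal_le_one.2 (by
      have : (0 : ℝ) ≤ 1 / ((k : ℝ) + 1) := by positivity
      linarith)
    have hrn := Measure.measurable_rnDeriv ν volume
    have h1 : ∀ S, MeasurableSet S → S ⊆ Ioi s ∩ Z →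
        ∫⁻ t in S, a * (κ * levelProfile c u t) ≤
          ∫⁻ t in S, (Q k t + κ * (q * ν.rnDeriv volume t)) := by
      intro S hS hSs
      have hνS : volume (u ⁻¹' S) = ν S := by
        rw [hν, Measure.map_apply hu hS, Measure.restrict_apply (hu hS),
          inter_eq_left.2 (preimage_mono (hSs.trans inter_subset_left))]
      have h2 := setLIntegral_levelProfile_le hC h0 hc hCc hug' hu hgi hs hS
        (hSs.trans inter_subset_left)
      have h3 : ∫⁻ x in u ⁻¹' S, ENNReal.ofReal (suppFnR C (g x)) ≤
          (∫⁻ x in u ⁻¹' S, ENNReal.ofReal ‖g x‖ * ψ x) + q * ν S := by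
        calc _ ≤ ∫⁻ x in u ⁻¹' S, (ENNReal.ofReal ‖g x‖ * ψ x + q) :=
              lintegral_mono_ae (ae_restrict_of_ae hyoung)
          _ = _ := by
              rw [lintegral_add_right _ measurable_const, setLIntegral_const, hνS]
      have h4 := hQS k S hS
      have hk0 : (0 : ℝ) ≤ 1 - 1 / ((k : ℝ) + 1) := by
        rw [sub_nonneg, div_le_one (by positivity)]
        have : (0 : ℝ) ≤ k := Nat.cast_nonneg k
        linarith
      simp only [ENNReal.ofReal_mul hk0, mul_assoc] at h4
      have hm : Measurable fun x => ENNReal.ofReal ‖g x‖ * ψ x := hgm.norm.ennreal_ofReal.mul hψm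
      rw [lintegral_const_mul _ hm] at h4
      rw [lintegral_const_mul _ (hlp.const_mul κ), lintegral_const_mul _ hlp,
        lintegral_add_left (hQm k), lintegral_const_mul _ (hrn.const_mul _),
        lintegral_const_mul _ hrn, ← hνZ S hS (hSs.trans inter_subset_right)]
      calc a * (κ * ∫⁻ t in S, levelProfile c u t)
          ≤ a * (κ * ((∫⁻ x in u ⁻¹' S, ENNReal.ofReal ‖g x‖ * ψ x) + q * ν S)) := by
            gcongr
            exact h2.trans h3
        _ = κ * (a * ∫⁻ x in u ⁻¹' S, ENNReal.ofReal ‖g x‖ * ψ x) + a * (κ * (q * ν S)) := by ring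
        _ ≤ (∫⁻ t in S, Q k t) + 1 * (κ * (q * ν S)) := by gcongr
        _ = _ := by rw [one_mul]
    have hmS : MeasurableSet (Ioi s ∩ Z) := measurableSet_Ioi.inter hZm
    have h2 : (Ioi s ∩ Z).indicator (fun t => a * (κ * levelProfile c u t)) ≤ᵐ[volume]
        (Ioi s ∩ Z).indicator (fun t => Q k t + κ * (q * ν.rnDeriv volume t)) := by
      refine ae_le_of_forall_setLIntegral_le_of_sigmaFinite
        (Measurable.indicator (by fun_prop) hmS) fun S hS _ => ?_
      rw [setLIntegral_indicator hmS, setLIntegral_indicator hmS]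
      exact h1 _ (hmS.inter hS) inter_subset_left
    filter_upwards [h2, measure_eq_zero_iff_ae_notMem.1 hZ2] with t ht htZ hts
    have h3 : t ∈ Ioi s ∩ Z := ⟨hts, not_not.1 htZ⟩
    rwa [indicator_of_mem h3, indicator_of_mem h3] at ht
  filter_upwards [ae_all_iff.2 main] with t ht hts
  have hlim : Tendsto (fun k : ℕ => ENNReal.ofReal (1 - 1 / ((k : ℝ) + 1)) *
      (κ * levelProfile c u t)) atTop (𝓝 (1 * (κ * levelProfile c u t))) := by
    refine ENNReal.Tendsto.mul_const ?_ (Or.inl one_ne_zero)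
    have := (tendsto_one_div_add_atTop_nhds_zero_nat (𝕜 := ℝ)).const_sub 1
    have h := (ENNReal.continuous_ofReal.tendsto _).comp this
    rw [sub_zero, ENNReal.ofReal_one] at h
    exact h
  rw [one_mul] at hlim
  refine le_of_tendsto' hlim fun k => (ht k hts).trans ?_
  gcongr
  refine (hQle k t).trans ?_
  exact lintegral_mono fun x => hψle x

end

section

variable {m : ℕ}

theorem volume_image_eq_zero_of_eq_integral {k w : ℝ → ℝ} {b : ℝ} (hk : LocallyIntegrable k)
    (hw : ∀ s, w s = b + ∫ τ in (0 : ℝ)..s, k τ) {N : Set ℝ} (hN : volume N = 0) :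
    volume (w '' N) = 0 := by
  have hi : ∀ x y, IntervalIntegrable k volume x y := fun x y =>
    (hk.integrableOn_isCompact isCompact_uIcc).intervalIntegrable
  have hcont : Continuous fun s => ∫ τ in (0 : ℝ)..s, ‖k τ‖ :=
    intervalIntegral.continuous_primitive (fun x y => (hi x y).norm) 0
  have hsub : ∀ x y, (∫ τ in (0 : ℝ)..y, ‖k τ‖) - ∫ τ in (0 : ℝ)..x, ‖k τ‖ = ∫ τ in x..y, ‖k τ‖ :=
    fun x y => intervalIntegral.integral_interval_sub_left (hi 0 y).norm (hi 0 x).norm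
  let F : StieltjesFunction ℝ :=
    { toFun := fun s => ∫ τ in (0 : ℝ)..s, ‖k τ‖
      mono' := fun x y hxy => by
        have := hsub x y
        have h2 : 0 ≤ ∫ τ in x..y, ‖k τ‖ :=
          intervalIntegral.integral_nonneg hxy fun _ _ => norm_nonneg _
        show (∫ τ in (0 : ℝ)..x, ‖k τ‖) ≤ ∫ τ in (0 : ℝ)..y, ‖k τ‖
        linarith
      right_continuous' := fun x => hcont.continuousWithinAt }
  have hF : F.measure = volume.withDensity fun s => ENNReal.ofReal ‖k s‖ := by
    refine Measure.ext_of_Ioc _ _ fun x y hxy => ?_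
    rw [StieltjesFunction.measure_Ioc, withDensity_apply _ measurableSet_Ioc]
    show ENNReal.ofReal ((∫ τ in (0 : ℝ)..y, ‖k τ‖) - ∫ τ in (0 : ℝ)..x, ‖k τ‖) = _
    rw [hsub, intervalIntegral.integral_of_le hxy.le,
      ofReal_integral_eq_lintegral_ofReal ((hi x y).norm.1) (ae_of_all _ fun _ => norm_nonneg _)]
  have hle : OuterMeasure.comap w (volume : Measure ℝ).toOuterMeasure ≤ F.outer := by
    refine OuterMeasure.le_ofFunction.2 fun s => ?_
    rw [OuterMeasure.comap_apply, StieltjesFunction.length_eq]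
    refine le_iInf fun x => le_iInf fun y => le_iInf fun hs => ?_
    have hs' : s ⊆ Ioc x y := fun z hz => hs ⟨hz, by simp [botSet]⟩
    refine (Real.volume_le_diam _).trans ?_
    refine Metric.ediam_le ?_
    rintro _ ⟨p, hp, rfl⟩ _ ⟨p', hp', rfl⟩
    have key : ∀ p ∈ Ioc x y, ∀ p' ∈ Ioc x y, p ≤ p' → edist (w p) (w p') ≤
        ENNReal.ofReal (F y - F x) := by
      intro p hp p' hp' hpp
      rw [edist_dist, dist_comm, Real.dist_eq, hw, hw, add_sub_add_left_eq_sub,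
        intervalIntegral.integral_interval_sub_left (hi 0 p') (hi 0 p)]
      refine ENNReal.ofReal_le_ofReal ?_
      have h0 : ‖∫ τ in p..p', k τ‖ ≤ ∫ τ in p..p', ‖k τ‖ :=
        intervalIntegral.norm_integral_le_integral_norm hpp
      refine h0.trans ?_
      rw [← hsub]
      have h1 := F.mono hp.1.le
      have h2 := F.mono hp'.2
      exact sub_le_sub h2 h1
    rcases le_total p p' with h | h
    · exact key p (hs' hp) p' (hs' hp') h
    · rw [edist_comm]
      exact key p' (hs' hp') p (hs' hp) h
  have h1 : F.measure N = 0 := by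
    rw [hF]
    exact withDensity_absolutelyContinuous _ _ hN
  have h2 : F.outer N = 0 := by
    rw [StieltjesFunction.measure] at h1
    exact h1
  exact le_antisymm ((hle N).trans h2.le) bot_le

theorem ae_hausdorffMeasure_slice_eq_zero {X : Type*} [MetricSpace X] [MeasurableSpace X]
    [BorelSpace X] {H : X → ℝ} {L : ℝ≥0} (hH : LipschitzWith L H) {N : Set X}
    (hN : μH[((m + 1 : ℕ) : ℝ)] N = 0) : ∀ᵐ r : ℝ, μH[(m : ℝ)] (N ∩ H ⁻¹' {r}) = 0 := by
  have hcov : ∀ j : ℕ, ∃ t : ℕ → Set X, N ⊆ ⋃ i, t i ∧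
      (∀ i, Metric.ediam (t i) ≤ ((j : ℝ≥0∞) + 1)⁻¹) ∧
      ∑' i, (⨆ _ : (t i).Nonempty, Metric.ediam (t i) ^ ((m + 1 : ℕ) : ℝ)) <
        ((j : ℝ≥0∞) + 1)⁻¹ := by
    intro j
    have hj : (0 : ℝ≥0∞) < ((j : ℝ≥0∞) + 1)⁻¹ := by simp
    rw [Measure.hausdorffMeasure_apply] at hN
    have h1 := ((le_iSup₂ (f := fun (r : ℝ≥0∞) (_ : 0 < r) => ⨅ (t : ℕ → Set X)
      (_ : N ⊆ ⋃ n, t n) (_ : ∀ n, Metric.ediam (t n) ≤ r),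
        ∑' n, ⨆ _ : (t n).Nonempty, Metric.ediam (t n) ^ ((m + 1 : ℕ) : ℝ)) _ hj).trans
          hN.le).trans_lt hj
    simp only [iInf_lt_iff] at h1
    obtain ⟨t, h2, h3, h4⟩ := h1
    exact ⟨t, h2, h3, h4⟩
  choose t ht hd hs using hcov
  set G : ℕ → ℝ → ℝ≥0∞ := fun j r => ∑' i, (closure (H '' t j i)).indicator
    (fun _ => Metric.ediam (t j i) ^ (m : ℝ)) r with hG
  have hGm : ∀ j, Measurable (G j) := fun j => Measurable.tsum fun i =>
    measurable_const.indicator isClosed_closure.measurableSet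
  have hGi : ∀ j, ∫⁻ r, G j r ≤ L * ((j : ℝ≥0∞) + 1)⁻¹ := by
    intro j
    rw [lintegral_tsum fun i => (measurable_const.indicator
      isClosed_closure.measurableSet).aemeasurable]
    refine le_trans ?_ (mul_le_mul_right (hs j).le _)
    rw [← ENNReal.tsum_mul_left]
    refine ENNReal.tsum_le_tsum fun i => ?_
    rw [lintegral_indicator_const isClosed_closure.measurableSet]
    rcases (t j i).eq_empty_or_nonempty with h | h
    · simp [h]
    · rw [ciSup_pos h, ENNReal.rpow_natCast, ENNReal.rpow_natCast, pow_succ, ← mul_assoc,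
        mul_comm (L : ℝ≥0∞), mul_assoc]
      gcongr
      refine (Real.volume_le_diam _).trans ?_
      rw [Metric.ediam_closure]
      exact hH.ediam_image_le _
  have hlim : ∫⁻ r, liminf (fun j => G j r) atTop = 0 := by
    refine le_antisymm ((lintegral_liminf_le hGm).trans ?_) bot_le
    have h0 : Tendsto (fun j : ℕ => (L : ℝ≥0∞) * ((j : ℝ≥0∞) + 1)⁻¹) atTop (𝓝 0) := by
      have h1 := (tendsto_add_atTop_iff_nat 1).2 ENNReal.tendsto_inv_nat_nhds_zero
      have h2 := ENNReal.Tendsto.const_mul (a := (L : ℝ≥0∞)) h1 (Or.inr ENNReal.coe_ne_top)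
      simpa using h2
    rw [← h0.liminf_eq]
    exact liminf_le_liminf (Eventually.of_forall hGi)
  have h0 := (lintegral_eq_zero_iff (Measurable.liminf hGm)).1 hlim
  filter_upwards [h0] with r hr
  refine le_antisymm ?_ bot_le
  refine (Measure.hausdorffMeasure_le_liminf_tsum (m : ℝ) _ (l := atTop)
    (ι := fun j : ℕ => {i : ℕ | r ∈ closure (H '' t j i)})
    (fun j : ℕ => ((j : ℝ≥0∞) + 1)⁻¹) ?_ (fun j i => t j i)
    (Eventually.of_forall fun j i => hd j i) (Eventually.of_forall fun j => ?_)).trans ?_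
  · have h1 := (tendsto_add_atTop_iff_nat 1).2 ENNReal.tendsto_inv_nat_nhds_zero
    simpa using h1
  · rintro x ⟨hx, hxr⟩
    obtain ⟨i, hi⟩ := mem_iUnion.1 (ht j hx)
    refine mem_iUnion.2 ⟨⟨i, ?_⟩, hi⟩
    exact subset_closure ⟨x, hi, hxr⟩
  · refine le_of_eq_of_le ?_ hr.le
    congr 1
    funext j
    rw [tsum_subtype {i : ℕ | r ∈ closure (H '' t j i)}
      (fun i => Metric.ediam (t j i) ^ (m : ℝ))]
    refine tsum_congr fun i => ?_
    by_cases hi : r ∈ closure (H '' t j i)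
    · rw [indicator_of_mem hi, indicator_of_mem (by exact hi)]
    · rw [indicator_of_notMem hi, indicator_of_notMem (by exact hi)]

end

section

variable {m : ℕ} {K : Set (Euc (m + 1))}

theorem gauge_pos_iff_ne_zero {n : ℕ} {K : Set (Euc n)} (hK : IsConvexBody K)
    (h0 : (0 : Euc n) ∈ interior K) {x : Euc n} : 0 < gauge K x ↔ x ≠ 0 :=
  gauge_pos (absorbent_nhds_zero (mem_interior_iff_mem_nhds.1 h0))
    ((NormedSpace.isVonNBounded_iff ℝ).2 hK.1.isBounded)

theorem setOf_gauge_le_eq_smul {n : ℕ} {K : Set (Euc n)} (hK : IsConvexBody K)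
    (h0 : (0 : Euc n) ∈ interior K) {a : ℝ} (ha : 0 ≤ a) : {x | gauge K x ≤ a} = a • K := by
  have hn := mem_interior_iff_mem_nhds.1 h0
  rcases ha.eq_or_lt with rfl | ha
  · rw [zero_smul_set ⟨0, interior_subset h0⟩]
    ext x
    have := gauge_pos_iff_ne_zero hK h0 (x := x)
    rw [Set.mem_ofPred_eq, Set.mem_zero, ← not_lt, this, not_not]
  · ext x
    have h1 : gauge K (a⁻¹ • x) = a⁻¹ * gauge K x := by
      rw [gauge_smul_of_nonneg (inv_nonneg.2 ha.le), smul_eq_mul]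
    rw [mem_smul_set_iff_inv_smul_mem₀ ha.ne', Set.mem_ofPred_eq]
    have h2 := gauge_le_one_iff_mem_closure (x := a⁻¹ • x) hK.2 hn
    rw [hK.1.isClosed.closure_eq] at h2
    rw [← h2, h1, inv_mul_le_iff₀ ha, mul_one]

theorem volume_setOf_gauge_le (hK : IsConvexBody K) (h0 : (0 : Euc (m + 1)) ∈ interior K) (a : ℝ) :
    volume {x | gauge K x ≤ a} = ENNReal.ofReal (max a 0 ^ (m + 1)) * volume K := by
  rcases le_or_gt 0 a with ha | ha
  · rw [setOf_gauge_le_eq_smul hK h0 ha, Measure.addHaar_smul, max_eq_left ha]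
    simp [abs_of_nonneg ha]
  · have : {x : Euc (m + 1) | gauge K x ≤ a} = ∅ := by
      ext x
      have := gauge_nonneg (s := K) x
      simp only [Set.mem_ofPred_eq, mem_empty_iff_false, iff_false, not_le]
      linarith
    rw [this, max_eq_right ha.le]
    simp

theorem volume_convexBody_ne_top {n : ℕ} {K : Set (Euc n)} (hK : IsConvexBody K) :
    volume K ≠ ⊤ := hK.1.measure_lt_top.ne

theorem volume_convexBody_pos {n : ℕ} {K : Set (Euc n)} (h0 : (0 : Euc n) ∈ interior K) :
    0 < volume K := Measure.measure_pos_of_mem_nhds _ (mem_interior_iff_mem_nhds.1 h0)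

theorem exists_lipschitzWith_gauge {n : ℕ} {K : Set (Euc n)} (hK : IsConvexBody K)
    (h0 : (0 : Euc n) ∈ interior K) : ∃ L : ℝ≥0, LipschitzWith L (gauge K) :=
  hK.2.lipschitz_gauge (mem_interior_iff_mem_nhds.1 h0)

theorem continuous_gauge_convexBody {n : ℕ} {K : Set (Euc n)} (hK : IsConvexBody K)
    (h0 : (0 : Euc n) ∈ interior K) : Continuous (gauge K) :=
  continuous_gauge hK.2 (mem_interior_iff_mem_nhds.1 h0)

theorem map_gauge_volume (hK : IsConvexBody K) (h0 : (0 : Euc (m + 1)) ∈ interior K) :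
    (volume : Measure (Euc (m + 1))).map (gauge K) =
      (volume.restrict (Ioi 0)).withDensity fun r =>
        ENNReal.ofReal ((m + 1) * (volume K).toReal * r ^ m) := by
  have hm : Measurable (gauge K) := (continuous_gauge_convexBody hK h0).measurable
  have hle : ∀ a, (volume : Measure (Euc (m + 1))).map (gauge K) (Iic a) =
      ENNReal.ofReal (max a 0 ^ (m + 1)) * volume K := fun a => by
    rw [Measure.map_apply hm measurableSet_Iic, ← volume_setOf_gauge_le hK h0]
    rfl
  have hfin : ∀ a, (volume : Measure (Euc (m + 1))).map (gauge K) (Iic a) ≠ ⊤ := fun a => by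
    rw [hle]
    exact ENNReal.mul_ne_top ENNReal.ofReal_ne_top (volume_convexBody_ne_top hK)
  refine Measure.ext_of_Ioc' _ _
    (fun a b _ => ne_top_of_le_ne_top (hfin b) (measure_mono Ioc_subset_Iic_self))
    fun a b hab => ?_
  have h1 : Ioc a b = Iic b \ Iic a := by
    ext x
    simp [and_comm]
  conv_lhs => rw [h1]
  rw [measure_sdiff (Iic_subset_Iic.2 hab.le) measurableSet_Iic.nullMeasurableSet (hfin a),
    hle, hle, withDensity_apply _ measurableSet_Ioc, Measure.restrict_restrict measurableSet_Ioc]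
  have h2 : Ioc a b ∩ Ioi 0 = Ioc (max a 0) (max b 0) := by
    ext x
    simp only [mem_inter_iff, mem_Ioc, mem_Ioi, max_lt_iff, le_max_iff]
    constructor
    · rintro ⟨⟨h, h'⟩, h''⟩
      exact ⟨⟨h, h''⟩, Or.inl h'⟩
    · rintro ⟨⟨h, h'⟩, h'' | h''⟩
      · exact ⟨⟨h, h''⟩, h'⟩
      · linarith
  have hmax : max a 0 ≤ max b 0 := max_le_max_right 0 hab.le
  have hint : ∫ r in (max a 0)..(max b 0), (m + 1) * (volume K).toReal * r ^ m =
      (volume K).toReal * (max b 0 ^ (m + 1) - max a 0 ^ (m + 1)) := by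
    rw [intervalIntegral.integral_const_mul, integral_pow]
    field_simp
  have hcont : Continuous fun r : ℝ => (m + 1) * (volume K).toReal * r ^ m := by fun_prop
  rw [h2, ← ofReal_integral_eq_lintegral_ofReal, ← intervalIntegral.integral_of_le hmax, hint,
    mul_sub, ENNReal.ofReal_sub _ (by positivity), ENNReal.ofReal_mul ENNReal.toReal_nonneg,
    ENNReal.ofReal_mul ENNReal.toReal_nonneg, ENNReal.ofReal_toReal (volume_convexBody_ne_top hK),
    mul_comm (volume K), mul_comm (volume K)]
  · have h3 : IntervalIntegrable (fun r : ℝ => (m + 1) * (volume K).toReal * r ^ m) volume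
      (max a 0) (max b 0) := hcont.intervalIntegrable _ _
    exact h3.1
  · filter_upwards [ae_restrict_mem measurableSet_Ioc] with r hr
    have : 0 ≤ r := (le_max_right a 0).trans hr.1.le
    show (0 : ℝ) ≤ _
    positivity

theorem hasDerivAt_add_smul_gradient {n : ℕ} {f : Euc n → ℝ} {x : Euc n}
    (hx : DifferentiableAt ℝ f x) (z : Euc n) :
    HasDerivAt (fun t : ℝ => f (x + t • z)) ⟪gradient f x, z⟫ 0 := by
  have h2 : HasLineDerivAt ℝ f _ x z := hx.hasGradientAt.hasFDerivAt.hasLineDerivAt z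
  exact h2

theorem inner_gradient_gauge_le (hK : IsConvexBody K) (h0 : (0 : Euc (m + 1)) ∈ interior K)
    {x : Euc (m + 1)} (hx : DifferentiableAt ℝ (gauge K) x) (z : Euc (m + 1)) :
    ⟪gradient (gauge K) x, z⟫ ≤ gauge K z := by
  have h1 : HasDerivAt (fun t : ℝ => gauge K (x + t • z)) ⟪gradient (gauge K) x, z⟫ 0 :=
    hasDerivAt_add_smul_gradient hx z
  have h2 := h1.tendsto_slope_zero_right
  refine le_of_tendsto h2 ?_
  filter_upwards [self_mem_nhdsWithin] with t ht
  have ht' : 0 < t := ht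
  have h3 := gauge_add_le hK.2 (absorbent_nhds_zero (mem_interior_iff_mem_nhds.1 h0)) x (t • z)
  rw [gauge_smul_of_nonneg ht'.le, smul_eq_mul] at h3
  simp only [zero_add, zero_smul, add_zero, smul_eq_mul]
  rw [inv_mul_le_iff₀ ht']
  linarith

theorem inner_gradient_gauge_self {x : Euc (m + 1)} (hx : DifferentiableAt ℝ (gauge K) x) :
    ⟪gradient (gauge K) x, x⟫ = gauge K x := by
  have h1 : HasDerivAt (fun t : ℝ => gauge K (x + t • x)) ⟪gradient (gauge K) x, x⟫ 0 :=
    hasDerivAt_add_smul_gradient hx x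
  have h2 := h1.tendsto_slope_zero_right
  refine tendsto_nhds_unique h2 (tendsto_const_nhds.congr' ?_)
  filter_upwards [self_mem_nhdsWithin] with t ht
  have ht' : 0 < t := ht
  have h3 : gauge K (x + t • x) = (1 + t) * gauge K x := by
    have : x + t • x = (1 + t) • x := by rw [add_smul, one_smul]
    rw [this, gauge_smul_of_nonneg (by linarith), smul_eq_mul]
  simp only [zero_add, zero_smul, add_zero, smul_eq_mul, h3]
  field_simp
  ring

theorem gradient_gauge_ne_zero (hK : IsConvexBody K) (h0 : (0 : Euc (m + 1)) ∈ interior K)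
    {x : Euc (m + 1)} (hx : DifferentiableAt ℝ (gauge K) x) (hx0 : x ≠ 0) :
    gradient (gauge K) x ≠ 0 := by
  intro h
  have h1 := inner_gradient_gauge_self hx
  have h2 := (gauge_pos_iff_ne_zero hK h0).2 hx0
  rw [h, inner_zero_left] at h1
  linarith

theorem measurable_gradient {n : ℕ} (f : Euc n → ℝ) : Measurable (gradient f) :=
  (InnerProductSpace.toDual ℝ (Euc n)).symm.continuous.measurable.comp (measurable_fderiv ℝ f)

theorem abs_inner_sub_le_of_gauge_eq (hK : IsConvexBody K) (h0 : (0 : Euc (m + 1)) ∈ interior K)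
    {e x y : Euc (m + 1)} {δ : ℝ} (hx : DifferentiableAt ℝ (gauge K) x)
    (hy : DifferentiableAt ℝ (gauge K) y)
    (hxe : ‖‖gradient (gauge K) x‖⁻¹ • gradient (gauge K) x - e‖ ≤ δ)
    (hye : ‖‖gradient (gauge K) y‖⁻¹ • gradient (gauge K) y - e‖ ≤ δ)
    (hxy : gauge K x = gauge K y) : |⟪x - y, e⟫| ≤ δ * ‖x - y‖ := by
  have key : ∀ x y : Euc (m + 1), DifferentiableAt ℝ (gauge K) x →
      ‖‖gradient (gauge K) x‖⁻¹ • gradient (gauge K) x - e‖ ≤ δ → gauge K x = gauge K y →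
      -(δ * ‖x - y‖) ≤ ⟪x - y, e⟫ := by
    intro x y hx hxe hxy
    have h1 := inner_gradient_gauge_self hx
    have h2 := inner_gradient_gauge_le hK h0 hx y
    have h3 : 0 ≤ ⟪‖gradient (gauge K) x‖⁻¹ • gradient (gauge K) x, x - y⟫ := by
      rw [real_inner_smul_left, inner_sub_right]
      exact mul_nonneg (inv_nonneg.2 (norm_nonneg _)) (by linarith)
    have h4 := (abs_le.1 (abs_real_inner_le_norm
      (‖gradient (gauge K) x‖⁻¹ • gradient (gauge K) x - e) (x - y))).2
    have h5 : ‖‖gradient (gauge K) x‖⁻¹ • gradient (gauge K) x - e‖ * ‖x - y‖ ≤ δ * ‖x - y‖ := by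
      gcongr
    rw [inner_sub_left] at h4
    rw [real_inner_comm]
    linarith
  refine abs_le.2 ⟨key x y hx hxe hxy, ?_⟩
  have h := key y x hy hye hxy.symm
  rw [← neg_sub x y, norm_neg, inner_neg_left] at h
  linarith

end

section

variable {m : ℕ}

theorem hausdorffMeasure_le_mul_image {X Y : Type*} [Nonempty X] [MetricSpace X]
    [MeasurableSpace X] [BorelSpace X] [MetricSpace Y] [MeasurableSpace Y] [BorelSpace Y]
    {M : ℝ≥0} {P : X → Y} {E : Set X}
    (hM : ∀ x ∈ E, ∀ y ∈ E, dist x y ≤ M * dist (P x) (P y)) :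
    μH[(m : ℝ)] E ≤ (M : ℝ≥0∞) ^ m * μH[(m : ℝ)] (P '' E) := by
  have hinj : InjOn P E := fun x hx y hy hxy => by
    have := hM x hx y hy
    rw [hxy, dist_self, mul_zero] at this
    exact dist_le_zero.1 this
  have hl : LipschitzOnWith M (Function.invFunOn P E) (P '' E) := by
    refine LipschitzOnWith.of_dist_le_mul ?_
    rintro _ ⟨x, hx, rfl⟩ _ ⟨y, hy, rfl⟩
    rw [hinj.leftInvOn_invFunOn hx, hinj.leftInvOn_invFunOn hy]
    exact hM x hx y hy
  have h1 := hl.hausdorffMeasure_image_le (Nat.cast_nonneg m)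
  rwa [hinj.leftInvOn_invFunOn.image_image, ENNReal.rpow_natCast] at h1

theorem exists_le_slice {u : Euc (m + 1) → ℝ} (hu : Measurable u) {e : Euc (m + 1)}
    {T : (ℝ × Euc m) ≃L[ℝ] Euc (m + 1)} (hTv : MeasurePreserving T)
    (hTe : ∀ s y, T (s, y) = s • e + T (0, y))
    (hT : ∀ p, ‖T p‖ ^ 2 = p.1 ^ 2 + ‖p.2‖ ^ 2) {c : ℝ≥0∞}
    (hc : (μH[(m : ℝ)] : Measure (Euc m)) = c • volume)
    {A : Set (Euc (m + 1))} (hA : MeasurableSet A) (hdiff : ∀ x ∈ A, DifferentiableAt ℝ u x)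
    {M : ℝ≥0} (hM : ∀ x ∈ A, ∀ y ∈ A, u x = u y →
      dist x y ≤ M * dist (T.symm x).2 (T.symm y).2) {ψ : Euc (m + 1) → ℝ≥0∞} (hψ : Measurable ψ) :
    ∃ Q : ℝ → ℝ≥0∞, Measurable Q ∧ (∀ t, ∫⁻ x in u ⁻¹' {t} ∩ A, ψ x ∂μH[(m : ℝ)] ≤ Q t) ∧
      ∀ S, MeasurableSet S → ∫⁻ t in S, Q t ≤
        (M : ℝ≥0∞) ^ m * c * ∫⁻ x in u ⁻¹' S ∩ A, ENNReal.ofReal |⟪gradient u x, e⟫| * ψ x := by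
  have hP := lipschitzWith_snd_lineCoords hT
  have hPm : Measurable fun x => (T.symm x).2 := hP.continuous.measurable
  have hinj : InjOn (fun x => (u x, (T.symm x).2)) A := by
    intro x hx y hy hxy
    simp only [Prod.mk.injEq] at hxy
    have := hM x hx y hy hxy.1
    rw [hxy.2, dist_self, mul_zero] at this
    exact dist_le_zero.1 this
  obtain ⟨F, hF, hF1, hF0⟩ := exists_fiber_density (G := fun x => (u x, (T.symm x).2))
    (hu.prodMk hPm) hA hinj hψ
  refine ⟨fun t => (M : ℝ≥0∞) ^ m * c * ∫⁻ y, F (t, y), hF.lintegral_prod_right'.const_mul _,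
    fun t => ?_, fun S hS => ?_⟩
  · set E := u ⁻¹' {t} ∩ A with hE
    have hEm : MeasurableSet E := (hu (measurableSet_singleton t)).inter hA
    have h1 : (μH[(m : ℝ)].restrict E).map (fun x => (T.symm x).2) ≤
        ((M : ℝ≥0∞) ^ m * c) • (volume : Measure (Euc m)) := by
      refine Measure.le_iff.2 fun S hS => ?_
      rw [Measure.map_apply hPm hS, Measure.restrict_apply (hPm hS)]
      have h2 := hausdorffMeasure_le_mul_image (m := m) (M := M) (P := fun x => (T.symm x).2)
        (E := (fun x => (T.symm x).2) ⁻¹' S ∩ E) fun x hx y hy =>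
          hM x hx.2.2 y hy.2.2 (hx.2.1.trans (Eq.symm hy.2.1))
      refine h2.trans ?_
      rw [Measure.smul_apply, smul_eq_mul, mul_assoc]
      refine mul_le_mul_right ?_ _
      rw [hc, Measure.smul_apply, smul_eq_mul]
      refine mul_le_mul_right (measure_mono ?_) _
      rintro _ ⟨x, hx, rfl⟩
      exact hx.1
    have hFt : Measurable fun y => F (t, y) := by fun_prop
    have h2 : ∫⁻ x in E, ψ x ∂μH[(m : ℝ)] = ∫⁻ x in E, F (t, (T.symm x).2) ∂μH[(m : ℝ)] := by
      refine setLIntegral_congr_fun hEm fun x hx => ?_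
      have h1 : u x = t := hx.1
      rw [← hF1 x hx.2, h1]
    rw [h2, ← lintegral_map (f := fun y => F (t, y)) hFt hPm]
    refine (lintegral_mono' h1 le_rfl).trans ?_
    rw [lintegral_smul_measure, smul_eq_mul]
  rw [lintegral_const_mul _ hF.lintegral_prod_right']
  refine mul_le_mul_right ?_ _
  have hswap : ∫⁻ t in S, ∫⁻ y, F (t, y) = ∫⁻ y, ∫⁻ t in S, F (t, y) :=
    lintegral_lintegral_swap (f := fun t y => F (t, y)) hF.aemeasurable
  have hTm : Measurable T := T.continuous.measurable
  have hB : MeasurableSet (u ⁻¹' S ∩ A) := (hu hS).inter hA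
  have hk : Measurable fun x => ⟪gradient u x, e⟫ :=
    (measurable_gradient u).inner measurable_const
  have hkψ : Measurable fun x => ENNReal.ofReal |⟪gradient u x, e⟫| * ψ x :=
    (ENNReal.measurable_ofReal.comp hk.norm).mul hψ
  have hkT : Measurable fun a => ENNReal.ofReal |⟪gradient u (T a), e⟫| * ψ (T a) := hkψ.comp hTm
  rw [← hTv.setLIntegral_comp_preimage hB hkψ, Measure.volume_eq_prod,
    ← lintegral_indicator (hTm hB), lintegral_prod_symm _
      (hkT.indicator (hTm hB)).aemeasurable, hswap]
  refine lintegral_mono fun y => ?_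
  have hTy : Measurable fun s : ℝ => T (s, y) := by fun_prop
  set w : ℝ → ℝ := fun s => u (T (s, y)) with hw
  set D : Set ℝ := (fun s => T (s, y)) ⁻¹' A with hD
  have hDm : MeasurableSet D := hTy hA
  have hwinj : InjOn w D := by
    intro s hs s' hs' h
    have h1 := hinj hs hs' (by simpa using h)
    simpa using T.injective h1
  have hwd : ∀ s ∈ D, HasDerivWithinAt w ⟪gradient u (T (s, y)), e⟫ D s := by
    intro s hs
    have h1 := hasDerivAt_add_smul_gradient (hdiff _ hs) e
    have h2 : HasDerivAt (fun τ : ℝ => u (T (s, y) + (τ - s) • e))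
        ⟪gradient u (T (s, y)), e⟫ s := by
      have h3 := HasDerivAt.comp_sub_const (f := fun τ : ℝ => u (T (s, y) + τ • e)) s s
        (by rw [sub_self]; exact h1)
      exact h3
    refine (h2.congr_of_eventuallyEq (Eventually.of_forall fun τ => ?_)).hasDerivWithinAt
    simp only [hw]
    rw [hTe s, hTe τ, sub_smul]
    congr 1
    abel
  have hSm : MeasurableSet (w ⁻¹' S ∩ D) := ((hu.comp hTy) hS).inter hDm
  have h1 := lintegral_image_fiber_density hwd hwinj
    (f := fun t => F (t, y)) (p := fun s => ψ (T (s, y))) (fun s hs => by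
      rw [← hF1 _ hs]
      simp [hw]) (S := S) hSm
  calc ∫⁻ t in S, F (t, y) = ∫⁻ t in S, (S ∩ w '' D).indicator (fun t => F (t, y)) t := by
        refine setLIntegral_congr_fun hS fun t ht => ?_
        by_cases h : t ∈ S ∩ w '' D
        · rw [indicator_of_mem h]
        · rw [indicator_of_notMem h]
          refine hF0 _ ?_
          rintro ⟨x, hx, hxt⟩
          simp only [Prod.mk.injEq] at hxt
          refine h ⟨ht, (T.symm x).1, ?_, ?_⟩
          · show T ((T.symm x).1, y) ∈ A
            rw [← hxt.2]
            simpa using hx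
          · show u (T ((T.symm x).1, y)) = t
            rw [← hxt.2, ← hxt.1]
            simp
    _ ≤ ∫⁻ t, (S ∩ w '' D).indicator (fun t => F (t, y)) t := setLIntegral_le_lintegral _ _
    _ ≤ ∫⁻ t in S ∩ w '' D, F (t, y) := lintegral_indicator_le _ _
    _ = ∫⁻ s in w ⁻¹' S ∩ D, ENNReal.ofReal |⟪gradient u (T (s, y)), e⟫| * ψ (T (s, y)) := h1
    _ = ∫⁻ s, (T ⁻¹' (u ⁻¹' S ∩ A)).indicator
        (fun x => ENNReal.ofReal |⟪gradient u (T x), e⟫| * ψ (T x)) (s, y) := by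
        rw [← lintegral_indicator hSm]
        refine lintegral_congr fun s => ?_
        by_cases h : T (s, y) ∈ u ⁻¹' S ∩ A
        · rw [indicator_of_mem (show (s, y) ∈ T ⁻¹' (u ⁻¹' S ∩ A) from h), indicator_of_mem]
          exact h
        · rw [indicator_of_notMem (show (s, y) ∉ T ⁻¹' (u ⁻¹' S ∩ A) from h), indicator_of_notMem]
          exact h

theorem ae_setLIntegral_gauge_le_mul {K : Set (Euc (m + 1))} (hK : IsConvexBody K)
    (h0 : (0 : Euc (m + 1)) ∈ interior K) {κ : ℝ≥0∞}
    (hκ : (μH[(m : ℝ)] : Measure (Euc m)) = κ • volume) {δ : ℝ} (hδ0 : 0 < δ) (hδ1 : δ < 1) :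
    ∀ᵐ r : ℝ, 0 < r →
      ∫⁻ x in {x | gauge K x = r ∧ DifferentiableAt ℝ (gauge K) x},
          (ENNReal.ofReal ‖gradient (gauge K) x‖)⁻¹ ∂μH[(m : ℝ)] ≤
        ENNReal.ofReal ((√(1 - δ ^ 2))⁻¹) ^ m * κ *
          ENNReal.ofReal ((m + 1) * (volume K).toReal * r ^ m) := by
  have hH : Measurable (gauge K) := (continuous_gauge_convexBody hK h0).measurable
  have hg := measurable_gradient (gauge K)
  obtain ⟨d, hd1, hd⟩ := exists_dense_directions m
  choose T hTv hTe hTi hTn using fun i => exists_lineCoords (d i) (hd1 i)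
  set M : ℝ≥0 := (√(1 - δ ^ 2))⁻¹.toNNReal with hMdef
  have hδ2 : 0 < 1 - δ ^ 2 := by nlinarith
  have hM' : (M : ℝ) = (√(1 - δ ^ 2))⁻¹ := Real.coe_toNNReal _ (by positivity)
  set B : ℕ → Set (Euc (m + 1)) := fun i => {x | DifferentiableAt ℝ (gauge K) x} ∩
    {x | ‖‖gradient (gauge K) x‖⁻¹ • gradient (gauge K) x - d i‖ < δ} with hB
  have hBm : ∀ i, MeasurableSet (B i) := fun i =>
    (measurableSet_of_differentiableAt ℝ _).inter
      (measurableSet_lt ((hg.norm.inv.smul hg).sub measurable_const).norm measurable_const)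
  set A := disjointed B with hA
  have hAm : ∀ i, MeasurableSet (A i) := fun i => MeasurableSet.disjointed hBm i
  have hAB : ∀ i, A i ⊆ B i := disjointed_subset B
  set ψ : Euc (m + 1) → ℝ≥0∞ := fun x => (ENNReal.ofReal ‖gradient (gauge K) x‖)⁻¹ with hψ
  have hψm : Measurable ψ := hg.norm.ennreal_ofReal.inv
  have hMi : ∀ i, ∀ x ∈ A i, ∀ y ∈ A i, gauge K x = gauge K y →
      dist x y ≤ M * dist ((T i).symm x).2 ((T i).symm y).2 := by
    intro i x hx y hy hxy
    have h1 := abs_inner_sub_le_of_gauge_eq hK h0 (hAB i hx).1 (hAB i hy).1 (hAB i hx).2.le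
      (hAB i hy).2.le hxy
    have h2 := hTn i ((T i).symm (x - y))
    have h3 : ⟪x - y, d i⟫ = ((T i).symm (x - y)).1 := by
      conv_lhs => rw [← (T i).apply_symm_apply (x - y)]
      exact hTi i _ _
    rw [(T i).apply_symm_apply, ← h3] at h2
    have h4 : ((T i).symm (x - y)).2 = ((T i).symm x).2 - ((T i).symm y).2 := by
      rw [map_sub]; rfl
    rw [h4] at h2
    rw [dist_eq_norm, dist_eq_norm, hM', inv_mul_eq_div, le_div_iff₀ (Real.sqrt_pos.2 hδ2)]
    refine abs_le_of_sq_le_sq' ?_ (norm_nonneg _) |>.2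
    rw [mul_pow, Real.sq_sqrt hδ2.le]
    have h5 : ⟪x - y, d i⟫ ^ 2 ≤ (δ * ‖x - y‖) ^ 2 := sq_le_sq' (by
      linarith [neg_abs_le ⟪x - y, d i⟫]) ((le_abs_self _).trans h1)
    nlinarith
  choose Q hQm hQle hQS using fun i => exists_le_slice hH (hTv i) (hTe i) (hTn i) hκ (hAm i)
    (fun x hx => (hAB i hx).1) (hMi i) hψm
  have hg0 : Measurable fun r : ℝ => ENNReal.ofReal ((m + 1) * (volume K).toReal * r ^ m) := by
    fun_prop
  have key : (fun r => ∑' i, Q i r) ≤ᵐ[volume.restrict (Ioi 0)] fun r => (M : ℝ≥0∞) ^ m * κ *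
      ENNReal.ofReal ((m + 1) * (volume K).toReal * r ^ m) := by
    refine ae_le_of_forall_setLIntegral_le_of_sigmaFinite (Measurable.tsum hQm)
      fun S hS _ => ?_
    rw [Measure.restrict_restrict hS, lintegral_tsum fun i => (hQm i).aemeasurable]
    have hS' := hS.inter (measurableSet_Ioi (a := (0 : ℝ)))
    calc ∑' i, ∫⁻ t in S ∩ Ioi 0, Q i t
        ≤ ∑' i, (M : ℝ≥0∞) ^ m * κ * volume (gauge K ⁻¹' (S ∩ Ioi 0) ∩ A i) := by
          refine ENNReal.tsum_le_tsum fun i => (hQS i _ hS').trans (mul_le_mul_right ?_ _)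
          rw [← setLIntegral_one]
          refine lintegral_mono fun x => ?_
          rw [hψ, ← div_eq_mul_inv]
          refine ENNReal.div_le_of_le_mul ?_
          rw [one_mul]
          refine ENNReal.ofReal_le_ofReal ((abs_real_inner_le_norm _ _).trans ?_)
          rw [hd1, mul_one]
      _ ≤ (M : ℝ≥0∞) ^ m * κ * volume (gauge K ⁻¹' (S ∩ Ioi 0)) := by
          rw [ENNReal.tsum_mul_left, ← measure_iUnion
            (fun i j hij => ((disjoint_disjointed B) hij).mono inter_subset_right inter_subset_right)
            fun i => (hH hS').inter (hAm i)]
          exact mul_le_mul_right (measure_mono (iUnion_subset fun i => inter_subset_left)) _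
      _ = _ := by
          rw [lintegral_const_mul _ hg0, ← Measure.map_apply hH hS', map_gauge_volume hK h0,
            withDensity_apply _ hS', Measure.restrict_restrict hS', inter_assoc, inter_self]
  rw [EventuallyLE, ae_restrict_iff' measurableSet_Ioi] at key
  filter_upwards [key] with r hr hr0
  refine le_trans ?_ (hr hr0)
  have hsub : {x | gauge K x = r ∧ DifferentiableAt ℝ (gauge K) x} ⊆
      ⋃ i, gauge K ⁻¹' {r} ∩ A i := by
    rintro x ⟨hx, hxd⟩
    have hx0 : x ≠ 0 := (gauge_pos_iff_ne_zero hK h0).1 (hx ▸ hr0)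
    obtain ⟨i, hi⟩ := hd _ δ (gradient_gauge_ne_zero hK h0 hxd hx0) hδ0
    have h1 : x ∈ ⋃ i, A i := by
      rw [hA, iUnion_disjointed]
      exact mem_iUnion.2 ⟨i, hxd, hi⟩
    obtain ⟨j, hj⟩ := mem_iUnion.1 h1
    exact mem_iUnion.2 ⟨j, hx, hj⟩
  exact (lintegral_mono_set hsub).trans ((lintegral_iUnion_le _ _).trans
    (ENNReal.tsum_le_tsum fun i => hQle i r))

theorem ae_setLIntegral_gauge_le {K : Set (Euc (m + 1))} (hK : IsConvexBody K)
    (h0 : (0 : Euc (m + 1)) ∈ interior K) {κ : ℝ≥0∞}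
    (hκ : (μH[(m : ℝ)] : Measure (Euc m)) = κ • volume) :
    ∀ᵐ r : ℝ, 0 < r →
      ∫⁻ x in {x | gauge K x = r ∧ DifferentiableAt ℝ (gauge K) x},
          (ENNReal.ofReal ‖gradient (gauge K) x‖)⁻¹ ∂μH[(m : ℝ)] ≤
        κ * ENNReal.ofReal ((m + 1) * (volume K).toReal * r ^ m) := by
  have h1 : ∀ᵐ r : ℝ, ∀ j : ℕ, 0 < r → _ := ae_all_iff.2 fun j : ℕ =>
    ae_setLIntegral_gauge_le_mul hK h0 hκ (δ := 1 / ((j : ℝ) + 2)) (by positivity)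
      (by rw [div_lt_one (by positivity)]; linarith [(Nat.cast_nonneg j : (0 : ℝ) ≤ j)])
  filter_upwards [h1] with r hr hr0
  have hδ : Tendsto (fun j : ℕ => 1 / ((j : ℝ) + 2)) atTop (𝓝 0) := by
    have := tendsto_one_div_add_atTop_nhds_zero_nat (𝕜 := ℝ)
    refine ((tendsto_add_atTop_iff_nat 1).2 this).congr fun j => ?_
    push_cast
    ring
  have h2 : Tendsto (fun j : ℕ => (√(1 - (1 / ((j : ℝ) + 2)) ^ 2))⁻¹) atTop (𝓝 1) := by
    have h3 := ((Real.continuous_sqrt.tendsto _).comp ((hδ.pow 2).const_sub 1)).inv₀ (by simp)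
    simpa using h3
  have h3 : Tendsto (fun j : ℕ => ENNReal.ofReal ((√(1 - (1 / ((j : ℝ) + 2)) ^ 2))⁻¹) ^ m * κ *
      ENNReal.ofReal ((m + 1) * (volume K).toReal * r ^ m)) atTop
      (𝓝 (1 * (κ * ENNReal.ofReal ((m + 1) * (volume K).toReal * r ^ m)))) := by
    simp only [mul_assoc]
    refine ENNReal.Tendsto.mul_const ?_ (Or.inl one_ne_zero)
    simpa using ENNReal.Tendsto.pow (n := m) (ENNReal.tendsto_ofReal h2)
  rw [one_mul] at h3
  exact ge_of_tendsto h3 (Eventually.of_forall fun j => hr j hr0)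

end

section

variable {m : ℕ} {K : Set (Euc (m + 1))} {u : Euc (m + 1) → ℝ}

theorem iInter_setOf_lt_natCast {α : Type*} (u : α → ℝ) (t : ℝ) :
    ⋂ j : ℕ, {x | t + j < u x} = ∅ := by
  refine eq_empty_of_forall_notMem fun x hx => ?_
  obtain ⟨j, hj⟩ := exists_nat_gt (u x - t)
  have h1 : t + j < u x := mem_iInter.1 hx j
  linarith

theorem exists_eInf_lt {n : ℕ} (u : Euc n → ℝ) : ∃ t : ℝ, eInf u < (t : EReal) := by
  have h1 : eInf u < ⊤ := by
    refine lt_top_iff_ne_top.2 fun h => ?_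
    have h2 := ae_essInf_le (μ := (volume : Measure (Euc n))) (f := fun x => (u x : EReal))
    obtain ⟨x, hx⟩ := h2.exists
    have h3 : (⊤ : EReal) ≤ (u x : EReal) := by
      rw [← h]
      exact hx
    exact EReal.coe_ne_top _ (top_le_iff.1 h3)
  obtain ⟨q, hq, -⟩ := EReal.lt_iff_exists_real_btwn.1 h1
  exact ⟨q, hq⟩

theorem exists_distFn_le (hu : MemMd u) {s : ℝ} (hs : 0 < s) :
    ∃ t, distFn u t ≤ ENNReal.ofReal s := by
  obtain ⟨t, ht⟩ := exists_eInf_lt u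
  have h1 : Tendsto (fun j : ℕ => volume {x | t + j < u x}) atTop
      (𝓝 (volume (⋂ j : ℕ, {x | t + j < u x}))) := by
    refine tendsto_measure_iInter_atTop
      (fun j => (measurableSet_lt measurable_const hu.1).nullMeasurableSet) ?_ ⟨0, ?_⟩
    · intro i j hij x hx
      have h2 : t + j < u x := hx
      have h3 : (i : ℝ) ≤ j := Nat.cast_le.2 hij
      exact lt_of_le_of_lt (by linarith) h2
    · have h2 : volume {x | t < u x} ≠ ⊤ := (hu.2 t ht).ne
      simpa using h2
  rw [iInter_setOf_lt_natCast, measure_empty] at h1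
  obtain ⟨j, hj⟩ := (h1.eventually_lt_const (ENNReal.ofReal_pos.2 hs)).exists
  exact ⟨t + j, hj.le⟩

theorem bddBelow_setOf_distFn_le (u : Euc (m + 1) → ℝ) (s : ℝ) :
    BddBelow {t | distFn u t ≤ ENNReal.ofReal s} := by
  have h1 : Tendsto (fun j : ℕ => volume {x | -(j : ℝ) < u x}) atTop
      (𝓝 (volume (⋃ j : ℕ, {x | -(j : ℝ) < u x}))) := by
    refine tendsto_measure_iUnion_atTop fun i j hij x hx => ?_
    have h2 : -(i : ℝ) < u x := hx
    have h3 : (i : ℝ) ≤ j := Nat.cast_le.2 hij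
    exact lt_of_le_of_lt (by linarith) h2
  have h2 : ⋃ j : ℕ, {x | -(j : ℝ) < u x} = univ := by
    refine eq_univ_of_forall fun x => ?_
    obtain ⟨j, hj⟩ := exists_nat_gt (-u x)
    exact mem_iUnion.2 ⟨j, show -(j : ℝ) < u x by linarith⟩
  rw [h2, measure_univ_of_isAddLeftInvariant] at h1
  obtain ⟨j, hj⟩ := (h1.eventually_const_lt (ENNReal.ofReal_lt_top (r := s))).exists
  refine ⟨-(j : ℝ), fun t ht => ?_⟩
  by_contra! h
  exact absurd ((antitone_distFn u h.le).trans ht) (not_le.2 hj)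

theorem decRearr_le_iff (hu : MemMd u) {s : ℝ} (hs : 0 < s) {t : ℝ} :
    decRearr u s ≤ t ↔ distFn u t ≤ ENNReal.ofReal s := by
  have hne : {t | distFn u t ≤ ENNReal.ofReal s}.Nonempty := exists_distFn_le hu hs
  have hbd := bddBelow_setOf_distFn_le u s
  refine ⟨fun h => ?_, fun h => csInf_le hbd h⟩
  have h1 : {x | t < u x} = ⋃ j : ℕ, {x | t + 1 / ((j : ℝ) + 1) < u x} := by
    ext x
    simp only [Set.mem_ofPred_eq, mem_iUnion]
    refine ⟨fun hx => ?_, fun ⟨j, hj⟩ => lt_trans (by simp; positivity) hj⟩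
    obtain ⟨j, hj⟩ := exists_nat_one_div_lt (sub_pos.2 hx)
    exact ⟨j, by linarith⟩
  rw [distFn, h1, Monotone.measure_iUnion]
  · refine iSup_le fun j => ?_
    have h2 : sInf {t | distFn u t ≤ ENNReal.ofReal s} < t + 1 / ((j : ℝ) + 1) :=
      lt_of_le_of_lt h (by simp; positivity)
    obtain ⟨t', ht', htt⟩ := exists_lt_of_csInf_lt hne h2
    exact (antitone_distFn u htt.le).trans ht'
  · intro i j hij x hx
    have h2 : t + 1 / ((i : ℝ) + 1) < u x := hx
    have h3 : 1 / ((j : ℝ) + 1) ≤ 1 / ((i : ℝ) + 1) := Nat.one_div_le_one_div hij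
    exact lt_of_le_of_lt (by linarith) h2

/-- The radial profile of the symmetral `u^K`. -/
def radProfile (K : Set (Euc (m + 1))) (u : Euc (m + 1) → ℝ) (r : ℝ) : ℝ :=
  decRearr u ((volume K).toReal * r ^ (m + 1))

theorem radProfile_le_iff (hK : 0 < (volume K).toReal) (hu : MemMd u) {r : ℝ} (hr : 0 < r) {t : ℝ} :
    radProfile K u r ≤ t ↔ distFn u t ≤ ENNReal.ofReal ((volume K).toReal * r ^ (m + 1)) :=
  decRearr_le_iff hu (by positivity)

theorem antitoneOn_radProfile (hK : 0 < (volume K).toReal) (hu : MemMd u) :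
    AntitoneOn (radProfile K u) (Ioi 0) := by
  intro r hr r' hr' h
  have h0 : (0 : ℝ) < r := hr
  rw [radProfile_le_iff hK hu hr']
  refine ((radProfile_le_iff hK hu hr).1 le_rfl).trans (ENNReal.ofReal_le_ofReal ?_)
  gcongr

theorem eq_of_antitoneOn_of_hasDerivAt {f : ℝ → ℝ} (hf : AntitoneOn f (Ioi 0)) {r r' d : ℝ}
    (hr : 0 < r) (hr' : 0 < r') (hd : HasDerivAt f d r) (hd0 : d ≠ 0) (h : f r' = f r) :
    r' = r := by
  by_contra hne
  refine hd0 ?_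
  rcases lt_or_gt_of_ne hne with hlt | hlt
  · have h1 : HasDerivWithinAt f 0 (Iio r) r := by
      refine (hasDerivWithinAt_const r _ (f r)).congr_of_eventuallyEq ?_ rfl
      filter_upwards [Ioo_mem_nhdsLT hlt] with s hs
      exact le_antisymm (h ▸ hf hr' (hr'.trans hs.1) hs.1.le) (hf (hr'.trans hs.1) hr hs.2.le)
    exact (uniqueDiffWithinAt_Iio r).eq_deriv _ hd.hasDerivWithinAt h1
  · have h1 : HasDerivWithinAt f 0 (Ioi r) r := by
      refine (hasDerivWithinAt_const r _ (f r)).congr_of_eventuallyEq ?_ rfl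
      filter_upwards [Ioo_mem_nhdsGT hlt] with s hs
      exact le_antisymm (hf hr (hr.trans hs.1) hs.1.le) (h ▸ hf (hr.trans hs.1) hr' hs.2.le)
    exact (uniqueDiffWithinAt_Ioi r).eq_deriv _ hd.hasDerivWithinAt h1

theorem distFn_radProfile_eq (hK : 0 < (volume K).toReal) (hu : MemMd u) {r d : ℝ} (hr : 0 < r)
    (hd : HasDerivAt (radProfile K u) d r) (hd0 : d ≠ 0) :
    distFn u (radProfile K u r) = ENNReal.ofReal ((volume K).toReal * r ^ (m + 1)) := by
  refine le_antisymm ((radProfile_le_iff hK hu hr).1 le_rfl) ?_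
  by_contra! hlt
  have hc : Tendsto (fun s : ℝ => ENNReal.ofReal ((volume K).toReal * s ^ (m + 1))) (𝓝[<] r)
      (𝓝 (ENNReal.ofReal ((volume K).toReal * r ^ (m + 1)))) := by
    refine (ENNReal.continuous_ofReal.comp ?_).continuousAt.tendsto.mono_left nhdsWithin_le_nhds
    fun_prop
  obtain ⟨s, hs, hsr⟩ := ((hc.eventually_const_lt hlt).and (Ioo_mem_nhdsLT hr)).exists
  have h1 : radProfile K u s = radProfile K u r :=
    le_antisymm ((radProfile_le_iff hK hu hsr.1).2 hs.le)
      (antitoneOn_radProfile hK hu hsr.1 hr hsr.2.le)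
  exact hsr.2.ne (eq_of_antitoneOn_of_hasDerivAt (antitoneOn_radProfile hK hu) hr hsr.1 hd hd0 h1)

theorem ae_rnDeriv_le_of_hasDerivAt_radProfile (hK : 0 < (volume K).toReal) (hu : MemMd u) {s : ℝ}
    (hs : distFn u s ≠ ⊤) :
    ∀ᵐ t : ℝ, ∀ r a : ℝ, 0 < r → 0 < a → radProfile K u r = t →
      HasDerivAt (radProfile K u) (-a) r →
      ((volume.restrict (u ⁻¹' Ioi s)).map u).rnDeriv volume t ≤
        ENNReal.ofReal ((m + 1) * (volume K).toReal * r ^ m / a) := by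
  set ν : Measure ℝ := (volume.restrict (u ⁻¹' Ioi s)).map u with hν
  have : IsFiniteMeasure (volume.restrict (u ⁻¹' Ioi s)) := by
    refine isFiniteMeasure_restrict.2 ?_
    exact hs
  have : IsFiniteMeasure ν := Measure.isFiniteMeasure_map _ _
  filter_upwards [(IsUnifLocDoublingMeasure.vitaliFamily (volume : Measure ℝ) 1).ae_tendsto_rnDeriv
      ν] with t ht r a hr ha hrt hd
  set φ := radProfile K u with hφ
  set k := (volume K).toReal with hk
  have hslope : Tendsto (fun r' => (r' - r)⁻¹ * (φ r' - φ r)) (𝓝[>] r) (𝓝 (-a)) := by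
    have h1 := (hasDerivAt_iff_tendsto_slope.1 hd).mono_left
      (nhdsWithin_mono r fun x (hx : r < x) => hx.ne')
    refine h1.congr fun x => ?_
    rw [slope_def_module, smul_eq_mul]
  have hid : Tendsto (fun r' : ℝ => r' - r) (𝓝[>] r) (𝓝 0) := by
    have h1 : Tendsto (fun r' : ℝ => r' - r) (𝓝 r) (𝓝 (r - r)) := tendsto_id.sub_const r
    rw [sub_self] at h1
    exact h1.mono_left nhdsWithin_le_nhds
  have hpow : Tendsto (fun r' : ℝ => (r' - r)⁻¹ * (k * r' ^ (m + 1) - k * r ^ (m + 1))) (𝓝[>] r)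
      (𝓝 ((m + 1) * k * r ^ m)) := by
    have h0 : HasDerivAt (fun r' : ℝ => k * r' ^ (m + 1)) ((m + 1) * k * r ^ m) r := by
      have h1 := (hasDerivAt_pow (m + 1) r).const_mul k
      refine h1.congr_deriv ?_
      push_cast
      ring
    have h1 := (hasDerivAt_iff_tendsto_slope.1 h0).mono_left
      (nhdsWithin_mono r fun x (hx : r < x) => hx.ne')
    refine h1.congr fun x => ?_
    rw [slope_def_module, smul_eq_mul]
  set τ : ℝ → ℝ := fun r' => φ r' + (r' - r) ^ 2 with hτ
  have hτs : Tendsto (fun r' => (r' - r)⁻¹ * (t - τ r')) (𝓝[>] r) (𝓝 a) := by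
    have h1 := hslope.neg.sub hid
    rw [neg_neg, sub_zero] at h1
    refine h1.congr' ?_
    filter_upwards [self_mem_nhdsWithin] with x hx
    have hx0 : x - r ≠ 0 := (sub_pos.2 hx).ne'
    rw [hτ, ← hrt]
    field_simp
    ring
  have hτt : Tendsto τ (𝓝[>] r) (𝓝[<] t) := by
    refine tendsto_nhdsWithin_iff.2 ⟨?_, ?_⟩
    · have h1 := (hd.continuousAt.tendsto.mono_left (nhdsWithin_le_nhds (s := Ioi r))).add
        (hid.pow 2)
      rw [hrt] at h1
      simpa using h1
    · filter_upwards [hτs.eventually_const_lt ha, self_mem_nhdsWithin] with x hx hxr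
      have hx0 : 0 < x - r := sub_pos.2 hxr
      have := (pos_iff_pos_of_mul_pos hx).1 (inv_pos.2 hx0)
      exact sub_pos.1 this
  have h1 := (ht.comp (Real.tendsto_Icc_vitaliFamily_left t)).comp hτt
  have h2 : Tendsto (fun r' => ENNReal.ofReal ((r' - r)⁻¹ * (k * r' ^ (m + 1) - k * r ^ (m + 1)) /
      ((r' - r)⁻¹ * (t - τ r')))) (𝓝[>] r) (𝓝 (ENNReal.ofReal ((m + 1) * k * r ^ m / a))) :=
    ENNReal.tendsto_ofReal (hpow.div hτs ha.ne')
  refine le_of_tendsto_of_tendsto h1 h2 ?_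
  have hanti := antitoneOn_radProfile hK hu
  filter_upwards [self_mem_nhdsWithin, hτt.eventually self_mem_nhdsWithin] with x hx hxt
  have hx0 : 0 < x - r := sub_pos.2 hx
  have hxr0 : 0 < x := hr.trans hx
  have hxt' : 0 < t - τ x := sub_pos.2 hxt
  have hkx : k * r ^ (m + 1) ≤ k * x ^ (m + 1) := by
    have : r ≤ x := le_of_lt hx
    gcongr
  simp only [Function.comp_apply]
  rw [Real.volume_Icc, mul_div_mul_left _ _ (inv_pos.2 hx0).ne', ENNReal.ofReal_div_of_pos hxt']
  refine ENNReal.div_le_div_right ?_ _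
  rw [hν, Measure.map_apply hu.1 measurableSet_Icc]
  refine (Measure.restrict_apply_le _ _).trans ?_
  have hμt : distFn u t = ENNReal.ofReal (k * r ^ (m + 1)) := by
    rw [← hrt]
    exact distFn_radProfile_eq hK hu hr hd (neg_ne_zero.2 ha.ne')
  have hsub : u ⁻¹' Icc (τ x) t ⊆ {y | φ x < u y} \ {y | t < u y} := by
    intro y hy
    refine ⟨lt_of_lt_of_le ?_ hy.1, not_lt.2 hy.2⟩
    show φ x < φ x + (x - r) ^ 2
    have := pow_pos hx0 2
    linarith
  refine (measure_mono hsub).trans ?_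
  have hφxt : φ x ≤ t := hrt ▸ hanti hr hxr0 (le_of_lt hx)
  have hsub' : {y | t < u y} ⊆ {y | φ x < u y} := fun y (hy : t < u y) => lt_of_le_of_lt hφxt hy
  rw [measure_sdiff hsub' (measurableSet_lt measurable_const hu.1).nullMeasurableSet
    (by show distFn u t ≠ ⊤; rw [hμt]; exact ENNReal.ofReal_ne_top)]
  have h3 : volume {y | t < u y} = ENNReal.ofReal (k * r ^ (m + 1)) := hμt
  rw [h3, ENNReal.ofReal_sub _ (by positivity)]
  exact tsub_le_tsub_right ((radProfile_le_iff hK hu hxr0).1 le_rfl) _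

end

section

variable {m : ℕ}

theorem ae_ae_lineCoords_of_ae {T : (ℝ × Euc m) ≃L[ℝ] Euc (m + 1)} (hT : MeasurePreserving T)
    {p : Euc (m + 1) → Prop} (hp : ∀ᵐ x, p x) : ∀ᵐ y : Euc m, ∀ᵐ s : ℝ, p (T (s, y)) := by
  have h1 : ∀ᵐ z : ℝ × Euc m, p (T z) := hT.quasiMeasurePreserving.ae hp
  have h2 : ∀ᵐ z ∂(volume : Measure (Euc m)).prod (volume : Measure ℝ), p (T z.swap) :=
    Measure.measurePreserving_swap.quasiMeasurePreserving.ae h1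
  exact Measure.ae_ae_of_ae_prod h2

theorem ae_of_ae_ae_lineCoords {T : (ℝ × Euc m) ≃L[ℝ] Euc (m + 1)} (hT : MeasurePreserving T)
    {p : Euc (m + 1) → Prop} (hpm : MeasurableSet {x | p x})
    (hp : ∀ᵐ y : Euc m, ∀ᵐ s : ℝ, p (T (s, y))) : ∀ᵐ x, p x := by
  have hTm : Measurable T := T.continuous.measurable
  have hm : MeasurableSet {z : ℝ × Euc m | p (T z)} := hTm hpm
  have h1 := (Measure.ae_ae_comm (μ := (volume : Measure ℝ)) (ν := (volume : Measure (Euc m)))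
    (p := fun s y => p (T (s, y))) hm).2 hp
  have h2 : ∀ᵐ z : ℝ × Euc m, p (T z) := (Measure.ae_prod_iff_ae_ae hm).2 h1
  rw [← hT.map_eq]
  exact (ae_map_iff hTm.aemeasurable hpm).2 h2

theorem ae_inner_eq_inner_gradient {u : Euc (m + 1) → ℝ} {g : Euc (m + 1) → Euc (m + 1)}
    (hu : Measurable u) (hg : Measurable g) (hug : HasWeakGradient u g)
    (hd : ∀ᵐ x, DifferentiableAt ℝ u x) {e : Euc (m + 1)} (he : ‖e‖ = 1) :
    ∀ᵐ x, ⟪g x, e⟫ = ⟪gradient u x, e⟫ := by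
  obtain ⟨T, hT, hTe, -, -⟩ := exists_lineCoords e he
  refine ae_of_ae_ae_lineCoords hT (measurableSet_eq_fun (hg.inner measurable_const)
    ((measurable_gradient u).inner measurable_const)) ?_
  filter_upwards [(exists_injOn_cover hu hg hug hT hTe).1, ae_ae_lineCoords_of_ae hT hd]
    with y ⟨w, hw⟩ hdy
  set D : Set ℝ := {s | u (T (s, y)) = w s} with hD
  have hDae : ∀ᵐ s : ℝ, s ∈ D := hw.mono fun s hs => hs.1
  have hDd : Dense D := Measure.dense_of_ae hDae
  filter_upwards [hw, hdy] with s hs hds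
  have h1 := hasDerivAt_add_smul_gradient hds e
  have h2 : HasDerivAt (fun τ : ℝ => u (T (s, y) + (τ - s) • e)) ⟪gradient u (T (s, y)), e⟫ s :=
    HasDerivAt.comp_sub_const (f := fun τ : ℝ => u (T (s, y) + τ • e)) s s
      (by rw [sub_self]; exact h1)
  have h3 : HasDerivWithinAt w ⟪gradient u (T (s, y)), e⟫ D s := by
    refine h2.hasDerivWithinAt.congr (fun τ hτ => ?_) ?_
    · have h4 : u (T (τ, y)) = w τ := hτ
      rw [← h4, hTe s, hTe τ, sub_smul]
      congr 1
      abel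
    · rw [sub_self, zero_smul, add_zero, hs.1]
  have hacc : UniqueDiffWithinAt ℝ D s := by
    rw [uniqueDiffWithinAt_iff_accPt, accPt_iff_frequently]
    have h5 : ∃ᶠ z in 𝓝[≠] s, z ∈ D := by
      rw [frequently_iff]
      intro U hU
      obtain ⟨V, hV, hVU⟩ := mem_nhdsWithin.1 hU
      have h6 : (V ∩ {s}ᶜ).Nonempty := by
        have := (mem_closure_iff_nhdsWithin_neBot (s := ({s}ᶜ : Set ℝ)) (x := s)).1
          ((dense_compl_singleton s) s)
        exact (inter_mem (mem_nhdsWithin_of_mem_nhds (hV.mem_nhds hVU.1))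
          self_mem_nhdsWithin |> this.nonempty_of_mem)
      obtain ⟨z, hzD, hz⟩ := hDd.inter_open_nonempty _ (hV.inter isOpen_compl_singleton) h6
      exact ⟨z, hVU.2 hzD, hz⟩
    rw [frequently_nhdsWithin_iff] at h5
    exact h5.mono fun z hz => ⟨hz.2, hz.1⟩
  exact hacc.eq_deriv _ hs.2.hasDerivWithinAt h3

theorem ae_eq_gradient_of_ae_differentiableAt {u : Euc (m + 1) → ℝ}
    {g : Euc (m + 1) → Euc (m + 1)} (hu : Measurable u) (hug : HasWeakGradient u g)
    (hd : ∀ᵐ x, DifferentiableAt ℝ u x) : g =ᵐ[volume] gradient u := by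
  have hgs := hug.2.1.aestronglyMeasurable
  have h1 : ∀ᵐ x, ∀ i : Fin (m + 1), ⟪hgs.mk g x, EuclideanSpace.basisFun (Fin (m + 1)) ℝ i⟫ =
      ⟪gradient u x, EuclideanSpace.basisFun (Fin (m + 1)) ℝ i⟫ := ae_all_iff.2 fun i =>
    ae_inner_eq_inner_gradient hu hgs.stronglyMeasurable_mk.measurable
      (hug.congr_ae hgs.ae_eq_mk) hd ((EuclideanSpace.basisFun (Fin (m + 1)) ℝ).norm_eq_one i)
  filter_upwards [h1, hgs.ae_eq_mk] with x hx hx'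
  rw [hx']
  ext i
  simpa only [EuclideanSpace.basisFun_apply, EuclideanSpace.inner_single_right, one_mul,
    conj_trivial] using hx i

theorem eqOn_of_antitoneOn_of_ae_eq {f w : ℝ → ℝ} {U : Set ℝ} (hU : IsOpen U)
    (hf : AntitoneOn f U) (hw : Continuous w) (hfw : ∀ᵐ s : ℝ, f s = w s) : EqOn f w U := by
  intro s hs
  refine le_antisymm ?_ ?_
  · by_contra! hlt
    have h1 : ∀ᶠ z in 𝓝[<] s, w z < f s ∧ z ∈ U :=
      ((hw.continuousAt.eventually_lt_const hlt).and (hU.mem_nhds hs)).filter_mono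
        nhdsWithin_le_nhds
    obtain ⟨a, ha, h2⟩ := (mem_nhdsLT_iff_exists_Ioo_subset).1 h1
    obtain ⟨z, hz, hz'⟩ : ∃ z ∈ Ioo a s, f z = w z := by
      by_contra! h3
      have h4 : volume (Ioo a s) = 0 := measure_mono_null (fun z hz => h3 z hz) (ae_iff.1 hfw)
      rw [Real.volume_Ioo, ENNReal.ofReal_eq_zero] at h4
      exact absurd (mem_Iio.1 ha) (not_lt.2 (by linarith))
    have h5 := h2 hz
    have h6 := hf h5.2 hs hz.2.le
    rw [hz'] at h6
    exact absurd h5.1 (not_lt.2 h6)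
  · by_contra! hlt
    have h1 : ∀ᶠ z in 𝓝[>] s, f s < w z ∧ z ∈ U :=
      ((hw.continuousAt.eventually_const_lt hlt).and (hU.mem_nhds hs)).filter_mono
        nhdsWithin_le_nhds
    obtain ⟨a, ha, h2⟩ := (mem_nhdsGT_iff_exists_Ioo_subset).1 h1
    obtain ⟨z, hz, hz'⟩ : ∃ z ∈ Ioo s a, f z = w z := by
      by_contra! h3
      have h4 : volume (Ioo s a) = 0 := measure_mono_null (fun z hz => h3 z hz) (ae_iff.1 hfw)
      rw [Real.volume_Ioo, ENNReal.ofReal_eq_zero] at h4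
      exact absurd (mem_Ioi.1 ha) (not_lt.2 (by linarith))
    have h5 := h2 hz
    have h6 := hf hs h5.2 hz.1.le
    rw [hz'] at h6
    exact absurd h5.1 (not_lt.2 h6)

end

section

variable {m : ℕ} {K : Set (Euc (m + 1))}

theorem volume_setOf_mem_eq_zero_of_slope {h : ℝ → ℝ}
    (hs : ∀ s s', 0 < s → s ≤ s' → (h s - h 0) * (s' - s) ≤ s * (h s' - h s)) {N : Set ℝ}
    (hN : volume N = 0) : volume {s | 0 < s ∧ h 0 < h s ∧ h s ∈ N} = 0 := by
  set E : ℕ → Set ℝ := fun j =>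
    {s | 0 < s ∧ s ≤ (j : ℝ) + 1 ∧ 1 / ((j : ℝ) + 1) ≤ h s - h 0 ∧ h s ∈ N} with hE
  have hsub : {s | 0 < s ∧ h 0 < h s ∧ h s ∈ N} ⊆ ⋃ j, E j := by
    rintro s ⟨hs0, hs1, hs2⟩
    obtain ⟨i, hi⟩ := exists_nat_gt s
    obtain ⟨j, hj⟩ := exists_nat_one_div_lt (sub_pos.2 hs1)
    refine mem_iUnion.2 ⟨max i j, hs0, ?_, ?_, hs2⟩
    · have : (i : ℝ) ≤ (max i j : ℕ) := Nat.cast_le.2 (le_max_left _ _)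
      linarith
    · exact (Nat.one_div_le_one_div (le_max_right i j)).trans hj.le
  refine measure_mono_null hsub (measure_iUnion_null fun j => ?_)
  have hj : (0 : ℝ) < (j : ℝ) + 1 := by positivity
  have key : ∀ s ∈ E j, ∀ s' ∈ E j, s ≤ s' → s' - s ≤ ((j : ℝ) + 1) ^ 2 * (h s' - h s) := by
    rintro s ⟨h1, h2, h3, -⟩ s' - hss
    have h4 := hs s s' h1 hss
    have h5 : 1 / ((j : ℝ) + 1) * (s' - s) ≤ s * (h s' - h s) :=
      (mul_le_mul_of_nonneg_right h3 (sub_nonneg.2 hss)).trans h4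
    have h6 : 0 ≤ h s' - h s := by
      refine nonneg_of_mul_nonneg_right (le_trans ?_ h5) h1
      have := sub_nonneg.2 hss
      positivity
    have h7 := h5.trans (mul_le_mul_of_nonneg_right h2 h6)
    rw [one_div, inv_mul_le_iff₀ hj] at h7
    linarith
  have h1 := hausdorffMeasure_le_mul_image (m := 1) (P := h) (E := E j)
    (M := ⟨((j : ℝ) + 1) ^ 2, by positivity⟩) fun s hs s' hs' => by
      rw [Real.dist_eq, Real.dist_eq]
      rcases le_total s s' with hle | hle
      · rw [abs_sub_comm, abs_of_nonneg (sub_nonneg.2 hle), abs_sub_comm (h s)]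
        exact (key s hs s' hs' hle).trans
          (mul_le_mul_of_nonneg_left (le_abs_self _) (by positivity))
      · rw [abs_of_nonneg (sub_nonneg.2 hle)]
        exact (key s' hs' s hs hle).trans
          (mul_le_mul_of_nonneg_left (le_abs_self _) (by positivity))
  rw [Nat.cast_one, hausdorffMeasure_real] at h1
  have h2 : volume (h '' E j) = 0 := measure_mono_null (by rintro _ ⟨s, hs, rfl⟩; exact hs.2.2.2) hN
  rw [h2, mul_zero] at h1
  exact le_antisymm h1 bot_le

theorem volume_image_eq_zero_of_hasWeakGradient_comp_gauge (hK : IsConvexBody K)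
    (h0 : (0 : Euc (m + 1)) ∈ interior K) {φ : ℝ → ℝ} (hφ : AntitoneOn φ (Ioi 0))
    {g : Euc (m + 1) → Euc (m + 1)} (hf : Measurable fun x => φ (gauge K x))
    (hg : HasWeakGradient (fun x => φ (gauge K x)) g) {N : Set ℝ} (hN0 : N ⊆ Ioi 0)
    (hN : volume N = 0) : volume (φ '' N) = 0 := by
  have hgs := hg.2.1.aestronglyMeasurable
  have hgc := continuous_gauge_convexBody hK h0
  have habs := absorbent_nhds_zero (𝕜 := ℝ) (mem_interior_iff_mem_nhds.1 h0)
  have hadd : ∀ x y, gauge K (x + y) ≤ gauge K x + gauge K y := gauge_add_le hK.2 habs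
  set e : Euc (m + 1) := EuclideanSpace.single 0 1 with he
  have he1 : ‖e‖ = 1 := by simp [he]
  have hge : 0 < gauge K e := (gauge_pos_iff_ne_zero hK h0).2 (norm_pos_iff.1 (he1 ▸ one_pos))
  obtain ⟨T, hT, hTe, -, -⟩ := exists_lineCoords e he1
  obtain ⟨hli, b, -, hub⟩ := exists_absolutelyContinuous_lines hf
    hgs.stronglyMeasurable_mk.measurable (hg.congr_ae hgs.ae_eq_mk) hT hTe
  have hline : ∀ᵐ y : Euc m, volume (φ '' (N ∩ Ioi (gauge K (T (0, y))))) = 0 := by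
    filter_upwards [hli, hub] with y hy hy'
    set k : ℝ → ℝ := fun s => ⟪hgs.mk g (T (s, y)), e⟫ with hk
    set w : ℝ → ℝ := fun s => b y + ∫ τ in (0 : ℝ)..s, k τ with hw
    have hwc : Continuous w := continuous_const.add
      (intervalIntegral.continuous_primitive (fun c d =>
        (hy.integrableOn_isCompact isCompact_uIcc).intervalIntegrable) 0)
    set h : ℝ → ℝ := fun s => gauge K (T (s, y)) with hh
    have hhc : Continuous h := hgc.comp (T.continuous.comp (by fun_prop))
    have hslope : ∀ s s', 0 < s → s ≤ s' → (h s - h 0) * (s' - s) ≤ s * (h s' - h s) := by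
      intro s s' hs hss
      have hs' : 0 < s' := hs.trans_le hss
      have h1 : s' • T (s, y) = (s' - s) • T (0, y) + s • T (s', y) := by
        rw [hTe s, hTe s', smul_add, smul_add, smul_smul, smul_smul, sub_smul, mul_comm]
        abel
      have h2 : s' * h s ≤ (s' - s) * h 0 + s * h s' := by
        have h3 := hadd ((s' - s) • T (0, y)) (s • T (s', y))
        rw [← h1, gauge_smul_of_nonneg hs'.le, gauge_smul_of_nonneg (sub_nonneg.2 hss),
          gauge_smul_of_nonneg hs.le] at h3
        exact h3
      nlinarith
    set U : Set ℝ := {s | 0 < s ∧ h 0 < h s} with hU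
    have hUo : IsOpen U :=
      (isOpen_lt continuous_const continuous_id).inter (isOpen_lt continuous_const hhc)
    have hh0 : 0 ≤ h 0 := gauge_nonneg _
    have hanti : AntitoneOn (fun s => φ (h s)) U := by
      intro s hs s' hs' hss
      refine hφ (hh0.trans_lt hs.2) (hh0.trans_lt hs'.2) ?_
      have h1 := hslope s s' hs.1 hss
      have h2 : 0 ≤ (h s - h 0) * (s' - s) :=
        mul_nonneg (sub_nonneg.2 hs.2.le) (sub_nonneg.2 hss)
      exact sub_nonneg.1 (nonneg_of_mul_nonneg_right (h2.trans h1) hs.1)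
    have hEq := eqOn_of_antitoneOn_of_ae_eq hUo hanti hwc hy'
    have hnull := volume_image_eq_zero_of_eq_integral (w := w) hy (fun s => rfl)
      (volume_setOf_mem_eq_zero_of_slope hslope hN)
    refine measure_mono_null ?_ hnull
    rintro _ ⟨r, ⟨hrN, hr⟩, rfl⟩
    have hr0 : h 0 < r := hr
    set S : ℝ := (r + gauge K (-T (0, y))) / gauge K e with hS
    have hS0 : 0 ≤ S :=
      div_nonneg (add_nonneg (hh0.trans hr0.le) (gauge_nonneg _)) hge.le
    have hSr : r ≤ h S := by
      have h1 := hadd (T (S, y)) (-T (0, y))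
      rw [hTe S, add_neg_cancel_right, gauge_smul_of_nonneg hS0, smul_eq_mul, hS,
        div_mul_cancel₀ _ hge.ne', ← hS, ← hTe S] at h1
      show r ≤ gauge K (T (S, y))
      linarith
    obtain ⟨s, hs, hsr⟩ := intermediate_value_Icc hS0 hhc.continuousOn ⟨hr0.le, hSr⟩
    have hs0 : 0 < s := by
      refine hs.1.lt_of_ne fun h1 => ?_
      rw [← h1] at hsr
      exact hr0.ne hsr
    have hsU : s ∈ U := ⟨hs0, hsr ▸ hr0⟩
    exact ⟨s, ⟨hs0, hsU.2, hsr ▸ hrN⟩, by rw [← hEq hsU]; exact congrArg φ hsr⟩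
  have hcover : φ '' N ⊆ ⋃ j : ℕ, φ '' (N ∩ Ioi (1 / ((j : ℝ) + 1))) := by
    rintro _ ⟨r, hr, rfl⟩
    obtain ⟨j, hj⟩ := exists_nat_one_div_lt (mem_Ioi.1 (hN0 hr))
    exact mem_iUnion.2 ⟨j, r, ⟨hr, hj⟩, rfl⟩
  refine measure_mono_null hcover (measure_iUnion_null fun j => ?_)
  have hcont : Continuous fun y : Euc m => gauge K (T (0, y)) :=
    hgc.comp (T.continuous.comp (by fun_prop))
  have hopen : IsOpen {y : Euc m | gauge K (T (0, y)) < 1 / ((j : ℝ) + 1)} :=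
    isOpen_lt hcont continuous_const
  have hne : {y : Euc m | gauge K (T (0, y)) < 1 / ((j : ℝ) + 1)}.Nonempty := by
    refine ⟨0, ?_⟩
    have h1 : T (0, 0) = 0 := map_zero T
    rw [Set.mem_ofPred_eq, h1, gauge_zero]
    positivity
  obtain ⟨y, hyo, hy⟩ := (Measure.dense_of_ae hline).inter_open_nonempty _ hopen hne
  exact measure_mono_null (image_mono (inter_subset_inter_right N (Ioi_subset_Ioi (le_of_lt hyo)))) hy

end

section

variable {m : ℕ} {K : Set (Euc (m + 1))} {u : Euc (m + 1) → ℝ}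

theorem exists_hausdorffMeasure_eq_smul (n : ℕ) :
    ∃ κ : ℝ≥0∞, κ ≠ ⊤ ∧ (μH[(n : ℝ)] : Measure (Euc n)) = κ • volume := by
  have h1 : (μH[(Module.finrank ℝ (Euc n) : ℝ)] : Measure (Euc n)).IsAddHaarMeasure := inferInstance
  rw [finrank_euclideanSpace_fin] at h1
  exact ⟨Measure.addHaarScalarFactor μH[(n : ℝ)] volume, ENNReal.coe_ne_top,
    Measure.isAddLeftInvariant_eq_smul μH[(n : ℝ)] volume⟩

theorem hausdorffMeasure_eq_zero_of_volume_eq_zero {n : ℕ} {N : Set (Euc n)} (hN : volume N = 0) :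
    μH[(n : ℝ)] N = 0 := by
  obtain ⟨κ, -, hκ⟩ := exists_hausdorffMeasure_eq_smul n
  rw [hκ, Measure.smul_apply, hN, smul_zero]

theorem measurable_funcSymm (hK : IsConvexBody K) (h0 : (0 : Euc (m + 1)) ∈ interior K)
    (hu : MemMd u) : Measurable (funcSymm K u) := by
  have hv : 0 < (volume K).toReal :=
    ENNReal.toReal_pos (volume_convexBody_pos h0).ne' (volume_convexBody_ne_top hK)
  have hgm : Measurable (gauge K) := (continuous_gauge_convexBody hK h0).measurable
  refine measurable_of_Iic fun t => ?_
  have h1 : funcSymm K u ⁻¹' Iic t = ({0} ∩ funcSymm K u ⁻¹' Iic t) ∪ ({0}ᶜ ∩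
      {x | distFn u t ≤ ENNReal.ofReal ((volume K).toReal * gauge K x ^ (m + 1))}) := by
    ext x
    by_cases hx : x = 0
    · subst hx
      simp
    · have h2 := radProfile_le_iff (K := K) (t := t) hv hu ((gauge_pos_iff_ne_zero hK h0).2 hx)
      have h3 : x ∈ funcSymm K u ⁻¹' Iic t ↔
          distFn u t ≤ ENNReal.ofReal ((volume K).toReal * gauge K x ^ (m + 1)) := h2
      rw [h3]
      simp [hx]
  rw [h1]
  refine ((subsingleton_singleton.anti inter_subset_left).measurableSet).union
    ((measurableSet_singleton 0).compl.inter (measurableSet_le measurable_const ?_))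
  exact ((hgm.pow_const _).const_mul _).ennreal_ofReal

theorem volume_preimage_gauge_eq_zero (hK : IsConvexBody K)
    (h0 : (0 : Euc (m + 1)) ∈ interior K) {p : ℝ → Prop} (hp : ∀ᵐ r : ℝ, 0 < r → p r) :
    ∀ᵐ x : Euc (m + 1), p (gauge K x) := by
  have hgm : Measurable (gauge K) := (continuous_gauge_convexBody hK h0).measurable
  have h1 : ∀ᵐ r ∂((volume : Measure (Euc (m + 1))).map (gauge K)), p r := by
    rw [map_gauge_volume hK h0]
    exact (withDensity_absolutelyContinuous _ _).ae_le
      ((ae_restrict_iff' measurableSet_Ioi).2 hp)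
  exact ae_of_ae_map hgm.aemeasurable h1

theorem ae_differentiableAt_of_antitoneOn_Ioi {φ : ℝ → ℝ} (hφ : AntitoneOn φ (Ioi 0)) :
    ∀ᵐ r : ℝ, 0 < r → DifferentiableAt ℝ φ r := by
  have h1 : MonotoneOn (fun r => -φ r) (Ioi 0) := hφ.neg
  filter_upwards [h1.ae_differentiableWithinAt_of_mem] with r hr hr0
  have h2 := ((hr hr0).differentiableAt (Ioi_mem_nhds hr0)).neg
  have h3 : DifferentiableAt ℝ (fun r => - -φ r) r := h2
  simpa using h3

theorem deriv_nonpos_of_antitoneOn_Ioi {φ : ℝ → ℝ} (hφ : AntitoneOn φ (Ioi 0)) {r : ℝ}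
    (hr : 0 < r) : deriv φ r ≤ 0 := by
  rw [← derivWithin_of_mem_nhds (Ioi_mem_nhds hr)]
  exact hφ.derivWithin_nonpos

theorem volume_image_setOf_deriv_eq_zero (φ : ℝ → ℝ) :
    volume (φ '' {r | HasDerivAt φ 0 r}) = 0 := by
  refine addHaar_image_eq_zero_of_det_fderivWithin_eq_zero volume
    (f' := fun _ => ContinuousLinearMap.toSpanSingleton ℝ (0 : ℝ))
    (fun r hr => HasDerivAt.hasFDerivAt hr |>.hasFDerivWithinAt) fun r _ => ?_
  simp [ContinuousLinearMap.det]

theorem gradient_comp_gauge {φ : ℝ → ℝ} {x : Euc (m + 1)}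
    (hφ : DifferentiableAt ℝ φ (gauge K x)) (hx : DifferentiableAt ℝ (gauge K) x) :
    HasGradientAt (fun x => φ (gauge K x)) (deriv φ (gauge K x) • gradient (gauge K) x) x := by
  have h1 := hφ.hasDerivAt.comp_hasFDerivAt x hx.hasGradientAt.hasFDerivAt
  rw [hasGradientAt_iff_hasFDerivAt, map_smul]
  exact h1

theorem ae_eq_deriv_smul_gradient_gauge (hK : IsConvexBody K)
    (h0 : (0 : Euc (m + 1)) ∈ interior K) {φ : ℝ → ℝ} (hφ : AntitoneOn φ (Ioi 0))
    {g : Euc (m + 1) → Euc (m + 1)} (hf : Measurable fun x => φ (gauge K x))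
    (hg : HasWeakGradient (fun x => φ (gauge K x)) g) :
    ∀ᵐ x, DifferentiableAt ℝ (gauge K) x ∧
      g x = deriv φ (gauge K x) • gradient (gauge K) x := by
  obtain ⟨L, hL⟩ := exists_lipschitzWith_gauge hK h0
  have h1 : ∀ᵐ x, DifferentiableAt ℝ (gauge K) x := hL.ae_differentiableAt
  have h2 := volume_preimage_gauge_eq_zero hK h0 (ae_differentiableAt_of_antitoneOn_Ioi hφ)
  have h3 : ∀ᵐ x, HasGradientAt (fun x => φ (gauge K x))
      (deriv φ (gauge K x) • gradient (gauge K) x) x := by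
    filter_upwards [h1, h2] with x hx hx' using gradient_comp_gauge hx' hx
  filter_upwards [h1, h3, ae_eq_gradient_of_ae_differentiableAt hf hg
    (h3.mono fun x hx => hx.differentiableAt)] with x hx hx' hx''
  exact ⟨hx, hx''.trans hx'.gradient⟩

theorem ae_level_of_funcSymm (hK : IsConvexBody K) (h0 : (0 : Euc (m + 1)) ∈ interior K)
    (hu : MemMd u) {g : Euc (m + 1) → Euc (m + 1)} (hg : HasWeakGradient (funcSymm K u) g)
    {κ : ℝ≥0∞} (hκ : (μH[(m : ℝ)] : Measure (Euc m)) = κ • volume) :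
    ∀ᵐ t : ℝ, ∀ r : ℝ, 0 < r → radProfile K u r = t → ∃ a : ℝ, 0 < a ∧
      HasDerivAt (radProfile K u) (-a) r ∧
      μH[(m : ℝ)] ({x | ¬(DifferentiableAt ℝ (gauge K) x ∧
        g x = (-a) • gradient (gauge K) x)} ∩ gauge K ⁻¹' {r}) = 0 ∧
      ∫⁻ x in {x | gauge K x = r ∧ DifferentiableAt ℝ (gauge K) x},
          (ENNReal.ofReal ‖gradient (gauge K) x‖)⁻¹ ∂μH[(m : ℝ)] ≤
        κ * ENNReal.ofReal ((m + 1) * (volume K).toReal * r ^ m) := by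
  have hv : 0 < (volume K).toReal :=
    ENNReal.toReal_pos (volume_convexBody_pos h0).ne' (volume_convexBody_ne_top hK)
  set φ := radProfile K u with hφdef
  have hφ : AntitoneOn φ (Ioi 0) := antitoneOn_radProfile hv hu
  have hf := measurable_funcSymm hK h0 hu
  obtain ⟨L, hL⟩ := exists_lipschitzWith_gauge hK h0
  set N : Set (Euc (m + 1)) := {x | ¬(DifferentiableAt ℝ (gauge K) x ∧
    g x = deriv φ (gauge K x) • gradient (gauge K) x)} with hN
  have hN0 : volume N = 0 := ae_iff.1 (ae_eq_deriv_smul_gradient_gauge hK h0 hφ hf hg)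
  have hslice := ae_hausdorffMeasure_slice_eq_zero hL
    (hausdorffMeasure_eq_zero_of_volume_eq_zero hN0)
  have hgood : ∀ᵐ r : ℝ, 0 < r → DifferentiableAt ℝ φ r ∧
      μH[(m : ℝ)] (N ∩ gauge K ⁻¹' {r}) = 0 ∧
      ∫⁻ x in {x | gauge K x = r ∧ DifferentiableAt ℝ (gauge K) x},
          (ENNReal.ofReal ‖gradient (gauge K) x‖)⁻¹ ∂μH[(m : ℝ)] ≤
        κ * ENNReal.ofReal ((m + 1) * (volume K).toReal * r ^ m) := by
    filter_upwards [hslice, ae_differentiableAt_of_antitoneOn_Ioi hφ,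
      ae_setLIntegral_gauge_le hK h0 hκ] with r h1 h2 h3 hr
    exact ⟨h2 hr, h1, h3 hr⟩
  have hbad := volume_image_eq_zero_of_hasWeakGradient_comp_gauge hK h0 hφ hf hg
    (N := {r | ¬(0 < r → _)}) (fun r hr => (Classical.not_imp.1 hr).1) (ae_iff.1 hgood)
  filter_upwards [compl_mem_ae_iff.2 hbad, compl_mem_ae_iff.2 (volume_image_setOf_deriv_eq_zero φ)]
    with t ht1 ht2 r hr hrt
  have h1 : _ := not_not.1 fun h => ht1 ⟨r, h, hrt⟩
  obtain ⟨hd, hs, ha⟩ := h1 hr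
  have hne : deriv φ r ≠ 0 := fun h => ht2 ⟨r, h ▸ hd.hasDerivAt, hrt⟩
  have hlt := (deriv_nonpos_of_antitoneOn_Ioi hφ hr).lt_of_ne hne
  refine ⟨-deriv φ r, neg_pos.2 hlt, by rw [neg_neg]; exact hd.hasDerivAt, ?_, ha⟩
  refine measure_mono_null ?_ hs
  rintro x ⟨hx, hxr⟩
  refine ⟨fun h => hx ⟨h.1, ?_⟩, hxr⟩
  have h3 : gauge K x = r := hxr
  rw [neg_neg, h.2, h3]

end

section

variable {m : ℕ} {K : Set (Euc (m + 1))} {Φ : Euc (m + 1) → ℝ≥0∞}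

theorem lowerSemicontinuous_yconj {n : ℕ} (Φ : Euc n → ℝ≥0∞) : LowerSemicontinuous (yconj Φ) := by
  refine lowerSemicontinuous_iSup fun η => Continuous.lowerSemicontinuous ?_
  have h1 : Continuous fun ξ : Euc n => ENNReal.ofReal ⟪ξ, η⟫ :=
    ENNReal.continuous_ofReal.comp (by fun_prop)
  exact (ENNReal.continuous_sub_right (Φ η)).comp h1

theorem yconj_zero {n : ℕ} (Φ : Euc n → ℝ≥0∞) : yconj Φ 0 = 0 := by
  simp [yconj]

/-- A sublevel set of the Young conjugate, truncated to a ball. -/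
def truncSublevel (Φ : Euc (m + 1) → ℝ≥0∞) (q : ℝ≥0) (R : ℕ) : Set (Euc (m + 1)) :=
  {η | yconj Φ η ≤ q} ∩ Metric.closedBall 0 R

/-- The volume radius of `truncSublevel`, normalized so that the unit cube has radius one. -/
def truncRadius (Φ : Euc (m + 1) → ℝ≥0∞) (q : ℝ≥0) (R : ℕ) : ℝ :=
  (volume (truncSublevel Φ q R)).toReal ^ ((1 : ℝ) / (m + 1 : ℕ))

theorem isCompact_truncSublevel (q : ℝ≥0) (R : ℕ) : IsCompact (truncSublevel Φ q R) :=
  (isCompact_closedBall 0 (R : ℝ)).inter_left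
    ((lowerSemicontinuous_yconj Φ).isClosed_preimage (q : ℝ≥0∞))

theorem zero_mem_truncSublevel (q : ℝ≥0) (R : ℕ) : 0 ∈ truncSublevel Φ q R :=
  ⟨by simp [yconj_zero], by simp⟩

theorem ofReal_truncRadius_pow (q : ℝ≥0) (R : ℕ) :
    ENNReal.ofReal (truncRadius Φ q R ^ (m + 1)) = volume (truncSublevel Φ q R) := by
  rw [truncRadius, one_div, Real.rpow_inv_natCast_pow ENNReal.toReal_nonneg m.succ_ne_zero,
    ENNReal.ofReal_toReal (isCompact_truncSublevel q R).measure_lt_top.ne]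

theorem exists_le_truncRadius (hK : IsConvexBody K) (h0 : (0 : Euc (m + 1)) ∈ interior K)
    {q : ℝ≥0} {h H : ℝ} (hh : 0 ≤ h) (hH : h < H)
    (hle : volume K * ENNReal.ofReal (H ^ (m + 1)) ≤ volume {η | yconj Φ η ≤ q}) :
    ∃ R : ℕ, (volume K).toReal ^ ((1 : ℝ) / (m + 1 : ℕ)) * h ≤ truncRadius Φ q R := by
  have hKt := volume_convexBody_ne_top hK
  have hK0 := (volume_convexBody_pos h0).ne'
  have h1 : volume K * ENNReal.ofReal (h ^ (m + 1)) < volume {η | yconj Φ η ≤ q} := by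
    refine lt_of_lt_of_le ?_ hle
    refine ENNReal.mul_lt_mul_right hK0 hKt ?_
    exact (ENNReal.ofReal_lt_ofReal_iff (pow_pos (hh.trans_lt hH) _)).2
      (pow_lt_pow_left₀ hH hh m.succ_ne_zero)
  have h2 : {η | yconj Φ η ≤ q} = ⋃ R : ℕ, truncSublevel Φ q R := by
    simp only [truncSublevel]
    rw [← inter_iUnion, Metric.iUnion_closedBall_nat, inter_univ]
  have hmono : Monotone (truncSublevel Φ q) := fun R R' hR =>
    inter_subset_inter_right _ (Metric.closedBall_subset_closedBall (Nat.cast_le.2 hR))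
  rw [h2, hmono.measure_iUnion, lt_iSup_iff] at h1
  obtain ⟨R, hR⟩ := h1
  refine ⟨R, ?_⟩
  have h3 := ENNReal.toReal_mono (isCompact_truncSublevel q R).measure_lt_top.ne hR.le
  rw [ENNReal.toReal_mul, ENNReal.toReal_ofReal (by positivity)] at h3
  refine le_trans (le_of_eq ?_) (Real.rpow_le_rpow (by positivity) h3 (by positivity))
  rw [Real.mul_rpow (by positivity) (by positivity), one_div,
    Real.pow_rpow_inv_natCast hh m.succ_ne_zero]

theorem volume_mul_le_of_youngSymm_lt {Ψ : Euc (m + 1) → ℝ≥0∞} {η : Euc (m + 1)} {q : ℝ≥0∞}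
    (h : youngSymm K Ψ η < q) :
    volume K * ENNReal.ofReal (gauge K (-η) ^ (m + 1)) ≤ volume {ζ | Ψ ζ ≤ q} := by
  obtain ⟨s, hs, hsq⟩ := sInf_lt_iff.1 h
  exact le_trans hs (measure_mono fun ζ hζ => le_trans hζ hsq.le)

theorem mul_iSup_gauge_sub_youngSymm_le (hK : IsConvexBody K)
    (h0 : (0 : Euc (m + 1)) ∈ interior K) {κ I : ℝ≥0∞} (hκ : κ ≠ ⊤) {r a : ℝ} (hr : 0 < r)
    (ha : 0 < a)
    (h : ∀ (p : ℚ) (R : ℕ), κ * ENNReal.ofReal ((m + 1) *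
        ((volume K).toReal ^ ((1 : ℝ) / (m + 1 : ℕ)) * r) ^ m *
          truncRadius Φ (p : ℝ).toNNReal R) ≤
      I + κ * (ENNReal.ofReal p * ENNReal.ofReal ((m + 1) * (volume K).toReal * r ^ m / a))) :
    (⨆ η, (ENNReal.ofReal (a * gauge K (-η)) - youngSymm K (yconj Φ) η)) / ENNReal.ofReal a *
      (κ * ENNReal.ofReal ((m + 1) * (volume K).toReal * r ^ m)) ≤ I := by
  set k := (volume K).toReal with hk
  have hk0 : 0 ≤ k := ENNReal.toReal_nonneg
  set D := κ * ENNReal.ofReal ((m + 1) * k * r ^ m / a) with hD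
  have hDt : D ≠ ⊤ := ENNReal.mul_ne_top hκ ENNReal.ofReal_ne_top
  have hD' : ∀ B : ℝ≥0∞, B / ENNReal.ofReal a * (κ * ENNReal.ofReal ((m + 1) * k * r ^ m)) =
      D * B := fun B => by
    rw [hD, ENNReal.ofReal_div_of_pos ha, div_eq_mul_inv, div_eq_mul_inv]
    ring
  rw [hD', ENNReal.mul_iSup]
  refine iSup_le fun η => ?_
  set ψ := youngSymm K (yconj Φ) η with hψ
  rcases eq_or_ne ψ ⊤ with htop | htop
  · simp [htop]
  rw [ENNReal.mul_sub fun _ _ => hDt, tsub_le_iff_right]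
  have hstep : ∀ s : ℝ, ψ.toReal < s → ∀ b : ℝ, b < gauge K (-η) →
      D * ENNReal.ofReal (a * b) ≤ I + D * ENNReal.ofReal s := by
    intro s hs b hb
    rcases le_or_gt b 0 with hb0 | hb0
    · rw [ENNReal.ofReal_of_nonpos (mul_nonpos_of_nonneg_of_nonpos ha.le hb0), mul_zero]
      exact zero_le
    obtain ⟨p, hp1, hp2⟩ := exists_rat_btwn hs
    have hlt : ψ < ((p : ℝ).toNNReal : ℝ≥0∞) := by
      rw [← ENNReal.ofReal_toReal htop]
      exact (ENNReal.ofReal_lt_ofReal_iff (lt_of_le_of_lt ENNReal.toReal_nonneg hp1)).2 hp1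
    obtain ⟨R, hR⟩ := exists_le_truncRadius hK h0 hb0.le hb (volume_mul_le_of_youngSymm_lt hlt)
    calc D * ENNReal.ofReal (a * b)
        = κ * ENNReal.ofReal ((m + 1) * (k ^ ((1 : ℝ) / (m + 1 : ℕ)) * r) ^ m *
            (k ^ ((1 : ℝ) / (m + 1 : ℕ)) * b)) := by
          rw [hD, mul_assoc, ← ENNReal.ofReal_mul (by positivity)]
          congr 2
          have h1 : (k ^ ((1 : ℝ) / (m + 1 : ℕ))) ^ (m + 1) = k := by
            rw [one_div, Real.rpow_inv_natCast_pow hk0 m.succ_ne_zero]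
          nth_rewrite 1 [← h1]
          field_simp
          ring
      _ ≤ κ * ENNReal.ofReal ((m + 1) * (k ^ ((1 : ℝ) / (m + 1 : ℕ)) * r) ^ m *
            truncRadius Φ (p : ℝ).toNNReal R) := by
          refine mul_le_mul_right (ENNReal.ofReal_le_ofReal ?_) κ
          exact mul_le_mul_of_nonneg_left hR (by positivity)
      _ ≤ I + κ * (ENNReal.ofReal p * ENNReal.ofReal ((m + 1) * k * r ^ m / a)) := h p R
      _ ≤ I + D * ENNReal.ofReal s := by
          refine add_le_add le_rfl (le_of_eq_of_le ?_
            (mul_le_mul_right (ENNReal.ofReal_le_ofReal hp2.le) D))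
          rw [hD]
          ring
  have h1 : ∀ s : ℝ, ψ.toReal < s →
      D * ENNReal.ofReal (a * gauge K (-η)) ≤ I + D * ENNReal.ofReal s := by
    intro s hs
    have hc : Tendsto (fun b : ℝ => D * ENNReal.ofReal (a * b)) (𝓝[<] (gauge K (-η)))
        (𝓝 (D * ENNReal.ofReal (a * gauge K (-η)))) := by
      refine (ENNReal.Tendsto.const_mul ?_ (Or.inr hDt))
      exact (ENNReal.continuous_ofReal.comp (continuous_const_mul a)).continuousAt.tendsto.mono_left
        nhdsWithin_le_nhds
    exact le_of_tendsto hc (eventually_nhdsWithin_of_forall fun b hb => hstep s hs b hb)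
  have hc : Tendsto (fun s : ℝ => I + D * ENNReal.ofReal s) (𝓝[>] ψ.toReal)
      (𝓝 (I + D * ENNReal.ofReal ψ.toReal)) := by
    refine Tendsto.const_add _ (ENNReal.Tendsto.const_mul ?_ (Or.inr hDt))
    exact ENNReal.continuous_ofReal.continuousAt.tendsto.mono_left nhdsWithin_le_nhds
  rw [ENNReal.ofReal_toReal htop] at hc
  exact ge_of_tendsto hc (eventually_nhdsWithin_of_forall fun s hs => h1 s hs)

theorem setLIntegral_yconj_div_le (hK : IsConvexBody K) (h0 : (0 : Euc (m + 1)) ∈ interior K)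
    (Ψ : Euc (m + 1) → ℝ≥0∞) (g : Euc (m + 1) → Euc (m + 1)) {r a : ℝ} (ha : 0 < a)
    (hg : μH[(m : ℝ)] ({x | ¬(DifferentiableAt ℝ (gauge K) x ∧
        g x = (-a) • gradient (gauge K) x)} ∩ gauge K ⁻¹' {r}) = 0) :
    ∫⁻ x in {x | gauge K x = r}, yconj Ψ (g x) / ENNReal.ofReal ‖g x‖ ∂μH[(m : ℝ)] ≤
      (⨆ η, (ENNReal.ofReal (a * gauge K (-η)) - Ψ η)) / ENNReal.ofReal a *
        ∫⁻ x in {x | gauge K x = r ∧ DifferentiableAt ℝ (gauge K) x},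
          (ENNReal.ofReal ‖gradient (gauge K) x‖)⁻¹ ∂μH[(m : ℝ)] := by
  set B := ⨆ η, (ENNReal.ofReal (a * gauge K (-η)) - Ψ η) with hB
  have ha' : ENNReal.ofReal a ≠ 0 := (ENNReal.ofReal_pos.2 ha).ne'
  have hm : Measurable fun x => (ENNReal.ofReal ‖gradient (gauge K) x‖)⁻¹ :=
    (measurable_gradient (gauge K)).norm.ennreal_ofReal.inv
  set S : Set (Euc (m + 1)) := {x | gauge K x = r ∧ DifferentiableAt ℝ (gauge K) x ∧
    g x = (-a) • gradient (gauge K) x} with hS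
  have hae : ({x | gauge K x = r} : Set (Euc (m + 1))) =ᵐ[μH[(m : ℝ)]] S := by
    refine ae_eq_set.2 ⟨measure_mono_null ?_ hg, ?_⟩
    · rintro x ⟨hx, hx'⟩
      exact ⟨fun h => hx' ⟨hx, h⟩, hx⟩
    · rw [sdiff_eq_empty.2 fun x hx => hx.1, measure_empty]
  rw [setLIntegral_congr hae]
  refine le_trans (setLIntegral_mono (hm.const_mul (B / ENNReal.ofReal a)) ?_) ?_
  · rintro x ⟨-, hx, hgx⟩
    have h1 : yconj Ψ (g x) ≤ B := by
      refine iSup_mono fun η => tsub_le_tsub_right (ENNReal.ofReal_le_ofReal ?_) _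
      rw [hgx, inner_smul_left, RCLike.conj_to_real, neg_mul, ← mul_neg, ← inner_neg_right]
      exact mul_le_mul_of_nonneg_left (inner_gradient_gauge_le hK h0 hx _) ha.le
    have h2 : ENNReal.ofReal ‖g x‖ = ENNReal.ofReal a * ENNReal.ofReal ‖gradient (gauge K) x‖ := by
      rw [hgx, norm_smul, norm_neg, Real.norm_of_nonneg ha.le, ENNReal.ofReal_mul ha.le]
    rw [h2, div_eq_mul_inv, div_eq_mul_inv,
      ENNReal.mul_inv (Or.inl ha') (Or.inl ENNReal.ofReal_ne_top), ← mul_assoc]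
    gcongr
  · rw [lintegral_const_mul _ hm]
    have hsub : S ⊆ {x | gauge K x = r ∧ DifferentiableAt ℝ (gauge K) x} :=
      fun x hx => ⟨hx.1, hx.2.1⟩
    exact mul_le_mul_right (lintegral_mono_set hsub) _

end

section

variable {m : ℕ} {K : Set (Euc (m + 1))} {u : Euc (m + 1) → ℝ}

theorem setOf_funcSymm_eq (hK : IsConvexBody K) (h0 : (0 : Euc (m + 1)) ∈ interior K)
    (hu : MemMd u) {r d : ℝ} (hr : 0 < r) (hd : HasDerivAt (radProfile K u) d r) (hd0 : d ≠ 0)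
    (h : funcSymm K u 0 ≠ radProfile K u r) :
    {x | funcSymm K u x = radProfile K u r} = {x | gauge K x = r} := by
  have hv : 0 < (volume K).toReal :=
    ENNReal.toReal_pos (volume_convexBody_pos h0).ne' (volume_convexBody_ne_top hK)
  ext x
  refine ⟨fun hx => ?_, fun hx => congrArg (radProfile K u) hx⟩
  have hx0 : x ≠ 0 := fun hx0 => h (hx0 ▸ hx)
  exact eq_of_antitoneOn_of_hasDerivAt (antitoneOn_radProfile hv hu) hr
    ((gauge_pos_iff_ne_zero hK h0).2 hx0) hd hd0 hx

theorem levelProfile_radProfile (hK : IsConvexBody K) (h0 : (0 : Euc (m + 1)) ∈ interior K)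
    (hu : MemMd u) {r d c : ℝ} (hr : 0 < r) (hd : HasDerivAt (radProfile K u) d r) (hd0 : d ≠ 0) :
    levelProfile c u (radProfile K u r) = ENNReal.ofReal ((m + 1) *
      ((volume K).toReal ^ ((1 : ℝ) / (m + 1 : ℕ)) * r) ^ m * c) := by
  have hv : 0 < (volume K).toReal :=
    ENNReal.toReal_pos (volume_convexBody_pos h0).ne' (volume_convexBody_ne_top hK)
  have h1 : 0 < (volume K).toReal * r ^ (m + 1) := by positivity
  rw [levelProfile, distFn_radProfile_eq hv hu hr hd hd0, if_neg (ENNReal.ofReal_pos.2 h1).ne',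
    ENNReal.toReal_ofReal h1.le, Real.mul_rpow hv.le (by positivity), one_div,
    Real.pow_rpow_inv_natCast hr.le m.succ_ne_zero]

theorem setLIntegral_level_le {Φ : Euc (m + 1) → ℝ≥0∞} (hK : IsConvexBody K)
    (h0 : (0 : Euc (m + 1)) ∈ interior K) (hΦ : LowerSemicontinuous Φ)
    {gu g : Euc (m + 1) → Euc (m + 1)} (hug : HasWeakGradient u gu) (hu : MemMd u)
    (hgu : Integrable gu) (hg : HasWeakGradient (funcSymm K u) g) :
    ∀ᵐ t : ℝ, eInf u < (t : EReal) →
      ∫⁻ x in {x | funcSymm K u x = t},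
          yconj (youngSymm K (yconj Φ)) (g x) / ENNReal.ofReal ‖g x‖ ∂μH[(m : ℝ)] ≤
        ∫⁻ x in {x | u x = t}, Φ (gu x) / ENNReal.ofReal ‖gu x‖ ∂μH[(m : ℝ)] := by
  obtain ⟨κ, hκt, hκ⟩ := exists_hausdorffMeasure_eq_smul m
  have hv : 0 < (volume K).toReal :=
    ENNReal.toReal_pos (volume_convexBody_pos h0).ne' (volume_convexBody_ne_top hK)
  have h1 : ∀ᵐ t : ℝ, ∀ (s p : ℚ) (R : ℕ), distFn u s ≠ ⊤ → (s : ℝ) < t →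
      κ * levelProfile (truncRadius Φ (p : ℝ).toNNReal R) u t ≤
        (∫⁻ x in {x | u x = t}, Φ (gu x) / ENNReal.ofReal ‖gu x‖ ∂μH[(m : ℝ)]) +
          κ * (ENNReal.ofReal p *
            ((volume.restrict (u ⁻¹' Ioi (s : ℝ))).map u).rnDeriv volume t) := by
    refine ae_all_iff.2 fun s => ae_all_iff.2 fun p => ae_all_iff.2 fun R => ?_
    by_cases hs : distFn u s = ⊤
    · exact ae_of_all _ fun t h => absurd hs h
    · filter_upwards [ae_mul_levelProfile_le hΦ hug hu.1 hgu hκ (isCompact_truncSublevel _ R)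
        (zero_mem_truncSublevel _ R) (Real.rpow_nonneg ENNReal.toReal_nonneg _)
        (ofReal_truncRadius_pow (p : ℝ).toNNReal R) (fun η hη => hη.1) hs] with t ht _ using ht
  have h2 : ∀ᵐ t : ℝ, ∀ s : ℚ, distFn u s ≠ ⊤ → ∀ r a : ℝ, 0 < r → 0 < a →
      radProfile K u r = t → HasDerivAt (radProfile K u) (-a) r →
      ((volume.restrict (u ⁻¹' Ioi (s : ℝ))).map u).rnDeriv volume t ≤
        ENNReal.ofReal ((m + 1) * (volume K).toReal * r ^ m / a) := by
    refine ae_all_iff.2 fun s => ?_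
    by_cases hs : distFn u s = ⊤
    · exact ae_of_all _ fun t h => absurd hs h
    · filter_upwards [ae_rnDeriv_le_of_hasDerivAt_radProfile hv hu hs] with t ht _ using ht
  have h3 : ∀ᵐ t : ℝ, t ≠ funcSymm K u 0 := by
    rw [ae_iff]
    simp
  filter_upwards [h1, h2, h3, ae_level_of_funcSymm hK h0 hu hg hκ] with t ht1 ht2 ht3 ht4 ht
  by_cases hr : ∃ r, 0 < r ∧ radProfile K u r = t
  swap
  · have hem : {x | funcSymm K u x = t} = ∅ := by
      refine eq_empty_of_forall_notMem fun x hx => ?_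
      have hx' : funcSymm K u x = t := hx
      have hx0 : x ≠ 0 := fun h => ht3 (h ▸ hx'.symm)
      exact hr ⟨gauge K x, (gauge_pos_iff_ne_zero hK h0).2 hx0, hx⟩
    rw [hem, setLIntegral_empty]
    exact zero_le
  obtain ⟨r, hr, rfl⟩ := hr
  obtain ⟨a, ha, hd, hnull, harea⟩ := ht4 r hr rfl
  obtain ⟨s, hs1, hs2⟩ := EReal.exists_rat_btwn_of_lt ht
  have hst : (s : ℝ) < radProfile K u r := EReal.coe_lt_coe_iff.1 hs2
  have hsf : distFn u s ≠ ⊤ := (hu.2 s hs1).ne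
  rw [setOf_funcSymm_eq hK h0 hu hr hd (neg_ne_zero.2 ha.ne') ht3.symm]
  refine (setLIntegral_yconj_div_le hK h0 _ g ha hnull).trans
    ((mul_le_mul_right harea _).trans
      (mul_iSup_gauge_sub_youngSymm_le hK h0 hκt hr ha fun p R => ?_))
  rw [← levelProfile_radProfile hK h0 hu hr hd (neg_ne_zero.2 ha.ne')]
  refine (ht1 s p R hsf hst).trans (add_le_add le_rfl ?_)
  gcongr
  exact ht2 s hsf r a hr ha rfl hd

end

/-- **Key level-set inequality in the proof of the anisotropic Pólya–Szegő principle.** -/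
theorem statement19 {n : ℕ} (hn : 1 ≤ n) (K : Set (Euc n)) (hK : IsConvexBody K)
    (h0K : (0 : Euc n) ∈ interior K)
    (Φ : Euc n → ℝ≥0∞) (hΦ : IsNYoung Φ)
    (u : Euc n → ℝ) (gu : Euc n → Euc n)
    (hu : MemV1d (fun ξ : Euc n => ENNReal.ofReal ‖ξ‖) u gu)
    (gK : Euc n → Euc n) (hgK : HasWeakGradient (funcSymm K u) gK) :
    ∀ᵐ t : ℝ ∂volume, eInf u < (t : EReal) → (t : EReal) < eSup u →
      ∫⁻ x in {x | funcSymm K u x = t},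
          yconj (youngSymm K (yconj Φ)) (gK x) / ENNReal.ofReal ‖gK x‖ ∂μH[(n : ℝ) - 1] ≤
        ∫⁻ x in {x | u x = t}, Φ (gu x) / ENNReal.ofReal ‖gu x‖ ∂μH[(n : ℝ) - 1] := by
  obtain ⟨m, rfl⟩ : ∃ m, n = m + 1 := ⟨n - 1, by omega⟩
  obtain ⟨hug, huM, hfin⟩ := hu
  have hgu : Integrable gu := by
    refine ⟨hug.2.1.aestronglyMeasurable, ?_⟩
    rw [hasFiniteIntegral_iff_norm]
    exact hfin
  have hm : ((m + 1 : ℕ) : ℝ) - 1 = m := by push_cast; ring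
  rw [hm]
  filter_upwards [setLIntegral_level_le hK h0K hΦ.lsc hug huM hgu hgK] with t ht h _ using ht h

end
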